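/- For a ∈ (0,a*) let u_a be a minimizer of e(a), x_a its (unique, for a near a*) global maximum point of |u_a|. Then the family {x_a} remains bounded as a ↗ a*, and V_Ω(x_a) → 0 as a ↗ a*; since V_Ω vanishes only at the origin, the concentration point x_a converges to 0. -/

import Mathlib

open MeasureTheory Filter Topology Set Metric

noncomputable section

/-- The plane `ℝ²` with the Euclidean norm. -/
abbrev Plane : Type := EuclideanSpace ℝ (Fin 2)

def e0 : Plane := EuclideanSpace.single (0 : Fin 2) (1 : ℝ)
def e1 : Plane := EuclideanSpace.single (1 : Fin 2) (1 : ℝ)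

/-- Partial derivatives of a complex-valued function. -/
def d0 (u : Plane → ℂ) (x : Plane) : ℂ := fderiv ℝ u x e0
def d1 (u : Plane → ℂ) (x : Plane) : ℂ := fderiv ℝ u x e1

/-- `|∇u|²` for complex-valued `u`. -/
def gradSq (u : Plane → ℂ) (x : Plane) : ℝ := ‖d0 u x‖ ^ 2 + ‖d1 u x‖ ^ 2

/-- `|∇|u||²`. -/
def gradAbsSq (u : Plane → ℂ) (x : Plane) : ℝ := ‖fderiv ℝ (fun y => ‖u y‖) x‖ ^ 2

/-- Membership in `H¹(ℝ², ℂ)` (smooth-representative formulation). -/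
def InH1 (u : Plane → ℂ) : Prop :=
  Differentiable ℝ u ∧ Integrable (fun x => ‖u x‖ ^ 2) ∧ Integrable (gradSq u)

/-- Membership in the space `𝓗 = {u ∈ H¹ : ∫ V |u|² < ∞}`. -/
def InH (V : Plane → ℝ) (u : Plane → ℂ) : Prop :=
  InH1 u ∧ Integrable (fun x => V x * ‖u x‖ ^ 2)

/-- The constraint set `S_a`. -/
def Sset (V : Plane → ℝ) (a : ℝ) : Set (Plane → ℂ) :=
  {u | InH V u ∧ (∫ x : Plane, ‖u x‖ ^ 2) = a}

/-- The momentum density `x^⊥ · (iu, ∇u)`, with `x^⊥ = (-x₂, x₁)` and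
`(iu,∇u)_j = Im(ū ∂_j u)`. -/
def momentum (u : Plane → ℂ) (x : Plane) : ℝ :=
  (-(x 1)) * ((starRingEnd ℂ) (u x) * d0 u x).im + (x 0) * ((starRingEnd ℂ) (u x) * d1 u x).im

/-- The logarithmic convolution term `∫∫ ln|x-y| |u(x)|²|u(y)|²`. -/
def logConv (u : Plane → ℂ) : ℝ :=
  ∫ x : Plane, ∫ y : Plane, Real.log ‖x - y‖ * ‖u x‖ ^ 2 * ‖u y‖ ^ 2

/-- The energy functional `E_a`. -/
def Ea (V : Plane → ℝ) (Ω : ℝ) (u : Plane → ℂ) : ℝ :=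
  (∫ x : Plane, (gradSq u x + V x * ‖u x‖ ^ 2)) + (1 / 2) * logConv u
    - (1 / 2) * (∫ x : Plane, ‖u x‖ ^ 4) - Ω * (∫ x : Plane, momentum u x)

/-- `u` is a minimizer of `e(a) = inf_{S_a} E_a`. -/
def IsMinimizer (V : Plane → ℝ) (Ω a : ℝ) (u : Plane → ℂ) : Prop :=
  u ∈ Sset V a ∧ ∀ v ∈ Sset V a, Ea V Ω u ≤ Ea V Ω v

/-- `e(a) = inf_{u ∈ S_a} E_a(u)`. -/
def eInf (V : Plane → ℝ) (Ω a : ℝ) : ℝ := sInf (Ea V Ω '' Sset V a)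

/-- `f(x) → ∞` as `|x| → ∞`. -/
def TendsInfty (f : Plane → ℝ) : Prop := ∀ M : ℝ, ∃ R : ℝ, ∀ x : Plane, R ≤ ‖x‖ → M ≤ f x

/-- Hypotheses (1.10): `0 ≤ V ∈ L^∞_loc` and `liminf_{|x|→∞} V(x)/|x|² > 0`. -/
def V110 (V : Plane → ℝ) : Prop :=
  Measurable V ∧ (∀ x, 0 ≤ V x) ∧
  (∀ R : ℝ, ∃ C : ℝ, ∀ x : Plane, ‖x‖ ≤ R → V x ≤ C) ∧
  (∃ c : ℝ, 0 < c ∧ ∃ R : ℝ, ∀ x : Plane, R ≤ ‖x‖ → c * ‖x‖ ^ 2 ≤ V x)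

/-- The set of rotational velocities `W > 0` with `V(x) - (W²/4)|x|² → ∞`;
`Ω* = sup RotSet V`. -/
def RotSet (V : Plane → ℝ) : Set ℝ :=
  {W : ℝ | 0 < W ∧ TendsInfty (fun x => V x - W ^ 2 / 4 * ‖x‖ ^ 2)}

/-- `Ω < Ω*` where `Ω* = sup RotSet V` (possibly `+∞`). -/
def SubCritical (V : Plane → ℝ) (Ω : ℝ) : Prop := ∃ W ∈ RotSet V, Ω < W

def d0R (q : Plane → ℝ) (x : Plane) : ℝ := fderiv ℝ q x e0
def d1R (q : Plane → ℝ) (x : Plane) : ℝ := fderiv ℝ q x e1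

/-- `|∇q|²` for real-valued `q`. -/
def gradSqR (q : Plane → ℝ) (x : Plane) : ℝ := (d0R q x) ^ 2 + (d1R q x) ^ 2

/-- The Laplacian of a real-valued function. -/
def lapR (q : Plane → ℝ) (x : Plane) : ℝ := fderiv ℝ (d0R q) x e0 + fderiv ℝ (d1R q) x e1

/-- `Q` is the positive radially symmetric `H¹` solution of `-ΔQ + Q - Q³ = 0` on `ℝ²`. -/
def IsGroundState (Q : Plane → ℝ) : Prop :=
  ContDiff ℝ 2 Q ∧ (∀ x, 0 < Q x) ∧ (∀ x y : Plane, ‖x‖ = ‖y‖ → Q x = Q y) ∧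
  Integrable (fun x => (Q x) ^ 2) ∧ Integrable (fun x => ‖fderiv ℝ Q x‖ ^ 2) ∧
  (∀ x, - lapR Q x + Q x - (Q x) ^ 3 = 0)

/-- The Laplacian of a complex-valued function. -/
def lapC (u : Plane → ℂ) (x : Plane) : ℂ := fderiv ℝ (d0 u) x e0 + fderiv ℝ (d1 u) x e1

/-- The Euler–Lagrange equation (1.18):
`-Δu + V u + (∫ ln|x-y||u(y)|² dy) u + iΩ (x^⊥·∇u) = μ u + |u|² u`. -/
def EulerLagrange (V : Plane → ℝ) (Ω : ℝ) (u : Plane → ℂ) (μ : ℝ) : Prop :=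
  ∀ x : Plane,
    - lapC u x + (V x : ℂ) * u x
      + (((∫ y : Plane, Real.log ‖x - y‖ * ‖u y‖ ^ 2) : ℝ) : ℂ) * u x
      + Complex.I * (Ω : ℂ) * (((-(x 1) : ℝ) : ℂ) * d0 u x + ((x 0 : ℝ) : ℂ) * d1 u x)
    = (μ : ℂ) * u x + ((‖u x‖ ^ 2 : ℝ) : ℂ) * u x

/-- Condition (V): `0 ≤ V_Ω ∈ C^α_loc`, `V_Ω` vanishes only at the origin, and `V` has at
most exponential growth. Here `V_Ω(x) = V(x) - (Ω²/4)|x|²`. -/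
def CondV (V : Plane → ℝ) (Ω α : ℝ) : Prop :=
  α ∈ Ioo (0 : ℝ) 1 ∧
  (∀ x : Plane, 0 ≤ V x - Ω ^ 2 / 4 * ‖x‖ ^ 2) ∧
  (∀ x : Plane, V x - Ω ^ 2 / 4 * ‖x‖ ^ 2 = 0 ↔ x = 0) ∧
  (∀ R : ℝ, 0 < R → ∃ C : ℝ, ∀ x ∈ closedBall (0 : Plane) R, ∀ y ∈ closedBall (0 : Plane) R,
    |(V x - Ω ^ 2 / 4 * ‖x‖ ^ 2) - (V y - Ω ^ 2 / 4 * ‖y‖ ^ 2)| ≤ C * ‖x - y‖ ^ α) ∧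
  (∃ C γ : ℝ, 0 < γ ∧ ∀ x : Plane, V x ≤ C * Real.exp (γ * ‖x‖))

/-- `ε_a = (∫ |∇|u_a||²)^{-1/2}` for a family of minimizers. -/
def epsOf (u : ℝ → Plane → ℂ) (a : ℝ) : ℝ :=
  (∫ x : Plane, gradAbsSq (u a) x) ^ (-(1 : ℝ) / 2)

/-- The rescaled family
`w_a(y) = ε_a u_a(ε_a y + x_a) e^{-i((ε_a Ω/2) y·x_a^⊥ - θ)}`. -/
def wfam (Ω : ℝ) (u : ℝ → Plane → ℂ) (xa : ℝ → Plane) (a θv : ℝ) (y : Plane) : ℂ :=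
  ((epsOf u a : ℝ) : ℂ) * u a ((epsOf u a) • y + xa a) *
    Complex.exp (-Complex.I *
      ((((epsOf u a * Ω / 2) * (-(y 0) * (xa a 1) + (y 1) * (xa a 0)) - θv) : ℝ) : ℂ))

/-- The limit profile `(1/√a*) Q(x/√a*)` where `a* = ‖Q‖₂²`. -/
def Qstar (Q : Plane → ℝ) (x : Plane) : ℝ :=
  (Real.sqrt (∫ y : Plane, (Q y) ^ 2))⁻¹ * Q ((Real.sqrt (∫ y : Plane, (Q y) ^ 2))⁻¹ • x)

lemma plane_norm_sq (x : Plane) : ‖x‖ ^ 2 = x 0 ^ 2 + x 1 ^ 2 := by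
  rw [EuclideanSpace.real_norm_sq_eq, Fin.sum_univ_two]

@[simp] lemma e0_zero : e0 0 = 1 := by simp [e0]
@[simp] lemma e0_one : e0 1 = 0 := by simp [e0]
@[simp] lemma e1_zero : e1 0 = 0 := by simp [e1]
@[simp] lemma e1_one : e1 1 = 1 := by simp [e1]

lemma hasFDerivAt_norm_sub_sq (z x : Plane) :
    HasFDerivAt (fun y : Plane => ‖y - z‖ ^ 2) (2 • innerSL ℝ (x - z)) x :=
  (hasFDerivAt_id x).sub_const z |>.norm_sq

lemma inner_e0 (x : Plane) : inner ℝ x e0 = x 0 := by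
  simp [e0, EuclideanSpace.inner_single_right]

lemma inner_e1 (x : Plane) : inner ℝ x e1 = x 1 := by
  simp [e1, EuclideanSpace.inner_single_right]

/-- A radial function `g(|x - z|²)` and its gradient. -/
lemma hasFDerivAt_radial {g : ℝ → ℝ} {g' : ℝ} (z x : Plane)
    (hg : HasDerivAt g g' (‖x - z‖ ^ 2)) :
    HasFDerivAt (fun y : Plane => g (‖y - z‖ ^ 2)) (g' • (2 • innerSL ℝ (x - z))) x :=
  hg.comp_hasFDerivAt x (hasFDerivAt_norm_sub_sq z x)

lemma d0R_radial {g : ℝ → ℝ} {g' : ℝ} (z x : Plane)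
    (hg : HasDerivAt g g' (‖x - z‖ ^ 2)) :
    d0R (fun y : Plane => g (‖y - z‖ ^ 2)) x = 2 * g' * (x - z) 0 := by
  rw [d0R, (hasFDerivAt_radial z x hg).fderiv]
  simp only [_root_.smul_apply, innerSL_apply_apply, inner_e0, smul_eq_mul, nsmul_eq_mul]
  push_cast; ring

lemma d1R_radial {g : ℝ → ℝ} {g' : ℝ} (z x : Plane)
    (hg : HasDerivAt g g' (‖x - z‖ ^ 2)) :
    d1R (fun y : Plane => g (‖y - z‖ ^ 2)) x = 2 * g' * (x - z) 1 := by
  rw [d1R, (hasFDerivAt_radial z x hg).fderiv]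
  simp only [_root_.smul_apply, innerSL_apply_apply, inner_e1, smul_eq_mul, nsmul_eq_mul]
  push_cast; ring

lemma gradSqR_radial {g : ℝ → ℝ} {g' : ℝ} (z x : Plane)
    (hg : HasDerivAt g g' (‖x - z‖ ^ 2)) :
    gradSqR (fun y : Plane => g (‖y - z‖ ^ 2)) x = 4 * g' ^ 2 * ‖x - z‖ ^ 2 := by
  rw [gradSqR, d0R_radial z x hg, d1R_radial z x hg, plane_norm_sq]; ring

lemma gradSqR_nonneg (f : Plane → ℝ) (x : Plane) : 0 ≤ gradSqR f x := by
  unfold gradSqR; positivity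

lemma measurable_d0 (u : Plane → ℂ) : Measurable (d0 u) := measurable_fderiv_apply_const ℝ u e0
lemma measurable_d1 (u : Plane → ℂ) : Measurable (d1 u) := measurable_fderiv_apply_const ℝ u e1
lemma measurable_d0R (u : Plane → ℝ) : Measurable (d0R u) := measurable_fderiv_apply_const ℝ u e0
lemma measurable_d1R (u : Plane → ℝ) : Measurable (d1R u) := measurable_fderiv_apply_const ℝ u e1
lemma measurable_gradSqR (u : Plane → ℝ) : Measurable (gradSqR u) :=
  ((measurable_d0R u).pow_const 2).add ((measurable_d1R u).pow_const 2)

lemma smoothTransition_deriv_bound :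
    ∃ B : ℝ, 0 < B ∧ ∀ t : ℝ, |deriv Real.smoothTransition t| ≤ B := by
  have hc : Continuous (deriv Real.smoothTransition) :=
    (Real.smoothTransition.contDiff (n := 1)).continuous_deriv le_rfl
  obtain ⟨C, hC⟩ := (isCompact_Icc (a := (0:ℝ)) (b := 1)).exists_bound_of_continuousOn
    hc.continuousOn
  refine ⟨max C 1, by positivity, fun t => ?_⟩
  by_cases h0 : t < 0
  · have : deriv Real.smoothTransition t = 0 := by
      have h : Real.smoothTransition =ᶠ[𝓝 t] fun _ => (0:ℝ) := by
        filter_upwards [Iio_mem_nhds h0] with s hs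
        exact Real.smoothTransition.zero_of_nonpos (le_of_lt hs)
      rw [h.deriv_eq]; simp
    rw [this]; simp
  by_cases h1 : 1 < t
  · have : deriv Real.smoothTransition t = 0 := by
      have h : Real.smoothTransition =ᶠ[𝓝 t] fun _ => (1:ℝ) := by
        filter_upwards [Ioi_mem_nhds h1] with s hs
        exact Real.smoothTransition.one_of_one_le (le_of_lt hs)
      rw [h.deriv_eq]; simp
    rw [this]; simp
  · exact (hC t ⟨by linarith, by linarith⟩).trans (le_max_left _ _)

lemma smoothTransition_deriv_eq_zero {t : ℝ} (h : t ≤ 0 ∨ 1 ≤ t) :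
    deriv Real.smoothTransition t = 0 := by
  rcases h with h | h
  · apply IsLocalMin.deriv_eq_zero
    refine Eventually.of_forall fun s => ?_
    simp only [Real.smoothTransition.zero_of_nonpos h]
    exact Real.smoothTransition.nonneg s
  · apply IsLocalMax.deriv_eq_zero
    refine Eventually.of_forall fun s => ?_
    simp only [Real.smoothTransition.one_of_one_le h]
    exact Real.smoothTransition.le_one s

/-- A smooth cutoff equal to `0` where `|x - z|² ≤ P` and to `1` where `|x - z|² ≥ S`. -/
def cut (z : Plane) (P S : ℝ) (x : Plane) : ℝ :=
  Real.smoothTransition ((‖x - z‖ ^ 2 - P) / (S - P))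

lemma cut_nonneg (z : Plane) (P S : ℝ) (x : Plane) : 0 ≤ cut z P S x :=
  Real.smoothTransition.nonneg _

lemma cut_le_one (z : Plane) (P S : ℝ) (x : Plane) : cut z P S x ≤ 1 :=
  Real.smoothTransition.le_one _

lemma cut_eq_zero {z : Plane} {P S : ℝ} (h : P < S) {x : Plane} (hx : ‖x - z‖ ^ 2 ≤ P) :
    cut z P S x = 0 :=
  Real.smoothTransition.zero_of_nonpos (div_nonpos_of_nonpos_of_nonneg (by linarith) (by linarith))

lemma cut_eq_one {z : Plane} {P S : ℝ} (h : P < S) {x : Plane} (hx : S ≤ ‖x - z‖ ^ 2) :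
    cut z P S x = 1 :=
  Real.smoothTransition.one_of_one_le (by rw [le_div_iff₀ (by linarith)]; linarith)

lemma contDiff_cut (z : Plane) (P S : ℝ) : ContDiff ℝ 2 (cut z P S) := by
  unfold cut
  refine (Real.smoothTransition.contDiff (n := 2)).comp ?_
  exact (((contDiff_id.sub contDiff_const).norm_sq ℝ).sub contDiff_const).div_const _

lemma differentiable_cut (z : Plane) (P S : ℝ) : Differentiable ℝ (cut z P S) :=
  (contDiff_cut z P S).differentiable (by norm_num)

lemma gradSqR_cut (z : Plane) (P S : ℝ) (x : Plane) :
    gradSqR (cut z P S) x =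
      4 * (deriv Real.smoothTransition ((‖x - z‖ ^ 2 - P) / (S - P)) / (S - P)) ^ 2
        * ‖x - z‖ ^ 2 := by
  have h : HasDerivAt (fun t => Real.smoothTransition ((t - P) / (S - P)))
      (deriv Real.smoothTransition ((‖x - z‖ ^ 2 - P) / (S - P)) / (S - P)) (‖x - z‖ ^ 2) := by
    have h1 : HasDerivAt Real.smoothTransition _ ((‖x - z‖ ^ 2 - P) / (S - P)) :=
      ((Real.smoothTransition.contDiff (n := 1)).differentiable (by norm_num) _).hasDerivAt
    have h2 : HasDerivAt (fun t : ℝ => (t - P) / (S - P)) (1 / (S - P)) (‖x - z‖ ^ 2) :=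
      ((hasDerivAt_id _).sub_const P).div_const _
    simpa [Function.comp_def, div_eq_mul_inv] using
      HasDerivAt.comp (h := fun t : ℝ => (t - P) / (S - P)) (‖x - z‖ ^ 2) h1 h2
  exact gradSqR_radial z x h

lemma gradSqR_cut_eq_zero {z : Plane} {P S : ℝ} (h : P < S) {x : Plane}
    (hx : ‖x - z‖ ^ 2 ≤ P ∨ S ≤ ‖x - z‖ ^ 2) : gradSqR (cut z P S) x = 0 := by
  rw [gradSqR_cut, smoothTransition_deriv_eq_zero]
  · simp
  · refine hx.imp (fun hx => div_nonpos_of_nonpos_of_nonneg (by linarith) (by linarith))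
      (fun hx => by rw [le_div_iff₀ (by linarith)]; linarith)

lemma gradSqR_cut_le {B : ℝ} (hB : ∀ t : ℝ, |deriv Real.smoothTransition t| ≤ B)
    (z : Plane) {P S : ℝ} (hS : 0 ≤ S) (h : P < S) (x : Plane) :
    gradSqR (cut z P S) x ≤ 4 * B ^ 2 * S / (S - P) ^ 2 := by
  by_cases hx : S ≤ ‖x - z‖ ^ 2
  · rw [gradSqR_cut_eq_zero h (Or.inr hx)]; positivity
  · rw [gradSqR_cut, div_pow]
    have h1 := hB ((‖x - z‖ ^ 2 - P) / (S - P))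
    have h2 := sq_le_sq' (abs_le.1 h1).1 (abs_le.1 h1).2
    have h3 : 0 < (S - P) ^ 2 := by have : 0 < S - P := by linarith
                                    positivity
    rw [mul_div_assoc', div_mul_eq_mul_div, div_le_div_iff_of_pos_right h3]
    push Not at hx
    gcongr

/-- The negative part of `log ‖z‖`. -/
def lneg (z : Plane) : ℝ := max 0 (-Real.log ‖z‖)

lemma lneg_nonneg (z : Plane) : 0 ≤ lneg z := le_max_left _ _

lemma integrable_lneg_sq : Integrable (fun z : Plane => lneg z ^ 2) := by
  have h := (integrable_fun_norm_addHaar (volume : Measure Plane)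
    (f := fun y : ℝ => (max 0 (-Real.log y)) ^ 2)).2 ?_
  · exact h
  have hd : Module.finrank ℝ Plane = 2 := by simp
  rw [hd]
  have hu : Ioi (0:ℝ) = Ioc 0 1 ∪ Ioi 1 := by rw [Ioc_union_Ioi_eq_Ioi]; norm_num
  rw [hu]
  refine IntegrableOn.union ?_ ?_
  · refine Measure.integrableOn_of_bounded (M := 4) (by simp) ?_ ?_
    · exact (by fun_prop : Measurable fun y : ℝ => y ^ (2 - 1) •
        (max 0 (-Real.log y)) ^ 2).aestronglyMeasurable
    · refine (ae_restrict_iff' measurableSet_Ioc).2 (Eventually.of_forall fun y hy => ?_)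
      have h1 := Real.abs_log_mul_self_rpow_lt y (1/2) hy.1 hy.2 (by norm_num)
      have h2 : max 0 (-Real.log y) = -Real.log y :=
        max_eq_right (by have := Real.log_nonpos hy.1.le hy.2; linarith)
      rw [h2, ← Real.sqrt_eq_rpow] at *
      have h3 : (Real.log y * √y) ^ 2 ≤ 2 ^ 2 := by
        rw [show (1 : ℝ) / (1 / 2) = 2 by norm_num] at h1
        rw [sq_le_sq, abs_of_pos (by norm_num : (0 : ℝ) < 2)]
        exact h1.le
      rw [mul_pow, Real.sq_sqrt hy.1.le] at h3
      rw [Real.norm_of_nonneg (by have := hy.1; simp only [smul_eq_mul]; positivity)]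
      simp only [smul_eq_mul]; norm_num; nlinarith
  · refine (integrableOn_zero (μ := volume)).congr_fun (fun y hy => ?_) measurableSet_Ioi
    have : max 0 (-Real.log y) = 0 :=
      max_eq_left (by have := Real.log_nonneg (le_of_lt hy : (1:ℝ) ≤ y); linarith)
    simp [this]

/-- A mass density for which the logarithmic energy converges. -/
structure Dens (f : Plane → ℝ) : Prop where
  nonneg : ∀ x, 0 ≤ f x
  int : Integrable f
  int_sq : Integrable (fun x => f x ^ 2)
  int_norm : Integrable (fun x => ‖x‖ * f x)

/-- A density multiplied by a bounded factor. -/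
lemma Dens.mul {f c : Plane → ℝ} (hf : Dens f) {C : ℝ} (hc : Measurable c) (h0 : ∀ x, 0 ≤ c x)
    (h1 : ∀ x, c x ≤ C) : Dens (fun x => c x * f x) := by
  have hb : ∀ x, ‖c x‖ ≤ C := fun x => by rw [Real.norm_of_nonneg (h0 x)]; exact h1 x
  refine ⟨fun x => mul_nonneg (h0 x) (hf.nonneg x), ?_, ?_, ?_⟩
  · exact hf.int.bdd_mul hc.aestronglyMeasurable (Eventually.of_forall hb)
  · simp_rw [mul_pow]
    refine hf.int_sq.bdd_mul (c := C ^ 2) (hc.pow_const 2).aestronglyMeasurable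
      (Eventually.of_forall fun x => ?_)
    rw [norm_pow]; have := hb x; gcongr
  · have := hf.int_norm.bdd_mul hc.aestronglyMeasurable (Eventually.of_forall hb)
    refine this.congr (Eventually.of_forall fun x => ?_)
    simp only; ring

/-- The logarithmic interaction of two densities. -/
def logInt (f g : Plane → ℝ) : ℝ :=
  ∫ p : Plane × Plane, Real.log ‖p.1 - p.2‖ * f p.1 * g p.2

lemma integrable_conv_lneg {f : Plane → ℝ} (hf : Integrable f) :
    Integrable (fun p : Plane × Plane => f p.1 * lneg (p.1 - p.2) ^ 2) := by
  have h := (hf.convolution_integrand (ContinuousLinearMap.mul ℝ ℝ) integrable_lneg_sq).swap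
  refine h.congr (Eventually.of_forall fun p => ?_)
  simp only [Function.comp, Prod.snd_swap, Prod.fst_swap, ContinuousLinearMap.mul_apply']
  unfold lneg
  rw [norm_sub_rev]

lemma integral_conv_lneg {f : Plane → ℝ} (hf : Integrable f) :
    ∫ p : Plane × Plane, f p.1 * lneg (p.1 - p.2) ^ 2 = (∫ x, f x) * ∫ z, lneg z ^ 2 := by
  have h := integral_prod _ (integrable_conv_lneg hf)
  rw [Measure.volume_eq_prod, h]
  simp_rw [integral_const_mul]
  have : ∀ x : Plane, ∫ y, lneg (x - y) ^ 2 = ∫ z, lneg z ^ 2 := fun x =>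
    integral_sub_left_eq_self (fun z => lneg z ^ 2) volume x
  simp_rw [this]
  rw [integral_mul_const]

lemma lneg_le {a b l δ : ℝ} (ha : 0 ≤ a) (hδ : 0 < δ) :
    l * a * b ≤ δ * (a * b ^ 2) + (4 * δ)⁻¹ * (a * l ^ 2) := by
  have h : l * b ≤ δ * b ^ 2 + (4 * δ)⁻¹ * l ^ 2 := by
    have h1 : δ * b ^ 2 + (4 * δ)⁻¹ * l ^ 2 - l * b = (2 * δ * b - l) ^ 2 * (4 * δ)⁻¹ := by
      field_simp; ring
    have : 0 ≤ (2 * δ * b - l) ^ 2 * (4 * δ)⁻¹ := by positivity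
    linarith
  nlinarith

lemma log_integrable {f g : Plane → ℝ} (hf : Dens f) (hg : Dens g) :
    Integrable (fun p : Plane × Plane => Real.log ‖p.1 - p.2‖ * f p.1 * g p.2) := by
  have i1 : Integrable (fun p : Plane × Plane => f p.1 * g p.2 ^ 2) := hf.int.mul_prod hg.int_sq
  have i2 := integrable_conv_lneg hf.int
  have i3 : Integrable (fun p : Plane × Plane => (‖p.1‖ * f p.1) * g p.2) :=
    hf.int_norm.mul_prod hg.int
  have i4 : Integrable (fun p : Plane × Plane => f p.1 * (‖p.2‖ * g p.2)) :=
    hf.int.mul_prod hg.int_norm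
  have i5 : Integrable (fun p : Plane × Plane => f p.1 * g p.2) := hf.int.mul_prod hg.int
  refine Integrable.mono' ((((i1.const_mul 1).add (i2.const_mul (4 * 1)⁻¹)).add i3).add i4)
    ?_ (Eventually.of_forall fun p => ?_)
  · have hm : Measurable (fun p : Plane × Plane => Real.log ‖p.1 - p.2‖) := by fun_prop
    refine (hm.aestronglyMeasurable.mul i5.aestronglyMeasurable).congr
      (Eventually.of_forall fun p => ?_)
    simp only [Pi.mul_apply]; ring
  · have hfp := hf.nonneg p.1
    have hgp := hg.nonneg p.2
    rw [norm_mul, norm_mul, Real.norm_of_nonneg hfp, Real.norm_of_nonneg hgp]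
    have h1 := lneg_le (b := g p.2) (l := lneg (p.1 - p.2)) hfp one_pos
    have h2 : ‖Real.log ‖p.1 - p.2‖‖ ≤ lneg (p.1 - p.2) + (‖p.1‖ + ‖p.2‖) := by
      have h3 := norm_sub_le p.1 p.2
      rw [Real.norm_eq_abs]
      have h4 : -Real.log ‖p.1 - p.2‖ ≤ lneg (p.1 - p.2) := le_max_right _ _
      have h5 := lneg_nonneg (p.1 - p.2)
      have h6 := Real.log_le_self (norm_nonneg (p.1 - p.2))
      have := norm_nonneg p.1
      have := norm_nonneg p.2
      exact abs_le.2 ⟨by linarith, by linarith⟩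
    simp only [Pi.add_apply]
    calc ‖Real.log ‖p.1 - p.2‖‖ * f p.1 * g p.2
        ≤ (lneg (p.1 - p.2) + (‖p.1‖ + ‖p.2‖)) * f p.1 * g p.2 := by gcongr
      _ = lneg (p.1 - p.2) * f p.1 * g p.2 + ‖p.1‖ * f p.1 * g p.2 + f p.1 * (‖p.2‖ * g p.2) := by
          ring
      _ ≤ _ := by linarith

lemma logInt_comm (f g : Plane → ℝ) : logInt f g = logInt g f := by
  unfold logInt
  rw [Measure.volume_eq_prod, ← integral_prod_swap]
  refine integral_congr_ae (Eventually.of_forall fun p => ?_)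
  simp only [Prod.fst_swap, Prod.snd_swap]
  rw [norm_sub_rev]; ring

lemma logInt_add_left {f f' g : Plane → ℝ} (hf : Dens f) (hf' : Dens f') (hg : Dens g) :
    logInt (fun x => f x + f' x) g = logInt f g + logInt f' g := by
  unfold logInt
  rw [← integral_add (log_integrable hf hg) (log_integrable hf' hg)]
  refine integral_congr_ae (Eventually.of_forall fun p => ?_)
  simp only; ring

lemma logInt_smul (c d : ℝ) (f g : Plane → ℝ) :
    logInt (fun x => c * f x) (fun x => d * g x) = c * d * logInt f g := by
  unfold logInt
  rw [← integral_const_mul]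
  refine integral_congr_ae (Eventually.of_forall fun p => ?_)
  simp only; ring

lemma logInt_ge {f g : Plane → ℝ} (hf : Dens f) (hg : Dens g) {δ : ℝ} (hδ : 0 < δ) :
    -((∫ x, f x) * (δ * (∫ x, g x ^ 2) + (4 * δ)⁻¹ * ∫ z, lneg z ^ 2)) ≤ logInt f g := by
  have i1 : Integrable (fun p : Plane × Plane => f p.1 * g p.2 ^ 2) := hf.int.mul_prod hg.int_sq
  have i2 := integrable_conv_lneg hf.int
  have e1 : ∫ p : Plane × Plane, f p.1 * g p.2 ^ 2 = (∫ x, f x) * ∫ x, g x ^ 2 :=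
    integral_prod_mul f (fun x => g x ^ 2)
  have h := integral_mono ((i1.const_mul δ).add (i2.const_mul (4 * δ)⁻¹)).neg
    (log_integrable hf hg) (fun p => ?_)
  · refine le_trans (le_of_eq ?_) h
    simp only [Pi.neg_apply, Pi.add_apply]
    rw [integral_neg, integral_add (i1.const_mul δ) (i2.const_mul _), integral_const_mul,
      integral_const_mul, e1, integral_conv_lneg hf.int]
    ring
  · have hfp := hf.nonneg p.1
    have hgp := hg.nonneg p.2
    have h1 := lneg_le (b := g p.2) (l := lneg (p.1 - p.2)) hfp hδ
    have h4 : -Real.log ‖p.1 - p.2‖ ≤ lneg (p.1 - p.2) := le_max_right _ _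
    simp only [Pi.neg_apply, Pi.add_apply]
    have : -Real.log ‖p.1 - p.2‖ * f p.1 * g p.2 ≤ lneg (p.1 - p.2) * f p.1 * g p.2 := by gcongr
    linarith

/-- The logarithmic interaction of a density with support of diameter at most one. -/
lemma logInt_nonpos {f : Plane → ℝ} (hf : ∀ x, 0 ≤ f x) (z : Plane)
    (hs : ∀ x, f x ≠ 0 → ‖x - z‖ ≤ 1 / 2) : logInt f f ≤ 0 := by
  refine integral_nonpos fun p => ?_
  by_cases h1 : f p.1 = 0
  · simp [h1]
  by_cases h2 : f p.2 = 0
  · simp [h2]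
  have h3 : ‖p.1 - p.2‖ ≤ 1 := by
    have := norm_sub_le (p.1 - z) (p.2 - z)
    rw [sub_sub_sub_cancel_right] at this
    linarith [hs _ h1, hs _ h2]
  have := Real.log_nonpos (norm_nonneg _) h3
  have h4 := mul_nonneg (hf p.1) (hf p.2)
  simp only [Pi.zero_apply]
  nlinarith

lemma logConv_eq {u : Plane → ℂ} (hu : Dens (fun x => ‖u x‖ ^ 2)) :
    logConv u = logInt (fun x => ‖u x‖ ^ 2) (fun x => ‖u x‖ ^ 2) := by
  unfold logConv logInt
  exact (integral_prod _ (log_integrable hu hu)).symm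

/-- `|(∇ - iA)u|²` for the vector potential `A = (b/2) x^⊥`. -/
def magSq (b : ℝ) (u : Plane → ℂ) (x : Plane) : ℝ :=
  ‖d0 u x + Complex.I * ((b / 2 * x 1 : ℝ) : ℂ) * u x‖ ^ 2
    + ‖d1 u x - Complex.I * ((b / 2 * x 0 : ℝ) : ℂ) * u x‖ ^ 2

/-- `∇f · Re(ū ∇u)`. -/
def cr (f : Plane → ℝ) (u : Plane → ℂ) (x : Plane) : ℝ :=
  d0R f x * ((starRingEnd ℂ) (u x) * d0 u x).re + d1R f x * ((starRingEnd ℂ) (u x) * d1 u x).re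

lemma magSq_nonneg (b : ℝ) (u : Plane → ℂ) (x : Plane) : 0 ≤ magSq b u x := by
  unfold magSq; positivity

lemma gradSq_nonneg (u : Plane → ℂ) (x : Plane) : 0 ≤ gradSq u x := by
  unfold gradSq; positivity

lemma magSq_expand (b : ℝ) (u : Plane → ℂ) (x : Plane) :
    magSq b u x = gradSq u x + b ^ 2 / 4 * ‖x‖ ^ 2 * ‖u x‖ ^ 2 - b * momentum u x := by
  unfold magSq gradSq momentum
  rw [plane_norm_sq]
  simp only [Complex.sq_norm, Complex.normSq_apply]
  simp
  ring

lemma magSq_zero (u : Plane → ℂ) (x : Plane) : magSq 0 u x = gradSq u x := by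
  rw [magSq_expand]; ring

lemma abs_momentum_le (u : Plane → ℂ) (x : Plane) :
    2 * |momentum u x| ≤ gradSq u x + ‖x‖ ^ 2 * ‖u x‖ ^ 2 := by
  have h1 := magSq_nonneg 2 u x
  have h2 := magSq_nonneg (-2) u x
  rw [magSq_expand] at h1 h2
  have : |2 * momentum u x| ≤ gradSq u x + ‖x‖ ^ 2 * ‖u x‖ ^ 2 := by
    rw [abs_le]; constructor <;> linarith
  rwa [abs_mul, abs_two] at this

lemma magSq_le_two (b : ℝ) (u : Plane → ℂ) (x : Plane) :
    magSq b u x ≤ 2 * gradSq u x + 2 * (b ^ 2 / 4 * ‖x‖ ^ 2 * ‖u x‖ ^ 2) := by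
  have h := magSq_nonneg (-b) u x
  rw [magSq_expand] at h ⊢
  nlinarith

lemma gradSq_le_two (b : ℝ) (u : Plane → ℂ) (x : Plane) :
    gradSq u x ≤ 2 * magSq b u x + 2 * (b ^ 2 / 4 * ‖x‖ ^ 2 * ‖u x‖ ^ 2) := by
  have h : 0 ≤ gradSq u x + (2 * b) ^ 2 / 4 * ‖x‖ ^ 2 * ‖u x‖ ^ 2 - 2 * b * momentum u x := by
    rw [← magSq_expand]; exact magSq_nonneg _ _ _
  rw [magSq_expand]
  nlinarith

lemma d0_smul {f : Plane → ℝ} {u : Plane → ℂ} {x : Plane} (hf : DifferentiableAt ℝ f x)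
    (hu : DifferentiableAt ℝ u x) :
    d0 (fun y => f y • u y) x = f x • d0 u x + d0R f x • u x := by
  unfold d0 d0R; rw [fderiv_fun_smul hf hu]; simp

lemma d1_smul {f : Plane → ℝ} {u : Plane → ℂ} {x : Plane} (hf : DifferentiableAt ℝ f x)
    (hu : DifferentiableAt ℝ u x) :
    d1 (fun y => f y • u y) x = f x • d1 u x + d1R f x • u x := by
  unfold d1 d1R; rw [fderiv_fun_smul hf hu]; simp

lemma magSq_smul (b : ℝ) {f : Plane → ℝ} {u : Plane → ℂ} {x : Plane}
    (hf : DifferentiableAt ℝ f x) (hu : DifferentiableAt ℝ u x) :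
    magSq b (fun y => f y • u y) x
      = f x ^ 2 * magSq b u x + 2 * f x * cr f u x + gradSqR f x * ‖u x‖ ^ 2 := by
  unfold magSq cr gradSqR
  rw [d0_smul hf hu, d1_smul hf hu]
  simp only [Complex.sq_norm, Complex.normSq_apply]
  simp
  ring

lemma magSq_const_smul (b c : ℝ) {u : Plane → ℂ} {x : Plane} (hu : DifferentiableAt ℝ u x) :
    magSq b (fun y => c • u y) x = c ^ 2 * magSq b u x := by
  rw [magSq_smul b (differentiableAt_const c) hu]
  simp [cr, gradSqR, d0R, d1R]

lemma cr_sq_le (b : ℝ) (f : Plane → ℝ) (u : Plane → ℂ) (x : Plane) :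
    cr f u x ^ 2 ≤ gradSqR f x * ‖u x‖ ^ 2 * magSq b u x := by
  unfold magSq cr gradSqR
  simp only [Complex.sq_norm, Complex.normSq_apply]
  simp
  set a := (u x).re
  set c := (u x).im
  set p := d0R f x
  set q := d1R f x
  set P := (d0 u x).re + -(b / 2 * x.ofLp 1 * c)
  set P' := (d0 u x).im + b / 2 * x.ofLp 1 * a
  set R := (d1 u x).re + b / 2 * x.ofLp 0 * c
  set R' := (d1 u x).im - b / 2 * x.ofLp 0 * a
  have e1 : a * (d0 u x).re + c * (d0 u x).im = a * P + c * P' := by ring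
  have e2 : a * (d1 u x).re + c * (d1 u x).im = a * R + c * R' := by ring
  rw [e1, e2]
  have : (p ^ 2 + q ^ 2) * (a * a + c * c) * (P * P + P' * P' + (R * R + R' * R'))
      - (p * (a * P + c * P') + q * (a * R + c * R')) ^ 2 =
      (q * (a * P + c * P') - p * (a * R + c * R')) ^ 2
      + (p ^ 2 + q ^ 2) * ((a * P' - c * P) ^ 2 + (a * R' - c * R) ^ 2) := by ring
  nlinarith [sq_nonneg (q * (a * P + c * P') - p * (a * R + c * R')),
    (by positivity : 0 ≤ (p ^ 2 + q ^ 2) * ((a * P' - c * P) ^ 2 + (a * R' - c * R) ^ 2))]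

lemma abs_cr_le (b : ℝ) (f : Plane → ℝ) (u : Plane → ℂ) (x : Plane) {κ : ℝ} (hκ : 0 < κ) (s : ℝ) :
    2 * |s * cr f u x| ≤ κ * s ^ 2 * magSq b u x + κ⁻¹ * (gradSqR f x * ‖u x‖ ^ 2) := by
  have h := cr_sq_le b f u x
  set X := κ * s ^ 2 * magSq b u x
  set Y := κ⁻¹ * (gradSqR f x * ‖u x‖ ^ 2)
  have hX : 0 ≤ X := mul_nonneg (by positivity) (magSq_nonneg _ _ _)
  have hY : 0 ≤ Y := mul_nonneg (by positivity) (mul_nonneg (gradSqR_nonneg _ _) (by positivity))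
  have h1 : (s * cr f u x) ^ 2 ≤ X * Y := by
    have : X * Y = s ^ 2 * (gradSqR f x * ‖u x‖ ^ 2 * magSq b u x) := by
      simp only [X, Y]; field_simp
    rw [this, mul_pow]; gcongr
  have h2 : (2 * |s * cr f u x|) ^ 2 ≤ (X + Y) ^ 2 := by
    rw [mul_pow, sq_abs]; nlinarith [sq_nonneg (X - Y)]
  exact (abs_le_of_sq_le_sq' h2 (by positivity)).2

lemma measurable_cr {f : Plane → ℝ} {u : Plane → ℂ} (hu : Differentiable ℝ u) :
    Measurable (cr f u) := by
  have hc : Measurable fun x => (starRingEnd ℂ) (u x) :=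
    (Complex.continuous_conj.comp hu.continuous).measurable
  exact ((measurable_d0R f).mul (Complex.measurable_re.comp (hc.mul (measurable_d0 u)))).add
    ((measurable_d1R f).mul (Complex.measurable_re.comp (hc.mul (measurable_d1 u))))

lemma measurable_gradSq (u : Plane → ℂ) : Measurable (gradSq u) :=
  ((measurable_d0 u).norm.pow_const 2).add ((measurable_d1 u).norm.pow_const 2)

lemma measurable_coord (i : Fin 2) : Measurable (fun x : Plane => x i) :=
  (EuclideanSpace.proj (𝕜 := ℝ) i).continuous.measurable

lemma measurable_momentum {u : Plane → ℂ} (hu : Differentiable ℝ u) : Measurable (momentum u) := by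
  have hc : Measurable fun x => (starRingEnd ℂ) (u x) :=
    (Complex.continuous_conj.comp hu.continuous).measurable
  exact ((measurable_coord 1).neg.mul (Complex.measurable_im.comp (hc.mul (measurable_d0 u)))).add
    ((measurable_coord 0).mul (Complex.measurable_im.comp (hc.mul (measurable_d1 u))))

lemma measurable_magSq (b : ℝ) {u : Plane → ℂ} (hu : Differentiable ℝ u) :
    Measurable (magSq b u) := by
  have h : magSq b u =
      fun x => gradSq u x + b ^ 2 / 4 * ‖x‖ ^ 2 * ‖u x‖ ^ 2 - b * momentum u x :=
    funext (magSq_expand b u)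
  rw [h]
  have := hu.continuous.measurable
  have := measurable_gradSq u
  have := measurable_momentum hu
  fun_prop

/-- The magnetic Sobolev class. -/
structure MagH1 (b : ℝ) (u : Plane → ℂ) : Prop where
  diff : Differentiable ℝ u
  int : Integrable (fun x => ‖u x‖ ^ 2)
  int_mag : Integrable (magSq b u)

lemma MagH1.int_cr {b : ℝ} {u : Plane → ℂ} (hu : MagH1 b u) {f s : Plane → ℝ} (hs : Measurable s)
    {S C : ℝ} (hsS : ∀ x, |s x| ≤ S) (hC : ∀ x, gradSqR f x ≤ C) :
    Integrable (fun x => s x * cr f u x) := by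
  refine ((hu.int_mag.const_mul (S ^ 2)).add (hu.int.const_mul C)).mono'
    (hs.mul (measurable_cr hu.diff)).aestronglyMeasurable (Eventually.of_forall fun x => ?_)
  have h := abs_cr_le b f u x one_pos (s x)
  have h1 : s x ^ 2 ≤ S ^ 2 := by rw [← sq_abs]; gcongr; exact hsS x
  have h2 := mul_le_mul_of_nonneg_right h1 (magSq_nonneg b u x)
  have h3 := mul_le_mul_of_nonneg_right (hC x) (sq_nonneg ‖u x‖)
  have := abs_nonneg (s x * cr f u x)
  simp only [Real.norm_eq_abs, Pi.add_apply]
  simp only [inv_one, one_mul] at h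
  linarith

lemma MagH1.smul {b : ℝ} {u : Plane → ℂ} (hu : MagH1 b u) {f : Plane → ℝ}
    (hf : Differentiable ℝ f) {S C : ℝ} (hfS : ∀ x, |f x| ≤ S) (hC : ∀ x, gradSqR f x ≤ C) :
    MagH1 b (fun x => f x • u x) := by
  have hm := hf.continuous.measurable
  have hf2 : ∀ x, ‖f x ^ 2‖ ≤ S ^ 2 := fun x => by
    rw [norm_pow]; exact pow_le_pow_left₀ (norm_nonneg _) (hfS x) 2
  refine ⟨hf.smul hu.diff, ?_, ?_⟩
  · simp_rw [norm_smul, mul_pow, Real.norm_eq_abs, sq_abs]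
    exact hu.int.bdd_mul (hm.pow_const 2).aestronglyMeasurable (Eventually.of_forall hf2)
  · have h : magSq b (fun x => f x • u x) =
        fun x => f x ^ 2 * magSq b u x + 2 * (f x * cr f u x) + gradSqR f x * ‖u x‖ ^ 2 := by
      funext x; rw [magSq_smul b (hf x) (hu.diff x)]; ring
    rw [h]
    refine ((hu.int_mag.bdd_mul (hm.pow_const 2).aestronglyMeasurable
      (Eventually.of_forall hf2)).add ((hu.int_cr hm hfS hC).const_mul 2)).add ?_
    refine hu.int.bdd_mul (c := C) (measurable_gradSqR f).aestronglyMeasurable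
      (Eventually.of_forall fun x => ?_)
    rw [Real.norm_of_nonneg (gradSqR_nonneg f x)]; exact hC x

/-- The potential energy `∫ V_Ω |u|²`. -/
def pot (V : Plane → ℝ) (Ω : ℝ) (u : Plane → ℂ) : ℝ :=
  ∫ x : Plane, (V x - Ω ^ 2 / 4 * ‖x‖ ^ 2) * ‖u x‖ ^ 2

section Potential

variable {V : Plane → ℝ} {Ω : ℝ}

lemma int_sq_of_int_V (hΩ : 0 < Ω)
    (hV : ∀ x : Plane, 0 ≤ V x - Ω ^ 2 / 4 * ‖x‖ ^ 2) {u : Plane → ℂ} (hu : Continuous u)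
    (h : Integrable (fun x => V x * ‖u x‖ ^ 2)) :
    Integrable (fun x : Plane => ‖x‖ ^ 2 * ‖u x‖ ^ 2) := by
  refine (h.const_mul (4 / Ω ^ 2)).mono' (by fun_prop) (Eventually.of_forall fun x => ?_)
  rw [Real.norm_of_nonneg (by positivity)]
  have h1 : ‖x‖ ^ 2 ≤ 4 / Ω ^ 2 * V x := by
    have := hV x
    have e : 4 / Ω ^ 2 * V x - ‖x‖ ^ 2 = 4 / Ω ^ 2 * (V x - Ω ^ 2 / 4 * ‖x‖ ^ 2) := by
      field_simp
    have : 0 ≤ 4 / Ω ^ 2 * (V x - Ω ^ 2 / 4 * ‖x‖ ^ 2) := by positivity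
    linarith
  rw [← mul_assoc]; gcongr

lemma int_pot {u : Plane → ℂ} (h : Integrable (fun x => V x * ‖u x‖ ^ 2))
    (h2 : Integrable (fun x : Plane => ‖x‖ ^ 2 * ‖u x‖ ^ 2)) :
    Integrable (fun x => (V x - Ω ^ 2 / 4 * ‖x‖ ^ 2) * ‖u x‖ ^ 2) := by
  refine (h.sub (h2.const_mul (Ω ^ 2 / 4))).congr (Eventually.of_forall fun x => ?_)
  simp only [Pi.sub_apply]; ring

lemma InH.magH1 (hΩ : 0 < Ω)
    (hV : ∀ x : Plane, 0 ≤ V x - Ω ^ 2 / 4 * ‖x‖ ^ 2) {u : Plane → ℂ} (hu : InH V u) :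
    MagH1 Ω u := by
  have hx := int_sq_of_int_V hΩ hV hu.1.1.continuous hu.2
  refine ⟨hu.1.1, hu.1.2.1, ?_⟩
  refine ((hu.1.2.2.const_mul 2).add (hx.const_mul (2 * (Ω ^ 2 / 4)))).mono'
    (measurable_magSq Ω hu.1.1).aestronglyMeasurable (Eventually.of_forall fun x => ?_)
  rw [Real.norm_of_nonneg (magSq_nonneg _ _ _)]
  refine (magSq_le_two Ω u x).trans (le_of_eq ?_)
  simp only [Pi.add_apply]; ring

lemma MagH1.inH (hΩ : 0 < Ω)
    (hV : ∀ x : Plane, 0 ≤ V x - Ω ^ 2 / 4 * ‖x‖ ^ 2) {u : Plane → ℂ} (hu : MagH1 Ω u)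
    (hi : Integrable (fun x => V x * ‖u x‖ ^ 2)) : InH V u := by
  have hx := int_sq_of_int_V hΩ hV hu.diff.continuous hi
  refine ⟨⟨hu.diff, hu.int, ?_⟩, hi⟩
  refine ((hu.int_mag.const_mul 2).add (hx.const_mul (2 * (Ω ^ 2 / 4)))).mono'
    (measurable_gradSq u).aestronglyMeasurable (Eventually.of_forall fun x => ?_)
  rw [Real.norm_of_nonneg (gradSq_nonneg _ _)]
  refine (gradSq_le_two Ω u x).trans (le_of_eq ?_)
  simp only [Pi.add_apply]; ring

lemma Ea_eq (hΩ : 0 < Ω)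
    (hV : ∀ x : Plane, 0 ≤ V x - Ω ^ 2 / 4 * ‖x‖ ^ 2) {u : Plane → ℂ} (hu : InH V u) :
    Ea V Ω u = (∫ x, magSq Ω u x) + pot V Ω u + 1 / 2 * logConv u
      - 1 / 2 * ∫ x, ‖u x‖ ^ 4 := by
  have hx := int_sq_of_int_V hΩ hV hu.1.1.continuous hu.2
  have hp := int_pot (Ω := Ω) hu.2 hx
  have hm := hu.magH1 hΩ hV
  have hmom : Integrable (momentum u) := by
    refine (hu.1.2.2.add hx).mono' (measurable_momentum hu.1.1).aestronglyMeasurable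
      (Eventually.of_forall fun x => ?_)
    have := abs_momentum_le u x
    have := abs_nonneg (momentum u x)
    simp only [Real.norm_eq_abs, Pi.add_apply]; linarith
  have h : (∫ x, magSq Ω u x) + pot V Ω u =
      (∫ x, (gradSq u x + V x * ‖u x‖ ^ 2)) - Ω * ∫ x, momentum u x := by
    have hs : Integrable (fun x => gradSq u x + V x * ‖u x‖ ^ 2) := hu.1.2.2.add hu.2
    unfold pot
    rw [← integral_add hm.int_mag hp, ← integral_const_mul,
      ← integral_sub hs (hmom.const_mul Ω)]
    refine integral_congr_ae (Eventually.of_forall fun x => ?_)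
    simp only [magSq_expand]; ring
  unfold Ea
  rw [h]; ring

lemma dens_of_inH (hΩ : 0 < Ω)
    (hV : ∀ x : Plane, 0 ≤ V x - Ω ^ 2 / 4 * ‖x‖ ^ 2) {u : Plane → ℂ} (hu : InH V u)
    (h4 : Integrable (fun x => ‖u x‖ ^ 4)) : Dens (fun x => ‖u x‖ ^ 2) := by
  have hx := int_sq_of_int_V hΩ hV hu.1.1.continuous hu.2
  have hc := hu.1.1.continuous
  refine ⟨fun x => by positivity, hu.1.2.1, ?_, ?_⟩
  · refine h4.congr (Eventually.of_forall fun x => ?_); ring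
  · refine (hu.1.2.1.add hx).mono' (by fun_prop) (Eventually.of_forall fun x => ?_)
    rw [Real.norm_of_nonneg (by positivity)]
    simp only [Pi.add_apply]
    nlinarith [sq_nonneg ‖u x‖, sq_nonneg (‖x‖ - 1)]

end Potential

lemma integral_scale (f : Plane → ℝ) {l : ℝ} (hl : 0 < l) :
    ∫ x, f (l • x) = (l ^ 2)⁻¹ * ∫ x, f x := by
  rw [Measure.integral_comp_smul, finrank_euclideanSpace_fin, abs_of_pos (by positivity),
    smul_eq_mul]

lemma Integrable.scale {f : Plane → ℝ} (hf : Integrable f) {l : ℝ} (hl : 0 < l) :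
    Integrable (fun x => f (l • x)) := hf.comp_smul hl.ne'

lemma Dens.scale {f : Plane → ℝ} (hf : Dens f) {l : ℝ} (hl : 0 < l) :
    Dens (fun x => f (l • x)) := by
  refine ⟨fun x => hf.nonneg _, Integrable.scale hf.int hl, Integrable.scale hf.int_sq hl, ?_⟩
  refine ((Integrable.scale hf.int_norm hl).const_mul l⁻¹).congr (Eventually.of_forall fun x => ?_)
  simp only [norm_smul, Real.norm_of_nonneg hl.le]
  field_simp

lemma Dens.const_mul {f : Plane → ℝ} (hf : Dens f) {c : ℝ} (hc : 0 ≤ c) :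
    Dens (fun x => c * f x) :=
  hf.mul (c := fun _ => c) (C := c) measurable_const (fun _ => hc) (fun _ => le_rfl)

lemma ae_fst_ne_snd : ∀ᵐ p : Plane × Plane, p.1 ≠ p.2 := by
  have hs : MeasurableSet {p : Plane × Plane | p.1 = p.2} :=
    (isClosed_eq continuous_fst continuous_snd).measurableSet
  rw [ae_iff]
  simp only [ne_eq, not_not]
  rw [Measure.volume_eq_prod, Measure.measure_prod_null hs]
  refine Eventually.of_forall fun x => ?_
  have : Prod.mk x ⁻¹' {p : Plane × Plane | p.1 = p.2} = {x} := by
    ext y; simp [eq_comm]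
  simp [this]

lemma logInt_scale {f g : Plane → ℝ} (hf : Dens f) (hg : Dens g) {l : ℝ} (hl : 0 < l) :
    logInt (fun x => f (l • x)) (fun x => g (l • x))
      = (l ^ 4)⁻¹ * (logInt f g - Real.log l * ((∫ x, f x) * ∫ x, g x)) := by
  have h1 : logInt (fun x => f (l • x)) (fun x => g (l • x)) =
      ∫ p : Plane × Plane, (fun q : Plane × Plane =>
        Real.log ‖q.1 - q.2‖ * f q.1 * g q.2 - Real.log l * (f q.1 * g q.2)) (l • p) := by
    unfold logInt
    refine integral_congr_ae (ae_fst_ne_snd.mono fun p hp => ?_)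
    simp only [Prod.smul_fst, Prod.smul_snd]
    rw [← smul_sub, norm_smul, Real.norm_of_nonneg hl.le,
      Real.log_mul hl.ne' (by rw [norm_ne_zero_iff]; exact sub_ne_zero.2 hp)]
    ring
  rw [h1, Measure.volume_eq_prod,
    Measure.integral_comp_smul ((volume : Measure Plane).prod (volume : Measure Plane))
      (fun q : Plane × Plane =>
        Real.log ‖q.1 - q.2‖ * f q.1 * g q.2 - Real.log l * (f q.1 * g q.2)),
    Module.finrank_prod, finrank_euclideanSpace_fin,
    abs_of_pos (by positivity), smul_eq_mul,
    ← Measure.volume_eq_prod, integral_sub (log_integrable hf hg)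
      ((hf.int.mul_prod hg.int).const_mul _),
    integral_const_mul, Measure.volume_eq_prod, integral_prod_mul]
  rfl

lemma d0_ofReal {g : Plane → ℝ} {x : Plane} (hg : DifferentiableAt ℝ g x) :
    d0 (fun y => (g y : ℂ)) x = (d0R g x : ℂ) := by
  have h := (Complex.ofRealCLM.hasFDerivAt (x := g x)).comp x hg.hasFDerivAt
  unfold d0 d0R
  rw [show (fun y => (g y : ℂ)) = Complex.ofRealCLM ∘ g from rfl, h.fderiv]; simp

lemma d1_ofReal {g : Plane → ℝ} {x : Plane} (hg : DifferentiableAt ℝ g x) :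
    d1 (fun y => (g y : ℂ)) x = (d1R g x : ℂ) := by
  have h := (Complex.ofRealCLM.hasFDerivAt (x := g x)).comp x hg.hasFDerivAt
  unfold d1 d1R
  rw [show (fun y => (g y : ℂ)) = Complex.ofRealCLM ∘ g from rfl, h.fderiv]; simp

lemma gradSq_ofReal {g : Plane → ℝ} {x : Plane} (hg : DifferentiableAt ℝ g x) :
    gradSq (fun y => (g y : ℂ)) x = gradSqR g x := by
  unfold gradSq gradSqR
  rw [d0_ofReal hg, d1_ofReal hg]
  simp

lemma momentum_ofReal {g : Plane → ℝ} {x : Plane} (hg : DifferentiableAt ℝ g x) :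
    momentum (fun y => (g y : ℂ)) x = 0 := by
  unfold momentum
  rw [d0_ofReal hg, d1_ofReal hg]
  simp

lemma gradSqR_scale {v : Plane → ℝ} (hv : Differentiable ℝ v) (k l : ℝ) (x : Plane) :
    gradSqR (fun y => k * v (l • y)) x = (k * l) ^ 2 * gradSqR v (l • x) := by
  have h : HasFDerivAt (fun y => k * v (l • y))
      (k • ((fderiv ℝ v (l • x)).comp (l • ContinuousLinearMap.id ℝ Plane))) x :=
    ((hv (l • x)).hasFDerivAt.comp x ((hasFDerivAt_id x).const_smul l)).const_mul k
  unfold gradSqR d0R d1R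
  rw [h.fderiv]
  simp
  ring

/-- The structural hypotheses on the trap used throughout. -/
structure Trap (V : Plane → ℝ) (Ω C γ : ℝ) : Prop where
  meas : Measurable V
  Ω_pos : 0 < Ω
  nonneg : ∀ x : Plane, 0 ≤ V x - Ω ^ 2 / 4 * ‖x‖ ^ 2
  exp_le : ∀ x : Plane, V x ≤ C * Real.exp (γ * ‖x‖)

lemma Trap.V_nonneg {V : Plane → ℝ} {Ω C γ : ℝ} (h : Trap V Ω C γ) (x : Plane) : 0 ≤ V x := by
  have := h.nonneg x
  have : 0 ≤ Ω ^ 2 / 4 * ‖x‖ ^ 2 := by positivity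
  linarith

lemma Trap.C_nonneg {V : Plane → ℝ} {Ω C γ : ℝ} (h : Trap V Ω C γ) : 0 ≤ C := by
  have h1 := h.exp_le 0
  have h2 := h.V_nonneg 0
  simp at h1; linarith

/-- Real profiles which can be rescaled into trial states. -/
structure Profile (v : Plane → ℝ) : Prop where
  diff : Differentiable ℝ v
  int_exp : Integrable (fun x => Real.exp ‖x‖ * v x ^ 2)
  int_four : Integrable (fun x => v x ^ 4)
  int_grad : Integrable (gradSqR v)

lemma Profile.dens {v : Plane → ℝ} (hv : Profile v) : Dens (fun x => v x ^ 2) := by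
  have hc := hv.diff.continuous
  refine ⟨fun x => by positivity, ?_, ?_, ?_⟩
  · refine hv.int_exp.mono' (by fun_prop) (Eventually.of_forall fun x => ?_)
    rw [Real.norm_of_nonneg (by positivity)]
    have : 1 ≤ Real.exp ‖x‖ := Real.one_le_exp (norm_nonneg x)
    nlinarith [sq_nonneg (v x)]
  · refine hv.int_four.congr (Eventually.of_forall fun x => ?_); ring
  · refine hv.int_exp.mono' (by fun_prop) (Eventually.of_forall fun x => ?_)
    rw [Real.norm_of_nonneg (by positivity)]
    have := Real.add_one_le_exp ‖x‖
    gcongr; linarith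

lemma trial_bound {V : Plane → ℝ} {Ω C γ a : ℝ} (hV : Trap V Ω C γ) {u : Plane → ℂ}
    (hu : IsMinimizer V Ω a u) (ha : 0 ≤ a) {v : Plane → ℝ} (hv : Profile v)
    (hm : 0 < ∫ x, v x ^ 2) {l : ℝ} (hl : 1 ≤ l) (hγ : γ ≤ l) :
    Ea V Ω u ≤ l ^ 2 * ((a / ∫ x, v x ^ 2) * (∫ x, gradSqR v x)
        - 1 / 2 * (a / ∫ x, v x ^ 2) ^ 2 * ∫ x, v x ^ 4)
      + (C * (a / ∫ x, v x ^ 2) * (∫ x, Real.exp ‖x‖ * v x ^ 2)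
        + 1 / 2 * (a / ∫ x, v x ^ 2) ^ 2 * logInt (fun x => v x ^ 2) (fun x => v x ^ 2))
      - 1 / 2 * a ^ 2 * Real.log l := by
  set m := ∫ x, v x ^ 2 with hmdef
  have hl0 : 0 < l := by linarith
  have hC := hV.C_nonneg
  set c := √(a / m) with hcdef
  have hc2 : c ^ 2 = a / m := Real.sq_sqrt (by positivity)
  set g : Plane → ℝ := fun x => (c * l) * v (l • x) with hg
  have hgd : Differentiable ℝ g := (hv.diff.comp (differentiable_id.const_smul l)).const_mul _
  have hvc := hv.diff.continuous
  have hVm := hV.meas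
  set w : Plane → ℂ := fun x => (g x : ℂ) with hw
  have hwd : Differentiable ℝ w := Complex.ofRealCLM.differentiable.comp hgd
  have hn : ∀ x, ‖w x‖ ^ 2 = (c * l) ^ 2 * v (l • x) ^ 2 := fun x => by
    simp only [hw, hg, Complex.norm_real, Real.norm_eq_abs, sq_abs]; ring
  have hn4 : ∀ x, ‖w x‖ ^ 4 = (c * l) ^ 4 * v (l • x) ^ 4 := fun x => by
    rw [show ‖w x‖ ^ 4 = (‖w x‖ ^ 2) ^ 2 by ring, hn]; ring
  have hgr : ∀ x, gradSq w x = (c * l * l) ^ 2 * gradSqR v (l • x) := fun x => by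
    rw [hw, gradSq_ofReal (hgd x), hg, gradSqR_scale hv.diff]
  have hmass : ∫ x, ‖w x‖ ^ 2 = a := by
    simp_rw [hn]
    rw [integral_const_mul, integral_scale (fun x => v x ^ 2) hl0, ← hmdef, mul_pow, hc2]
    field_simp
  have hVle : ∀ x, V x * ‖w x‖ ^ 2 ≤
      C * (c * l) ^ 2 * (Real.exp ‖l • x‖ * v (l • x) ^ 2) := fun x => by
    rw [hn]
    have h1 : V x ≤ C * Real.exp ‖l • x‖ := by
      refine (hV.exp_le x).trans ?_
      rw [norm_smul, Real.norm_of_nonneg hl0.le]; gcongr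
    calc V x * ((c * l) ^ 2 * v (l • x) ^ 2)
        ≤ (C * Real.exp ‖l • x‖) * ((c * l) ^ 2 * v (l • x) ^ 2) := by gcongr
      _ = _ := by ring
  have iE : Integrable (fun x => C * (c * l) ^ 2 * (Real.exp ‖l • x‖ * v (l • x) ^ 2)) :=
    (Integrable.scale hv.int_exp hl0).const_mul _
  have iV : Integrable (fun x => V x * ‖w x‖ ^ 2) := by
    refine iE.mono' (hVm.mul (hwd.continuous.norm.pow 2).measurable).aestronglyMeasurable
      (Eventually.of_forall fun x => ?_)
    rw [Real.norm_of_nonneg (mul_nonneg (hV.V_nonneg x) (by positivity))]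
    exact hVle x
  have iG : Integrable (gradSq w) := by
    rw [show gradSq w = fun x => (c * l * l) ^ 2 * gradSqR v (l • x) from funext hgr]
    exact (Integrable.scale hv.int_grad hl0).const_mul _
  have hd2 := hv.dens
  have hD : Dens (fun x => ‖w x‖ ^ 2) := by
    simp_rw [hn]; exact (hd2.scale hl0).const_mul (by positivity)
  have hS : w ∈ Sset V a := ⟨⟨⟨hwd, hD.int, iG⟩, iV⟩, hmass⟩
  refine (hu.2 w hS).trans ?_
  have hmom : ∀ x, momentum w x = 0 := fun x => momentum_ofReal (hgd x)
  unfold Ea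
  rw [integral_add iG iV, logConv_eq hD]
  simp_rw [hmom, hn4, hn, hgr]
  rw [logInt_smul, logInt_scale hd2 hd2 hl0, integral_const_mul, integral_const_mul,
    integral_scale _ hl0, integral_scale (fun x => v x ^ 4) hl0, ← hmdef]
  have hVint : ∫ x, V x * ((c * l) ^ 2 * v (l • x) ^ 2) ≤
      C * (c * l) ^ 2 * ((l ^ 2)⁻¹ * ∫ x, Real.exp ‖x‖ * v x ^ 2) := by
    rw [← integral_scale (fun x => Real.exp ‖x‖ * v x ^ 2) hl0, ← integral_const_mul]
    refine integral_mono (by simpa only [hn] using iV) iE fun x => ?_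
    simpa only [hn] using hVle x
  have e : C * (c * l) ^ 2 * ((l ^ 2)⁻¹ * ∫ x, Real.exp ‖x‖ * v x ^ 2) =
      C * (a / m) * ∫ x, Real.exp ‖x‖ * v x ^ 2 := by
    rw [← hc2]; field_simp
  rw [e] at hVint
  rw [show a ^ 2 = (a / m) ^ 2 * m ^ 2 by field_simp, ← hc2] at *
  simp only [integral_zero, mul_zero, sub_zero]
  set T := ∫ x, gradSqR v x
  set P := ∫ x, Real.exp ‖x‖ * v x ^ 2
  set D := ∫ x, v x ^ 4
  set L := logInt (fun x => v x ^ 2) (fun x => v x ^ 2)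
  have e1 : (c * l * l) ^ 2 * ((l ^ 2)⁻¹ * T) = l ^ 2 * (c ^ 2 * T) := by field_simp
  have e2 : (c * l) ^ 2 * (c * l) ^ 2 * ((l ^ 4)⁻¹ * (L - Real.log l * (m * m)))
      = (c ^ 2) ^ 2 * (L - Real.log l * m ^ 2) := by field_simp
  have e3 : (c * l) ^ 4 * ((l ^ 2)⁻¹ * D) = l ^ 2 * ((c ^ 2) ^ 2 * D) := by field_simp
  rw [e1, e2, e3]
  linarith

/-- The Gagliardo–Nirenberg inequality with constant `2 / A`, for real profiles. -/
def GNIneq (A : ℝ) : Prop :=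
  ∀ v : Plane → ℝ, Profile v → A * ∫ x, v x ^ 4 ≤ 2 * (∫ x, gradSqR v x) * ∫ x, v x ^ 2

lemma gn_of_minimizers {V : Plane → ℝ} {Ω C γ A : ℝ} (hV : Trap V Ω C γ) (hA : 0 < A)
    {u : ℝ → Plane → ℂ} (hu : ∀ a ∈ Ioo (0 : ℝ) A, IsMinimizer V Ω a (u a)) : GNIneq A := by
  intro v hv
  have hm0 : 0 ≤ ∫ x, v x ^ 2 := integral_nonneg fun x => by positivity
  have hT0 : 0 ≤ ∫ x, gradSqR v x := integral_nonneg fun x => gradSqR_nonneg _ _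
  rcases hm0.eq_or_lt with hm | hm
  · have h1 := (integral_eq_zero_iff_of_nonneg (fun x => by positivity) hv.dens.int).1 hm.symm
    have h2 : ∫ x, v x ^ 4 = 0 := by
      refine integral_eq_zero_of_ae (h1.mono fun x hx => ?_)
      simp only [Pi.zero_apply] at hx ⊢
      rw [show v x ^ 4 = (v x ^ 2) ^ 2 by ring, hx]; ring
    rw [h2, ← hm]; simp
  by_contra hcon
  push Not at hcon
  set m := ∫ x, v x ^ 2
  set T := ∫ x, gradSqR v x
  set D := ∫ x, v x ^ 4
  have hD : 0 < D := by
    by_contra h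
    push Not at h
    nlinarith [mul_nonneg hT0 hm.le, mul_nonpos_of_nonneg_of_nonpos hA.le h]
  obtain ⟨a, ha1, ha2⟩ := exists_between
    (show 2 * T * m / D < A by rw [div_lt_iff₀ hD]; exact hcon)
  have ha0 : 0 < a := lt_of_le_of_lt (by positivity) ha1
  rw [div_lt_iff₀ hD] at ha1
  have hbr : (a / m) * T - 1 / 2 * (a / m) ^ 2 * D < 0 := by
    have : (a / m) * T - 1 / 2 * (a / m) ^ 2 * D = a / m ^ 2 * ((2 * T * m - a * D) / 2) := by
      field_simp
    rw [this]
    exact mul_neg_of_pos_of_neg (by positivity) (by linarith)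
  have key := fun l hl hγ => trial_bound hV (hu a ⟨ha0, ha2⟩) ha0.le hv hm (l := l) hl hγ
  set β := (a / m) * T - 1 / 2 * (a / m) ^ 2 * D
  set K := C * (a / m) * (∫ x, Real.exp ‖x‖ * v x ^ 2)
        + 1 / 2 * (a / m) ^ 2 * logInt (fun x => v x ^ 2) (fun x => v x ^ 2)
  set E := Ea V Ω (u a)
  set l := max 1 (max γ ((|K - E| + 1) / (-β))) with hl
  have h1 : 1 ≤ l := le_max_left _ _
  have h2 : γ ≤ l := (le_max_left _ _).trans (le_max_right _ _)
  have h3 : (|K - E| + 1) / (-β) ≤ l := (le_max_right _ _).trans (le_max_right _ _)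
  have h4 := key l h1 h2
  rw [div_le_iff₀ (by linarith)] at h3
  have h5 : 0 ≤ 1 / 2 * a ^ 2 * Real.log l := by have := Real.log_nonneg h1; positivity
  have h6 := le_abs_self (K - E)
  have h7 : 0 ≤ (l - 1) * (l * -β) :=
    mul_nonneg (by linarith) (mul_nonneg (by linarith) (by linarith))
  nlinarith

lemma fatou_bound {f : ℕ → Plane → ℝ} {F : Plane → ℝ} {c : ℕ → ℝ} {C : ℝ}
    (hi : ∀ k, Integrable (f k)) (h0 : ∀ k x, 0 ≤ f k x)
    (hF : ∀ x, Tendsto (fun k => f k x) atTop (𝓝 (F x)))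
    (hc : ∀ k, ∫ x, f k x ≤ c k) (hC : Tendsto c atTop (𝓝 C)) :
    Integrable F ∧ ∫ x, F x ≤ C := by
  have hF0 : ∀ x, 0 ≤ F x := fun x => ge_of_tendsto' (hF x) fun k => h0 k x
  have hFm : AEStronglyMeasurable F volume :=
    aestronglyMeasurable_of_tendsto_ae atTop (fun k => (hi k).aestronglyMeasurable)
      (Eventually.of_forall hF)
  have hC0 : 0 ≤ C := ge_of_tendsto' hC fun k => (integral_nonneg (h0 k)).trans (hc k)
  have key : ∫⁻ x, ENNReal.ofReal (F x) ≤ ENNReal.ofReal C := by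
    calc ∫⁻ x, ENNReal.ofReal (F x)
        = ∫⁻ x, liminf (fun k => ENNReal.ofReal (f k x)) atTop := by
          refine lintegral_congr fun x => ?_
          exact ((ENNReal.continuous_ofReal.tendsto _).comp (hF x)).liminf_eq.symm
      _ ≤ liminf (fun k => ∫⁻ x, ENNReal.ofReal (f k x)) atTop :=
          lintegral_liminf_le' fun k => (hi k).aestronglyMeasurable.aemeasurable.ennreal_ofReal
      _ ≤ liminf (fun k => ENNReal.ofReal (c k)) atTop := by
          refine liminf_le_liminf (Eventually.of_forall fun k => ?_)
          rw [← ofReal_integral_eq_lintegral_ofReal (hi k) (Eventually.of_forall (h0 k))]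
          exact ENNReal.ofReal_le_ofReal (hc k)
      _ = ENNReal.ofReal C := ((ENNReal.continuous_ofReal.tendsto _).comp hC).liminf_eq
  have hFint : Integrable F := by
    refine ⟨hFm, ?_⟩
    rw [hasFiniteIntegral_iff_ofReal (Eventually.of_forall hF0)]
    exact key.trans_lt ENNReal.ofReal_lt_top
  refine ⟨hFint, ?_⟩
  rw [← ofReal_integral_eq_lintegral_ofReal hFint (Eventually.of_forall hF0)] at key
  exact (ENNReal.ofReal_le_ofReal_iff hC0).1 key

lemma hasFDerivAt_normSq {u : Plane → ℂ} {x : Plane} (hu : DifferentiableAt ℝ u x) :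
    HasFDerivAt (fun y => ‖u y‖ ^ 2) (2 • (innerSL ℝ (u x)).comp (fderiv ℝ u x)) x :=
  hu.hasFDerivAt.norm_sq

lemma d0R_comp_normSq {u : Plane → ℂ} {x : Plane} (hu : DifferentiableAt ℝ u x) {g : ℝ → ℝ}
    {g' : ℝ} (hg : HasDerivAt g g' (‖u x‖ ^ 2)) :
    d0R (fun y => g (‖u y‖ ^ 2)) x = 2 * g' * ((starRingEnd ℂ) (u x) * d0 u x).re := by
  have h := HasDerivAt.comp_hasFDerivAt x hg (hasFDerivAt_normSq hu)
  unfold d0R d0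
  rw [show (fun y => g (‖u y‖ ^ 2)) = g ∘ fun y => ‖u y‖ ^ 2 from rfl, h.fderiv]
  simp [Complex.inner]
  ring

lemma d1R_comp_normSq {u : Plane → ℂ} {x : Plane} (hu : DifferentiableAt ℝ u x) {g : ℝ → ℝ}
    {g' : ℝ} (hg : HasDerivAt g g' (‖u x‖ ^ 2)) :
    d1R (fun y => g (‖u y‖ ^ 2)) x = 2 * g' * ((starRingEnd ℂ) (u x) * d1 u x).re := by
  have h := HasDerivAt.comp_hasFDerivAt x hg (hasFDerivAt_normSq hu)
  unfold d1R d1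
  rw [show (fun y => g (‖u y‖ ^ 2)) = g ∘ fun y => ‖u y‖ ^ 2 from rfl, h.fderiv]
  simp [Complex.inner]
  ring

lemma re_sq_le (b : ℝ) (u : Plane → ℂ) (x : Plane) :
    ((starRingEnd ℂ) (u x) * d0 u x).re ^ 2 + ((starRingEnd ℂ) (u x) * d1 u x).re ^ 2
      ≤ ‖u x‖ ^ 2 * magSq b u x := by
  set P := ((starRingEnd ℂ) (u x) * d0 u x).re
  set R := ((starRingEnd ℂ) (u x) * d1 u x).re
  have hP : P = ((starRingEnd ℂ) (u x) *
      (d0 u x + Complex.I * ((b / 2 * x 1 : ℝ) : ℂ) * u x)).re := by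
    simp [P]; ring
  have hR : R = ((starRingEnd ℂ) (u x) *
      (d1 u x - Complex.I * ((b / 2 * x 0 : ℝ) : ℂ) * u x)).re := by
    simp [R]; ring
  have aux : ∀ z w : ℂ, ((starRingEnd ℂ) z * w).re ^ 2 ≤ ‖z‖ ^ 2 * ‖w‖ ^ 2 := fun z w => by
    have h := Complex.abs_re_le_norm ((starRingEnd ℂ) z * w)
    rw [norm_mul, RCLike.norm_conj] at h
    rw [← sq_abs, ← mul_pow]; gcongr
  unfold magSq
  rw [hP, hR]
  exact (add_le_add (aux _ _) (aux _ _)).trans_eq (by ring)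

/-- Diamagnetic inequality for a regularized modulus. -/
lemma gradSqR_comp_normSq_le (b : ℝ) {u : Plane → ℂ} {x : Plane} (hu : DifferentiableAt ℝ u x)
    {g : ℝ → ℝ} {g' : ℝ} (hg : HasDerivAt g g' (‖u x‖ ^ 2))
    (h : (2 * g') ^ 2 * ‖u x‖ ^ 2 ≤ 1) :
    gradSqR (fun y => g (‖u y‖ ^ 2)) x ≤ magSq b u x := by
  unfold gradSqR
  rw [d0R_comp_normSq hu hg, d1R_comp_normSq hu hg, mul_pow, mul_pow _ (Complex.re _), ← mul_add]
  calc (2 * g') ^ 2 * _ ≤ (2 * g') ^ 2 * (‖u x‖ ^ 2 * magSq b u x) := by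
        gcongr; exact re_sq_le b u x
    _ = (2 * g') ^ 2 * ‖u x‖ ^ 2 * magSq b u x := by ring
    _ ≤ 1 * magSq b u x := by gcongr; exact magSq_nonneg _ _ _
    _ = _ := one_mul _

lemma gradSqR_mul_le {f g : Plane → ℝ} {x : Plane} (hf : DifferentiableAt ℝ f x)
    (hg : DifferentiableAt ℝ g x) {κ : ℝ} (hκ : 0 < κ) :
    gradSqR (fun y => f y * g y) x
      ≤ (1 + κ) * (f x ^ 2 * gradSqR g x) + (1 + κ⁻¹) * (g x ^ 2 * gradSqR f x) := by
  have aux : ∀ p q : ℝ, (p + q) ^ 2 ≤ (1 + κ) * p ^ 2 + (1 + κ⁻¹) * q ^ 2 := fun p q => by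
    have : (1 + κ) * p ^ 2 + (1 + κ⁻¹) * q ^ 2 - (p + q) ^ 2 = κ⁻¹ * (κ * p - q) ^ 2 := by
      field_simp; ring
    have : 0 ≤ κ⁻¹ * (κ * p - q) ^ 2 := by positivity
    linarith
  unfold gradSqR d0R d1R
  rw [fderiv_fun_mul hf hg]
  simp only [_root_.add_apply, _root_.smul_apply, smul_eq_mul]
  have h0 := aux (f x * fderiv ℝ g x e0) (g x * fderiv ℝ f x e0)
  have h1 := aux (f x * fderiv ℝ g x e1) (g x * fderiv ℝ f x e1)
  nlinarith

lemma gradSqR_one_sub (f : Plane → ℝ) (x : Plane) :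
    gradSqR (fun y => 1 - f y) x = gradSqR f x := by
  unfold gradSqR d0R d1R
  simp [fderiv_const_sub]

lemma profile_of_compact {v : Plane → ℝ} (hd : Differentiable ℝ v) (hc : HasCompactSupport v)
    (hg : Integrable (gradSqR v)) : Profile v := by
  have := hd.continuous
  refine ⟨hd, ?_, ?_, hg⟩
  · refine Continuous.integrable_of_hasCompactSupport (by fun_prop) ?_
    exact hc.mono fun x hx => by simp_all
  · refine Continuous.integrable_of_hasCompactSupport (by fun_prop) ?_
    exact hc.mono fun x hx => by simp_all

lemma hasCompactSupport_of_norm {v : Plane → ℝ} {R : ℝ} (z : Plane)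
    (h : ∀ x, R ≤ ‖x - z‖ → v x = 0) : HasCompactSupport v := by
  refine HasCompactSupport.intro (isCompact_closedBall z R) fun x hx => h x ?_
  rw [mem_closedBall, dist_eq_norm] at hx; linarith

lemma GNIneq.mag {A : ℝ} (hA : 0 < A) (hGN : GNIneq A) {b : ℝ} {u : Plane → ℂ}
    (hu : MagH1 b u) :
    Integrable (fun x => ‖u x‖ ^ 4) ∧
      A * ∫ x, ‖u x‖ ^ 4 ≤ 2 * (∫ x, magSq b u x) * ∫ x, ‖u x‖ ^ 2 := by
  obtain ⟨B, hB0, hB⟩ := smoothTransition_deriv_bound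
  set T := ∫ x, magSq b u x
  set m := ∫ x, ‖u x‖ ^ 2
  have hm : 0 ≤ m := integral_nonneg fun x => by positivity
  set R : ℕ → ℝ := fun k => (k : ℝ) + 1 with hRdef
  have hR : ∀ k, 0 < R k := fun k => by positivity
  set ct : ℕ → Plane → ℝ := fun k x => 1 - cut 0 (R k ^ 2) ((2 * R k) ^ 2) x with hct
  have hlt : ∀ k, R k ^ 2 < (2 * R k) ^ 2 := fun k => by nlinarith [hR k]
  set gg : ℕ → ℝ → ℝ := fun k t => √(t + (R k)⁻¹ ^ 2) - (R k)⁻¹ with hgg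
  have hgd : ∀ k t, 0 ≤ t → HasDerivAt (gg k) (1 / (2 * √(t + (R k)⁻¹ ^ 2))) t := fun k t ht => by
    have hp : t + (R k)⁻¹ ^ 2 ≠ 0 := by have := hR k; positivity
    exact (((hasDerivAt_id t).add_const _).sqrt hp).sub_const _
  have hg0 : ∀ k t, 0 ≤ t → 0 ≤ gg k t := fun k t ht => by
    simp only [hgg, sub_nonneg]
    exact Real.le_sqrt_of_sq_le (by linarith)
  have hg1 : ∀ k t, 0 ≤ t → gg k t ^ 2 ≤ t := fun k t ht => by
    have h1 : gg k t ≤ √t := by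
      simp only [hgg]
      have h2 : 0 < (R k)⁻¹ := inv_pos.2 (hR k)
      have h3 : √(t + (R k)⁻¹ ^ 2) ≤ √t + (R k)⁻¹ := Real.sqrt_le_iff.2
        ⟨by positivity, by nlinarith [Real.sq_sqrt ht, mul_nonneg (Real.sqrt_nonneg t) h2.le]⟩
      linarith
    calc gg k t ^ 2 ≤ √t ^ 2 := by gcongr; exact hg0 k t ht
      _ = t := Real.sq_sqrt ht
  set ρ : ℕ → Plane → ℝ := fun k x => gg k (‖u x‖ ^ 2) with hρ
  have hρd : ∀ k, Differentiable ℝ (ρ k) := fun k x =>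
    ((hgd k _ (by positivity)).comp_hasFDerivAt x
      (hasFDerivAt_normSq (hu.diff x))).differentiableAt
  have hctd : ∀ k, Differentiable ℝ (ct k) := fun k => (differentiable_cut _ _ _).const_sub 1
  have hct0 : ∀ k x, 0 ≤ ct k x := fun k x => by
    have := cut_le_one 0 (R k ^ 2) ((2 * R k) ^ 2) x; simp only [hct]; linarith
  have hct1 : ∀ k x, ct k x ≤ 1 := fun k x => by
    have := cut_nonneg 0 (R k ^ 2) ((2 * R k) ^ 2) x; simp only [hct]; linarith
  have hctg : ∀ k x, gradSqR (ct k) x ≤ 2 * B ^ 2 / R k ^ 2 := fun k x => by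
    simp only [hct]
    rw [gradSqR_one_sub]
    refine (gradSqR_cut_le hB 0 (by positivity) (hlt k) x).trans ?_
    have := hR k
    rw [show (2 * R k) ^ 2 - R k ^ 2 = 3 * R k ^ 2 by ring, div_le_div_iff₀ (by positivity)
      (by positivity)]
    nlinarith [show 0 ≤ B ^ 2 * (R k) ^ 4 by positivity]
  set v : ℕ → Plane → ℝ := fun k x => ct k x * ρ k x with hv
  have hvd : ∀ k, Differentiable ℝ (v k) := fun k => (hctd k).mul (hρd k)
  have hgb : ∀ k x, gradSqR (v k) x ≤ (1 + (R k)⁻¹) * magSq b u x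
      + (1 + R k) * (2 * B ^ 2 / R k ^ 2) * ‖u x‖ ^ 2 := fun k x => by
    have h1 := gradSqR_mul_le (hctd k x) (hρd k x) (inv_pos.2 (hR k))
    rw [inv_inv] at h1
    refine h1.trans ?_
    have h2 : gradSqR (ρ k) x ≤ magSq b u x := by
      refine gradSqR_comp_normSq_le b (hu.diff x) (hgd k _ (by positivity)) ?_
      have hp : 0 < ‖u x‖ ^ 2 + (R k)⁻¹ ^ 2 := by have := hR k; positivity
      have e : (2 * (1 / (2 * √(‖u x‖ ^ 2 + (R k)⁻¹ ^ 2)))) ^ 2 =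
          (‖u x‖ ^ 2 + (R k)⁻¹ ^ 2)⁻¹ := by
        rw [show 2 * (1 / (2 * √(‖u x‖ ^ 2 + (R k)⁻¹ ^ 2))) = (√(‖u x‖ ^ 2 + (R k)⁻¹ ^ 2))⁻¹ by
          field_simp, inv_pow, Real.sq_sqrt hp.le]
      rw [e, inv_mul_le_iff₀ hp]
      have := sq_nonneg (R k)⁻¹
      linarith
    have h3 : ρ k x ^ 2 ≤ ‖u x‖ ^ 2 := hg1 k _ (by positivity)
    have h4 : ct k x ^ 2 ≤ 1 := pow_le_one₀ (hct0 k x) (hct1 k x)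
    have h5 := hctg k x
    have hRk := hR k
    have h6 : ct k x ^ 2 * gradSqR (ρ k) x ≤ 1 * magSq b u x :=
      mul_le_mul h4 h2 (gradSqR_nonneg _ _) zero_le_one
    have h7 : ρ k x ^ 2 * gradSqR (ct k) x ≤ ‖u x‖ ^ 2 * (2 * B ^ 2 / R k ^ 2) :=
      mul_le_mul h3 h5 (gradSqR_nonneg _ _) (by positivity)
    calc _ ≤ (1 + (R k)⁻¹) * (1 * magSq b u x)
          + (1 + R k) * (‖u x‖ ^ 2 * (2 * B ^ 2 / R k ^ 2)) := by gcongr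
      _ = _ := by ring
  have igb : ∀ k, Integrable (fun x => (1 + (R k)⁻¹) * magSq b u x
      + (1 + R k) * (2 * B ^ 2 / R k ^ 2) * ‖u x‖ ^ 2) := fun k =>
    (hu.int_mag.const_mul _).add (hu.int.const_mul _)
  have hvp : ∀ k, Profile (v k) := fun k => by
    refine profile_of_compact (hvd k) (hasCompactSupport_of_norm 0 (R := 2 * R k) fun x hx => ?_) ?_
    · have hRk := hR k
      simp only [hv, hct]
      rw [cut_eq_one (hlt k) (by gcongr)]; simp
    · refine (igb k).mono' (measurable_gradSqR _).aestronglyMeasurable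
        (Eventually.of_forall fun x => ?_)
      rw [Real.norm_of_nonneg (gradSqR_nonneg _ _)]; exact hgb k x
  have hv2 : ∀ k x, v k x ^ 2 ≤ ‖u x‖ ^ 2 := fun k x => by
    simp only [hv, mul_pow]
    have h3 : ρ k x ^ 2 ≤ ‖u x‖ ^ 2 := hg1 k _ (by positivity)
    have h4 : ct k x ^ 2 ≤ 1 := pow_le_one₀ (hct0 k x) (hct1 k x)
    nlinarith [sq_nonneg (ρ k x)]
  have hbound : ∀ k, ∫ x, v k x ^ 4 ≤ A⁻¹ * (2 * ((1 + (R k)⁻¹) * T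
      + (1 + R k) * (2 * B ^ 2 / R k ^ 2) * m) * m) := fun k => by
    rw [← div_eq_inv_mul, le_div_iff₀ hA, mul_comm]
    refine (hGN (v k) (hvp k)).trans ?_
    have h1 : ∫ x, gradSqR (v k) x ≤ (1 + (R k)⁻¹) * T
        + (1 + R k) * (2 * B ^ 2 / R k ^ 2) * m := by
      refine (integral_mono (hvp k).int_grad (igb k) (hgb k)).trans (le_of_eq ?_)
      rw [integral_add (hu.int_mag.const_mul _) (hu.int.const_mul _), integral_const_mul,
        integral_const_mul]
    have h2 : ∫ x, v k x ^ 2 ≤ m := integral_mono (hvp k).dens.int hu.int (hv2 k)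
    have h3 : 0 ≤ ∫ x, gradSqR (v k) x := integral_nonneg fun x => gradSqR_nonneg _ _
    have h4 : 0 ≤ ∫ x, v k x ^ 2 := integral_nonneg fun x => by positivity
    exact mul_le_mul (by linarith) h2 h4 (by linarith)
  have hRlim : Tendsto (fun k => (R k)⁻¹) atTop (𝓝 0) := by
    simpa [hRdef, one_div] using tendsto_one_div_add_atTop_nhds_zero_nat (𝕜 := ℝ)
  have hlim : Tendsto (fun k => A⁻¹ * (2 * ((1 + (R k)⁻¹) * T
      + (1 + R k) * (2 * B ^ 2 / R k ^ 2) * m) * m)) atTop (𝓝 (A⁻¹ * (2 * T * m))) := by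
    have e : ∀ k, A⁻¹ * (2 * ((1 + (R k)⁻¹) * T
      + (1 + R k) * (2 * B ^ 2 / R k ^ 2) * m) * m) = A⁻¹ * (2 * ((1 + (R k)⁻¹) * T
      + ((R k)⁻¹ ^ 2 + (R k)⁻¹) * (2 * B ^ 2) * m) * m) := fun k => by
      have := (hR k).ne'
      field_simp
    simp_rw [e]
    have hc : Continuous fun t : ℝ => A⁻¹ * (2 * ((1 + t) * T
      + (t ^ 2 + t) * (2 * B ^ 2) * m) * m) := by fun_prop
    have := (hc.tendsto 0).comp hRlim
    simpa [Function.comp_def] using this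
  have hpt : ∀ x, Tendsto (fun k => v k x ^ 4) atTop (𝓝 (‖u x‖ ^ 4)) := fun x => by
    have h1 : Tendsto (fun k => ρ k x) atTop (𝓝 ‖u x‖) := by
      have hc : Continuous fun t : ℝ => √(‖u x‖ ^ 2 + t ^ 2) - t := by fun_prop
      have := (hc.tendsto 0).comp hRlim
      simpa [Function.comp_def, hρ, hgg] using this
    have h2 : ∀ᶠ k in atTop, v k x = ρ k x := by
      filter_upwards [eventually_ge_atTop ⌈‖x‖⌉₊] with k hk
      have hk' : ((⌈‖x‖⌉₊ : ℕ) : ℝ) ≤ k := by exact_mod_cast hk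
      have hx : ‖x‖ ≤ R k := (Nat.le_ceil _).trans (by simp only [hRdef]; linarith)
      simp only [hv, hct]
      rw [cut_eq_zero (hlt k) (by rw [sub_zero]; gcongr)]; simp
    exact (h1.congr' (h2.mono fun k hk => hk.symm)).pow 4
  obtain ⟨hi, hle⟩ := fatou_bound (fun k => (hvp k).int_four) (fun k x => by positivity) hpt
    hbound hlim
  refine ⟨hi, ?_⟩
  rw [← div_eq_inv_mul, le_div_iff₀ hA] at hle
  linarith

/-- A smooth cutoff equal to `1` on the ball of radius `k + 1`, supported in the doubled ball. -/
def chi (k : ℕ) (x : Plane) : ℝ := 1 - cut 0 (((k : ℝ) + 1) ^ 2) ((2 * ((k : ℝ) + 1)) ^ 2) x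

lemma chi_lt (k : ℕ) : ((k : ℝ) + 1) ^ 2 < (2 * ((k : ℝ) + 1)) ^ 2 := by
  have : (0:ℝ) < (k : ℝ) + 1 := by positivity
  nlinarith

lemma chi_nonneg (k : ℕ) (x : Plane) : 0 ≤ chi k x := by
  have := cut_le_one 0 (((k : ℝ) + 1) ^ 2) ((2 * ((k : ℝ) + 1)) ^ 2) x; unfold chi; linarith

lemma chi_le_one (k : ℕ) (x : Plane) : chi k x ≤ 1 := by
  have := cut_nonneg 0 (((k : ℝ) + 1) ^ 2) ((2 * ((k : ℝ) + 1)) ^ 2) x; unfold chi; linarith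

lemma abs_chi_le (k : ℕ) (x : Plane) : |chi k x| ≤ 1 := by
  rw [abs_of_nonneg (chi_nonneg k x)]; exact chi_le_one k x

lemma chi_eq_one {k : ℕ} {x : Plane} (h : ‖x‖ ≤ k + 1) : chi k x = 1 := by
  unfold chi; rw [cut_eq_zero (chi_lt k) (by rw [sub_zero]; gcongr)]; simp

lemma chi_eq_zero {k : ℕ} {x : Plane} (h : 2 * ((k : ℝ) + 1) ≤ ‖x‖) : chi k x = 0 := by
  unfold chi; rw [cut_eq_one (chi_lt k) (by rw [sub_zero]; gcongr)]; simp

lemma contDiff_chi (k : ℕ) : ContDiff ℝ 1 (chi k) :=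
  contDiff_const.sub ((contDiff_cut _ _ _).of_le (by norm_num))

lemma compact_chi (k : ℕ) : HasCompactSupport (chi k) :=
  hasCompactSupport_of_norm 0 (R := 2 * ((k : ℝ) + 1)) fun x hx =>
    chi_eq_zero (by rwa [sub_zero] at hx)

lemma gradSqR_chi (k : ℕ) (x : Plane) :
    gradSqR (chi k) x = gradSqR (cut 0 (((k : ℝ) + 1) ^ 2) ((2 * ((k : ℝ) + 1)) ^ 2)) x :=
  gradSqR_one_sub _ x

lemma gradSqR_chi_eq_zero {k : ℕ} {x : Plane} (h : ‖x‖ ≤ k + 1 ∨ 2 * ((k : ℝ) + 1) ≤ ‖x‖) :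
    gradSqR (chi k) x = 0 := by
  rw [gradSqR_chi]
  refine gradSqR_cut_eq_zero (chi_lt k) (h.imp (fun h => ?_) (fun h => ?_)) <;>
  · rw [sub_zero]; gcongr

lemma gradSqR_chi_le {B : ℝ} (hB : ∀ t : ℝ, |deriv Real.smoothTransition t| ≤ B) (k : ℕ)
    (x : Plane) : gradSqR (chi k) x ≤ 2 * B ^ 2 / ((k : ℝ) + 1) ^ 2 := by
  rw [gradSqR_chi]
  refine (gradSqR_cut_le hB 0 (by positivity) (chi_lt k) x).trans ?_
  rw [show (2 * ((k : ℝ) + 1)) ^ 2 - ((k : ℝ) + 1) ^ 2 = 3 * ((k : ℝ) + 1) ^ 2 by ring,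
    div_le_div_iff₀ (by positivity) (by positivity)]
  nlinarith [show 0 ≤ B ^ 2 * ((k : ℝ) + 1) ^ 4 by positivity]

lemma gradSqR_chi_le' {B : ℝ} (hB : ∀ t : ℝ, |deriv Real.smoothTransition t| ≤ B) (k : ℕ)
    (x : Plane) : gradSqR (chi k) x ≤ 2 * B ^ 2 := by
  refine (gradSqR_chi_le hB k x).trans (div_le_self (by positivity) ?_)
  have : (0:ℝ) ≤ k := by positivity
  nlinarith

lemma norm_sq_mul_gradSqR_chi_le {B : ℝ} (hB : ∀ t : ℝ, |deriv Real.smoothTransition t| ≤ B)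
    (k : ℕ) (x : Plane) : ‖x‖ ^ 2 * gradSqR (chi k) x ≤ 8 * B ^ 2 := by
  by_cases h : 2 * ((k : ℝ) + 1) ≤ ‖x‖
  · rw [gradSqR_chi_eq_zero (Or.inr h)]; simp; positivity
  · push Not at h
    calc ‖x‖ ^ 2 * gradSqR (chi k) x
        ≤ (2 * ((k : ℝ) + 1)) ^ 2 * (2 * B ^ 2 / ((k : ℝ) + 1) ^ 2) :=
          mul_le_mul (by gcongr) (gradSqR_chi_le hB k x) (gradSqR_nonneg _ _) (by positivity)
      _ = 8 * B ^ 2 := by field_simp; ring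

lemma eventually_norm_le (x : Plane) : ∀ᶠ k : ℕ in atTop, ‖x‖ < k + 1 := by
  filter_upwards [eventually_ge_atTop ⌈‖x‖⌉₊] with k hk
  have hk' : ((⌈‖x‖⌉₊ : ℕ) : ℝ) ≤ k := by exact_mod_cast hk
  have := Nat.le_ceil ‖x‖
  linarith

/-- Integrals against a bounded sequence which is eventually constant at every point. -/
lemma tendsto_integral_of_eventually {f : ℕ → Plane → ℝ} {F G : Plane → ℝ}
    (hf : ∀ k, AEStronglyMeasurable (f k) volume) (hG : Integrable G)
    (hb : ∀ k x, |f k x| ≤ G x) (h : ∀ x, ∀ᶠ k in atTop, f k x = F x) :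
    Tendsto (fun k => ∫ x, f k x) atTop (𝓝 (∫ x, F x)) :=
  tendsto_integral_of_dominated_convergence G hf hG (fun k => Eventually.of_forall (hb k))
    (Eventually.of_forall fun x => tendsto_nhds_of_eventually_eq (h x))

lemma contDiff_d0R {F : Plane → ℝ} {n : ℕ} (hF : ContDiff ℝ (n + 1) F) : ContDiff ℝ n (d0R F) :=
  (hF.fderiv_right (m := n) le_rfl).clm_apply contDiff_const

lemma contDiff_d1R {F : Plane → ℝ} {n : ℕ} (hF : ContDiff ℝ (n + 1) F) : ContDiff ℝ n (d1R F) :=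
  (hF.fderiv_right (m := n) le_rfl).clm_apply contDiff_const

lemma integral_div_test {F0 F1 g : Plane → ℝ} (h0 : ContDiff ℝ 1 F0) (h1 : ContDiff ℝ 1 F1)
    (hg : ContDiff ℝ 1 g) (hc : HasCompactSupport g) :
    ∫ x, (F0 x * d0R g x + F1 x * d1R g x) = -∫ x, (d0R F0 x + d1R F1 x) * g x := by
  have c0 : Continuous (d0R F0) := (contDiff_d0R (n := 0) (by simpa using h0)).continuous
  have c1 : Continuous (d1R F1) := (contDiff_d1R (n := 0) (by simpa using h1)).continuous
  have cg0 : Continuous (d0R g) := (contDiff_d0R (n := 0) (by simpa using hg)).continuous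
  have cg1 : Continuous (d1R g) := (contDiff_d1R (n := 0) (by simpa using hg)).continuous
  have hc0 : HasCompactSupport (d0R g) := hc.fderiv_apply (𝕜 := ℝ) e0
  have hc1 : HasCompactSupport (d1R g) := hc.fderiv_apply (𝕜 := ℝ) e1
  have i1 : Integrable fun x => d0R F0 x * g x :=
    (c0.mul hg.continuous).integrable_of_hasCompactSupport hc.mul_left
  have i2 : Integrable fun x => F0 x * d0R g x :=
    (h0.continuous.mul cg0).integrable_of_hasCompactSupport hc0.mul_left
  have i3 : Integrable fun x => F0 x * g x :=
    (h0.continuous.mul hg.continuous).integrable_of_hasCompactSupport hc.mul_left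
  have j1 : Integrable fun x => d1R F1 x * g x :=
    (c1.mul hg.continuous).integrable_of_hasCompactSupport hc.mul_left
  have j2 : Integrable fun x => F1 x * d1R g x :=
    (h1.continuous.mul cg1).integrable_of_hasCompactSupport hc1.mul_left
  have j3 : Integrable fun x => F1 x * g x :=
    (h1.continuous.mul hg.continuous).integrable_of_hasCompactSupport hc.mul_left
  have k0 := integral_mul_fderiv_eq_neg_fderiv_mul_of_integrable (𝕜 := ℝ) (v := e0) i1 i2 i3
    (fun x _ => h0.differentiable one_ne_zero x) (fun x _ => hg.differentiable one_ne_zero x)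
  have k1 := integral_mul_fderiv_eq_neg_fderiv_mul_of_integrable (𝕜 := ℝ) (v := e1) j1 j2 j3
    (fun x _ => h1.differentiable one_ne_zero x) (fun x _ => hg.differentiable one_ne_zero x)
  simp_rw [add_mul]
  rw [integral_add i2 j2, integral_add i1 j1, neg_add]
  exact congrArg₂ (· + ·) k0 k1

section GroundState

variable {Q : Plane → ℝ}

lemma IsGroundState.diff (hQ : IsGroundState Q) : Differentiable ℝ Q :=
  hQ.1.differentiable two_ne_zero

lemma IsGroundState.magH1 (hQ : IsGroundState Q) : MagH1 0 (fun x => (Q x : ℂ)) := by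
  refine ⟨Complex.ofRealCLM.differentiable.comp hQ.diff, ?_, ?_⟩
  · simpa using hQ.2.2.2.1
  · have e : magSq 0 (fun x => (Q x : ℂ)) = gradSqR Q := by
      funext x; rw [magSq_zero, gradSq_ofReal (hQ.diff x)]
    rw [e]
    refine (hQ.2.2.2.2.1.const_mul 2).mono' (measurable_gradSqR Q).aestronglyMeasurable
      (Eventually.of_forall fun x => ?_)
    rw [Real.norm_of_nonneg (gradSqR_nonneg _ _)]
    have n0 : ‖e0‖ = 1 := by simp [e0]
    have n1 : ‖e1‖ = 1 := by simp [e1]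
    have h0 := (fderiv ℝ Q x).le_opNorm e0
    have h1 := (fderiv ℝ Q x).le_opNorm e1
    rw [n0, mul_one, Real.norm_eq_abs] at h0
    rw [n1, mul_one, Real.norm_eq_abs] at h1
    unfold gradSqR d0R d1R
    have h0' := pow_le_pow_left₀ (abs_nonneg _) h0 2
    have h1' := pow_le_pow_left₀ (abs_nonneg _) h1 2
    rw [sq_abs] at h0' h1'
    linarith

lemma IsGroundState.magSq_eq (hQ : IsGroundState Q) (x : Plane) :
    magSq 0 (fun x => (Q x : ℂ)) x = gradSqR Q x := by
  rw [magSq_zero, gradSq_ofReal (hQ.diff x)]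

lemma IsGroundState.int_grad (hQ : IsGroundState Q) : Integrable (gradSqR Q) := by
  have := hQ.magH1.int_mag
  rwa [show magSq 0 (fun x => (Q x : ℂ)) = gradSqR Q from funext hQ.magSq_eq] at this

lemma IsGroundState.int_four (hQ : IsGroundState Q) {A : ℝ} (hA : 0 < A) (hGN : GNIneq A) :
    Integrable (fun x => Q x ^ 4) := by
  have h := (hGN.mag hA hQ.magH1).1
  refine h.congr (Eventually.of_forall fun x => ?_)
  simp only [Complex.norm_real, Real.norm_eq_abs]
  rw [show |Q x| ^ 4 = (|Q x| ^ 2) ^ 2 by ring, sq_abs]; ring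

lemma cr_ofReal (f : Plane → ℝ) {g : Plane → ℝ} {x : Plane} (hg : DifferentiableAt ℝ g x) :
    cr f (fun y => (g y : ℂ)) x = g x * (d0R f x * d0R g x + d1R f x * d1R g x) := by
  unfold cr
  rw [d0_ofReal hg, d1_ofReal hg]
  simp; ring

lemma d0R_mul {f g : Plane → ℝ} {x : Plane} (hf : DifferentiableAt ℝ f x)
    (hg : DifferentiableAt ℝ g x) :
    d0R (fun y => f y * g y) x = f x * d0R g x + g x * d0R f x := by
  unfold d0R; rw [fderiv_fun_mul hf hg]; simp

lemma d1R_mul {f g : Plane → ℝ} {x : Plane} (hf : DifferentiableAt ℝ f x)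
    (hg : DifferentiableAt ℝ g x) :
    d1R (fun y => f y * g y) x = f x * d1R g x + g x * d1R f x := by
  unfold d1R; rw [fderiv_fun_mul hf hg]; simp

/-- The equation for `Q` tested with `φ Q`, for compactly supported `φ`. -/
lemma IsGroundState.weak_compact (hQ : IsGroundState Q) {φ : Plane → ℝ} (hφ : ContDiff ℝ 1 φ)
    (hc : HasCompactSupport φ) :
    ∫ x, (φ x * gradSqR Q x + cr φ (fun x => (Q x : ℂ)) x + φ x * Q x ^ 2 - φ x * Q x ^ 4) = 0 := by
  have hQ1 : ContDiff ℝ 1 Q := hQ.1.of_le (by norm_num)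
  have h0 : ContDiff ℝ 1 (d0R Q) := contDiff_d0R (n := 1) (by exact_mod_cast hQ.1)
  have h1 : ContDiff ℝ 1 (d1R Q) := contDiff_d1R (n := 1) (by exact_mod_cast hQ.1)
  have hφd := hφ.differentiable one_ne_zero
  have hφ0 : Continuous (d0R φ) := (contDiff_d0R (n := 0) (by simpa using hφ)).continuous
  have hφ1 : Continuous (d1R φ) := (contDiff_d1R (n := 0) (by simpa using hφ)).continuous
  have hg : ContDiff ℝ 1 (fun x => φ x * Q x) := hφ.mul hQ1
  have hgc : HasCompactSupport (fun x => φ x * Q x) := hc.mul_right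
  have k := integral_div_test h0 h1 hg hgc
  have cQ := hQ1.continuous
  have cφ := hφ.continuous
  have c0 := h0.continuous
  have c1 := h1.continuous
  have i2 : Integrable (fun x => φ x * (Q x ^ 2 - Q x ^ 4)) :=
    Continuous.integrable_of_hasCompactSupport (by fun_prop) hc.mul_right
  have hc0 : HasCompactSupport (d0R φ) := hc.fderiv_apply (𝕜 := ℝ) e0
  have hc1 : HasCompactSupport (d1R φ) := hc.fderiv_apply (𝕜 := ℝ) e1
  have i1 : Integrable (fun x => φ x * (d0R Q x ^ 2 + d1R Q x ^ 2)
      + (d0R φ x * (Q x * d0R Q x) + d1R φ x * (Q x * d1R Q x))) := by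
    refine Integrable.add ?_ (Integrable.add ?_ ?_)
    · exact Continuous.integrable_of_hasCompactSupport (by fun_prop) hc.mul_right
    · exact Continuous.integrable_of_hasCompactSupport (by fun_prop) hc0.mul_right
    · exact Continuous.integrable_of_hasCompactSupport (by fun_prop) hc1.mul_right
  have e1 : ∫ x, (d0R (d0R Q) x + d1R (d1R Q) x) * (φ x * Q x)
      = ∫ x, φ x * (Q x ^ 2 - Q x ^ 4) := by
    refine integral_congr_ae (Eventually.of_forall fun x => ?_)
    have := hQ.2.2.2.2.2 x
    have e : d0R (d0R Q) x + d1R (d1R Q) x = lapR Q x := rfl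
    simp only
    rw [e, show lapR Q x = Q x - Q x ^ 3 by linarith]; ring
  have e2 : ∫ x, (d0R Q x * d0R (fun x => φ x * Q x) x + d1R Q x * d1R (fun x => φ x * Q x) x)
      = ∫ x, (φ x * (d0R Q x ^ 2 + d1R Q x ^ 2)
      + (d0R φ x * (Q x * d0R Q x) + d1R φ x * (Q x * d1R Q x))) := by
    refine integral_congr_ae (Eventually.of_forall fun x => ?_)
    simp only
    rw [d0R_mul (hφd x) (hQ.diff x), d1R_mul (hφd x) (hQ.diff x)]; ring
  rw [e1, e2] at k
  have k2 := integral_add i1 i2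
  rw [k, neg_add_cancel] at k2
  rw [← k2]
  refine integral_congr_ae (Eventually.of_forall fun x => ?_)
  simp only
  rw [cr_ofReal _ (hQ.diff x), gradSqR]; ring

lemma cr_mul {f g : Plane → ℝ} {u : Plane → ℂ} {x : Plane} (hf : DifferentiableAt ℝ f x)
    (hg : DifferentiableAt ℝ g x) :
    cr (fun y => f y * g y) u x = f x * cr g u x + g x * cr f u x := by
  unfold cr; rw [d0R_mul hf hg, d1R_mul hf hg]; ring

lemma cr_eq_zero {f : Plane → ℝ} {u : Plane → ℂ} {x : Plane} (h : gradSqR f x = 0) :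
    cr f u x = 0 := by
  have := cr_sq_le 0 f u x
  rw [h, zero_mul, zero_mul] at this
  exact pow_eq_zero_iff two_ne_zero |>.1 (le_antisymm this (sq_nonneg _))

lemma IsGroundState.weak (hQ : IsGroundState Q) {A : ℝ} (hA : 0 < A) (hGN : GNIneq A)
    {φ : Plane → ℝ} (hφ : ContDiff ℝ 1 φ) {S C : ℝ} (hS : ∀ x, |φ x| ≤ S)
    (hC : ∀ x, gradSqR φ x ≤ C) :
    (∫ x, φ x * gradSqR Q x) + (∫ x, cr φ (fun x => (Q x : ℂ)) x) + (∫ x, φ x * Q x ^ 2)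
      = ∫ x, φ x * Q x ^ 4 := by
  obtain ⟨B, hB0, hB⟩ := smoothTransition_deriv_bound
  have h4 := hQ.int_four hA hGN
  have h2 := hQ.2.2.2.1
  have hg := hQ.int_grad
  have hm := hQ.magH1
  have hφd := hφ.differentiable one_ne_zero
  have mφ := hφ.continuous.measurable
  have bφ : ∀ᵐ x, ‖φ x‖ ≤ S := Eventually.of_forall hS
  have icr : ∀ {s f : Plane → ℝ} {S C : ℝ}, Measurable s → (∀ x, |s x| ≤ S) →
      (∀ x, gradSqR f x ≤ C) → Integrable (fun x => s x * cr f (fun x => (Q x : ℂ)) x) :=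
    fun h1 h2 h3 => hm.int_cr h1 h2 h3
  have i1 : Integrable (fun x => φ x * gradSqR Q x) := hg.bdd_mul mφ.aestronglyMeasurable bφ
  have i2 : Integrable (cr φ (fun x => (Q x : ℂ))) := by
    simpa using icr (s := fun _ => 1) (S := 1) measurable_const (by simp) hC
  have i3 : Integrable (fun x => φ x * Q x ^ 2) := h2.bdd_mul mφ.aestronglyMeasurable bφ
  have i4 : Integrable (fun x => φ x * Q x ^ 4) := h4.bdd_mul mφ.aestronglyMeasurable bφ
  set F : Plane → ℝ := fun x =>
    φ x * gradSqR Q x + cr φ (fun x => (Q x : ℂ)) x + φ x * Q x ^ 2 - φ x * Q x ^ 4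
  have iF : Integrable F := ((i1.add i2).add i3).sub i4
  have key : ∫ x, F x = 0 := by
    have e : ∀ k x, (chi k x * φ x) * gradSqR Q x
        + cr (fun x => chi k x * φ x) (fun x => (Q x : ℂ)) x
        + (chi k x * φ x) * Q x ^ 2 - (chi k x * φ x) * Q x ^ 4
        = chi k x * F x + φ x * cr (chi k) (fun x => (Q x : ℂ)) x := fun k x => by
      rw [cr_mul ((contDiff_chi k).differentiable one_ne_zero x) (hφd x)]
      simp only [F]; ring
    have hk : ∀ k, ∫ x, (chi k x * F x + φ x * cr (chi k) (fun x => (Q x : ℂ)) x) = 0 := fun k => by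
      rw [← hQ.weak_compact ((contDiff_chi k).mul hφ) (compact_chi k).mul_right]
      exact integral_congr_ae (Eventually.of_forall fun x => (e k x).symm)
    have hlim := tendsto_integral_of_eventually (F := F)
      (f := fun k x => chi k x * F x + φ x * cr (chi k) (fun x => (Q x : ℂ)) x)
      (G := fun x => |F x| + (S ^ 2 * gradSqR Q x + 2 * B ^ 2 * Q x ^ 2))
      (fun k => ?_) (iF.abs.add ((hg.const_mul _).add (h2.const_mul _))) (fun k x => ?_)
      (fun x => ?_)
    · simp_rw [hk] at hlim
      exact tendsto_nhds_unique hlim tendsto_const_nhds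
    · refine Integrable.aestronglyMeasurable (Integrable.add ?_ ?_)
      · exact iF.bdd_mul (contDiff_chi k).continuous.aestronglyMeasurable
          (Eventually.of_forall (abs_chi_le k))
      · exact icr mφ hS (gradSqR_chi_le' hB k)
    · refine (abs_add_le _ _).trans (add_le_add ?_ ?_)
      · rw [abs_mul]
        exact mul_le_of_le_one_left (abs_nonneg _) (abs_chi_le k x)
      · have h := abs_cr_le 0 (chi k) (fun x => (Q x : ℂ)) x one_pos (φ x)
        rw [hQ.magSq_eq] at h
        have h1 : φ x ^ 2 ≤ S ^ 2 := by rw [← sq_abs]; gcongr; exact hS x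
        have h2 := mul_le_mul_of_nonneg_right h1 (gradSqR_nonneg Q x)
        have h3 := mul_le_mul_of_nonneg_right (gradSqR_chi_le' hB k x) (sq_nonneg (Q x))
        simp only [inv_one, one_mul, Complex.norm_real, Real.norm_eq_abs, sq_abs] at h
        have := abs_nonneg (φ x * cr (chi k) (fun x => (Q x : ℂ)) x)
        linarith
    · filter_upwards [eventually_norm_le x] with k hk
      rw [chi_eq_one hk.le, cr_eq_zero (gradSqR_chi_eq_zero (Or.inl hk.le))]; ring
  have e : ∫ x, F x = (∫ x, φ x * gradSqR Q x) + (∫ x, cr φ (fun x => (Q x : ℂ)) x)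
      + (∫ x, φ x * Q x ^ 2) - ∫ x, φ x * Q x ^ 4 := by
    simp only [F]
    have i12 : Integrable fun x => φ x * gradSqR Q x + cr φ (fun x => (Q x : ℂ)) x := i1.add i2
    have i123 : Integrable fun x =>
      φ x * gradSqR Q x + cr φ (fun x => (Q x : ℂ)) x + φ x * Q x ^ 2 := i12.add i3
    rw [integral_sub i123 i4, integral_add i12 i3, integral_add i1 i2]
  linarith

end GroundState

section GroundStateIdentities

variable {Q : Plane → ℝ}

/-- The Pohozaev vector field has divergence `-2 G(Q)`. -/
lemma IsGroundState.pohozaev_div (hQ : IsGroundState Q) :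
    ∃ F0 F1 : Plane → ℝ, ContDiff ℝ 1 F0 ∧ ContDiff ℝ 1 F1 ∧
      (∀ x, d0R F0 x + d1R F1 x = -2 * (1 / 2 * Q x ^ 2 - 1 / 4 * Q x ^ 4)) ∧
      (∀ x, F0 x ^ 2 + F1 x ^ 2 ≤ ‖x‖ ^ 2 * (2 * gradSqR Q x + Q x ^ 2 + Q x ^ 4) ^ 2) := by
  have hQ1 : ContDiff ℝ 1 Q := hQ.1.of_le (by norm_num)
  have h0 : ContDiff ℝ 1 (d0R Q) := contDiff_d0R (n := 1) (by exact_mod_cast hQ.1)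
  have h1 : ContDiff ℝ 1 (d1R Q) := contDiff_d1R (n := 1) (by exact_mod_cast hQ.1)
  have hx : ∀ i : Fin 2, ContDiff ℝ 1 (fun x : Plane => x i) := fun i =>
    (EuclideanSpace.proj (𝕜 := ℝ) i).contDiff
  set p := d0R Q with hp
  set q := d1R Q with hq
  refine ⟨fun x => (x 0 * p x + x 1 * q x) * p x - 1 / 2 * x 0 * (p x ^ 2 + q x ^ 2)
      - x 0 * (1 / 2 * Q x ^ 2 - 1 / 4 * Q x ^ 4),
    fun x => (x 0 * p x + x 1 * q x) * q x - 1 / 2 * x 1 * (p x ^ 2 + q x ^ 2)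
      - x 1 * (1 / 2 * Q x ^ 2 - 1 / 4 * Q x ^ 4), ?_, ?_, ?_, ?_⟩
  · have := hx 0; have := hx 1; fun_prop
  · have := hx 0; have := hx 1; fun_prop
  · intro x
    have dQ : HasFDerivAt Q (fderiv ℝ Q x) x := (hQ.diff x).hasFDerivAt
    have dp : HasFDerivAt p (fderiv ℝ p x) x := (h0.differentiable one_ne_zero x).hasFDerivAt
    have dq : HasFDerivAt q (fderiv ℝ q x) x := (h1.differentiable one_ne_zero x).hasFDerivAt
    have dx : ∀ i : Fin 2, HasFDerivAt (fun x : Plane => x i)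
      (EuclideanSpace.proj (𝕜 := ℝ) i : Plane →L[ℝ] ℝ) x := fun i =>
      (EuclideanSpace.proj (𝕜 := ℝ) i).hasFDerivAt
    have hG := (((dQ.pow 2).const_mul (1 / 2)).sub ((dQ.pow 4).const_mul (1 / 4)))
    have hN := (dp.pow 2).add (dq.pow 2)
    have hX := ((dx 0).mul dp).add ((dx 1).mul dq)
    have hF0 := ((hX.mul dp).sub (((dx 0).const_mul (1 / 2)).mul hN)).sub ((dx 0).mul hG)
    have hF1 := ((hX.mul dq).sub (((dx 1).const_mul (1 / 2)).mul hN)).sub ((dx 1).mul hG)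
    have f0 := hF0.fderiv
    have f1 := hF1.fderiv
    have sym : fderiv ℝ q x e0 = fderiv ℝ p x e1 := by
      have hs := (hQ.1.contDiffAt (x := x)).isSymmSndFDerivAt (by simp)
      have hd : DifferentiableAt ℝ (fderiv ℝ Q) x :=
        (hQ.1.fderiv_right (m := 1) (by norm_num)).differentiable one_ne_zero x
      have a1 : fderiv ℝ q x e0 = fderiv ℝ (fderiv ℝ Q) x e0 e1 := by
        simp only [hq]; unfold d1R
        rw [fderiv_clm_apply hd (differentiableAt_const _)]; simp
      have a2 : fderiv ℝ p x e1 = fderiv ℝ (fderiv ℝ Q) x e1 e0 := by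
        simp only [hp]; unfold d0R
        rw [fderiv_clm_apply hd (differentiableAt_const _)]; simp
      rw [a1, a2]; exact hs e0 e1
    have lap : fderiv ℝ p x e0 + fderiv ℝ q x e1 = Q x - Q x ^ 3 := by
      have := hQ.2.2.2.2.2 x
      unfold lapR at this; rw [← hp, ← hq] at this; linarith
    have b0 : fderiv ℝ Q x e0 = p x := rfl
    have b1 : fderiv ℝ Q x e1 = q x := rfl
    have t0 := congrArg (fun L : Plane →L[ℝ] ℝ => L e0) f0
    have t1 := congrArg (fun L : Plane →L[ℝ] ℝ => L e1) f1
    simp only [_root_.add_apply, _root_.sub_apply, _root_.smul_apply, smul_eq_mul, nsmul_eq_mul,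
      PiLp.proj_apply, e0_zero, e0_one, e1_zero, e1_one, b0, b1, sym, Pi.mul_apply,
      Pi.add_apply, Pi.sub_apply] at t0 t1
    norm_num at t0 t1
    refine (congrArg₂ (· + ·) t0 t1).trans ?_
    linear_combination (x 0 * p x + x 1 * q x) * lap
  · intro x
    rw [plane_norm_sq]
    unfold gradSqR
    rw [← hp, ← hq]
    set N := p x ^ 2 + q x ^ 2
    set G := 1 / 2 * Q x ^ 2 - 1 / 4 * Q x ^ 4
    have e : ((x 0 * p x + x 1 * q x) * p x - 1 / 2 * x 0 * N - x 0 * G) ^ 2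
        + ((x 0 * p x + x 1 * q x) * q x - 1 / 2 * x 1 * N - x 1 * G) ^ 2
        = (x 0 ^ 2 + x 1 ^ 2) * (1 / 2 * N + G) ^ 2 - 2 * G * (x 0 * p x + x 1 * q x) ^ 2 := by
      simp only [N]; ring
    rw [e]
    have hcs : (x 0 * p x + x 1 * q x) ^ 2 ≤ (x 0 ^ 2 + x 1 ^ 2) * N := by
      simp only [N]; nlinarith [sq_nonneg (x 0 * q x - x 1 * p x)]
    set H := Q x ^ 2 + Q x ^ 4 with hH
    have hN0 : 0 ≤ N := by positivity
    have hH0 : 0 ≤ H := by positivity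
    have hGH : |G| ≤ 1 / 2 * H := by
      rw [abs_le]; simp only [G, H]
      constructor <;> nlinarith [sq_nonneg (Q x), sq_nonneg (Q x ^ 2)]
    obtain ⟨g1, g2⟩ := abs_le.1 hGH
    have hr : 0 ≤ x 0 ^ 2 + x 1 ^ 2 := by positivity
    set X := (x 0 * p x + x 1 * q x) ^ 2
    have hX : 0 ≤ X := sq_nonneg _
    have s1 : -2 * G * X ≤ H * ((x 0 ^ 2 + x 1 ^ 2) * N) :=
      calc -2 * G * X ≤ H * X := by nlinarith
        _ ≤ _ := by gcongr
    have s2 : (1 / 2 * N + G) ^ 2 ≤ (1 / 2 * N + 1 / 2 * H) ^ 2 := by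
      apply sq_le_sq'  <;> linarith
    have s3 := mul_le_mul_of_nonneg_left s2 hr
    have s4 : (x 0 ^ 2 + x 1 ^ 2) * ((1 / 2 * N + 1 / 2 * H) ^ 2 + H * N) ≤
        (x 0 ^ 2 + x 1 ^ 2) * (2 * N + H) ^ 2 := by
      gcongr; nlinarith [mul_nonneg hN0 hH0, sq_nonneg N, sq_nonneg H]
    have e2 : 2 * N + Q x ^ 2 + Q x ^ 4 = 2 * N + H := by rw [hH]; ring
    rw [e2]
    linarith

lemma IsGroundState.pohozaev (hQ : IsGroundState Q) {A : ℝ} (hA : 0 < A) (hGN : GNIneq A) :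
    ∫ x, Q x ^ 4 = 2 * ∫ x, Q x ^ 2 := by
  obtain ⟨B, hB0, hB⟩ := smoothTransition_deriv_bound
  obtain ⟨F0, F1, c0, c1, hdiv, hF⟩ := hQ.pohozaev_div
  have h4 := hQ.int_four hA hGN
  have h2 := hQ.2.2.2.1
  have hg := hQ.int_grad
  have hQc := hQ.1.continuous
  have k1 : Tendsto (fun k => ∫ x, (F0 x * d0R (chi k) x + F1 x * d1R (chi k) x)) atTop
      (𝓝 (∫ _ : Plane, (0:ℝ))) := by
    refine tendsto_integral_of_eventually
      (G := fun x => (4 * B) * (2 * gradSqR Q x + Q x ^ 2 + Q x ^ 4)) (fun k => ?_)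
      ((((hg.const_mul 2).add h2).add h4).const_mul _) (fun k x => ?_) (fun x => ?_)
    · exact ((c0.continuous.measurable.mul (measurable_d0R _)).add
        (c1.continuous.measurable.mul (measurable_d1R _))).aestronglyMeasurable
    · set Y := 2 * gradSqR Q x + Q x ^ 2 + Q x ^ 4
      have hY : 0 ≤ Y := by have := gradSqR_nonneg Q x; positivity
      have hcs : (F0 x * d0R (chi k) x + F1 x * d1R (chi k) x) ^ 2
          ≤ (F0 x ^ 2 + F1 x ^ 2) * gradSqR (chi k) x := by
        unfold gradSqR; nlinarith [sq_nonneg (F0 x * d1R (chi k) x - F1 x * d0R (chi k) x)]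
      refine abs_le_of_sq_le_sq ?_ (by positivity)
      have h3 := mul_le_mul_of_nonneg_right (hF x) (gradSqR_nonneg (chi k) x)
      have h5 := mul_le_mul_of_nonneg_left (norm_sq_mul_gradSqR_chi_le hB k x) (sq_nonneg Y)
      nlinarith [show 0 ≤ B ^ 2 * Y ^ 2 by positivity]
    · filter_upwards [eventually_norm_le x] with k hk
      have h := gradSqR_chi_eq_zero (k := k) (x := x) (Or.inl hk.le)
      unfold gradSqR at h
      have a0 : d0R (chi k) x = 0 := by
        nlinarith [sq_nonneg (d0R (chi k) x), sq_nonneg (d1R (chi k) x)]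
      have a1 : d1R (chi k) x = 0 := by
        nlinarith [sq_nonneg (d0R (chi k) x), sq_nonneg (d1R (chi k) x)]
      rw [a0, a1]; ring
  have iG : Integrable (fun x => 2 * (1 / 2 * Q x ^ 2 - 1 / 4 * Q x ^ 4)) :=
    ((h2.const_mul _).sub (h4.const_mul _)).const_mul _
  have k2 : Tendsto (fun k => ∫ x, (2 * (1 / 2 * Q x ^ 2 - 1 / 4 * Q x ^ 4)) * chi k x) atTop
      (𝓝 (∫ x, 2 * (1 / 2 * Q x ^ 2 - 1 / 4 * Q x ^ 4))) := by
    refine tendsto_integral_of_eventually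
      (G := fun x => |2 * (1 / 2 * Q x ^ 2 - 1 / 4 * Q x ^ 4)|) (fun k => ?_)
      iG.abs (fun k x => ?_) (fun x => ?_)
    · have := (contDiff_chi k).continuous
      exact Continuous.aestronglyMeasurable (by fun_prop)
    · rw [abs_mul]; exact mul_le_of_le_one_right (abs_nonneg _) (abs_chi_le k x)
    · filter_upwards [eventually_norm_le x] with k hk
      rw [chi_eq_one hk.le, mul_one]
  have e : ∀ k, ∫ x, (F0 x * d0R (chi k) x + F1 x * d1R (chi k) x)
      = ∫ x, (2 * (1 / 2 * Q x ^ 2 - 1 / 4 * Q x ^ 4)) * chi k x := fun k => by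
    rw [integral_div_test c0 c1 (contDiff_chi k) (compact_chi k), ← integral_neg]
    refine integral_congr_ae (Eventually.of_forall fun x => ?_)
    simp only [hdiv]; ring
  simp_rw [e] at k1
  have h := tendsto_nhds_unique k1 k2
  rw [integral_zero, integral_const_mul, integral_sub (h2.const_mul _) (h4.const_mul _),
    integral_const_mul, integral_const_mul] at h
  linarith

lemma IsGroundState.energy (hQ : IsGroundState Q) {A : ℝ} (hA : 0 < A) (hGN : GNIneq A) :
    ∫ x, gradSqR Q x = ∫ x, Q x ^ 2 := by
  have h1 := hQ.weak hA hGN (φ := fun _ => 1) contDiff_const (S := 1) (C := 0) (by simp)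
    (by simp [gradSqR, d0R, d1R])
  have h2 := hQ.pohozaev hA hGN
  have h3 : ∀ x, cr (fun _ => (1:ℝ)) (fun x => (Q x : ℂ)) x = 0 := fun x => by
    simp [cr, d0R, d1R]
  simp only [one_mul, h3, integral_zero] at h1
  linarith

end GroundStateIdentities

/-! ### Exponential decay of the ground state -/

section Decay

lemma integral_add_three {f g h : Plane → ℝ} (hf : Integrable f) (hg : Integrable g)
    (hh : Integrable h) :
    ∫ x, (f x + g x + h x) = (∫ x, f x) + (∫ x, g x) + ∫ x, h x := by
  have := integral_add (hf.add hg) hh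
  simp only [Pi.add_apply] at this
  rw [this, integral_add hf hg]

lemma integrable_add_three {f g h : Plane → ℝ} (hf : Integrable f) (hg : Integrable g)
    (hh : Integrable h) : Integrable (fun x => f x + g x + h x) :=
  (hf.add hg).add hh

/-- A bounded radial weight comparable to `exp (c |x|)` as `δ → 0`. -/
def wt (c δ : ℝ) (x : Plane) : ℝ :=
  Real.exp (c * (Real.sqrt (1 + ‖x - 0‖ ^ 2) / (1 + δ * Real.sqrt (1 + ‖x - 0‖ ^ 2))))

lemma wt_pos (c δ : ℝ) (x : Plane) : 0 < wt c δ x := Real.exp_pos _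

lemma contDiff_wt (c : ℝ) {δ : ℝ} (hδ : 0 < δ) : ContDiff ℝ 1 (wt c δ) := by
  unfold wt
  have h : ContDiff ℝ 1 (fun x : Plane => Real.sqrt (1 + ‖x - 0‖ ^ 2)) := by
    apply ContDiff.sqrt
    · exact contDiff_const.add ((contDiff_id.sub contDiff_const).norm_sq ℝ)
    · intro x; positivity
  refine Real.contDiff_exp.comp (contDiff_const.mul (h.div (contDiff_const.add
    (contDiff_const.mul h)) ?_))
  intro x; positivity

lemma wt_le {c δ : ℝ} (hc : 0 ≤ c) (hδ : 0 < δ) (x : Plane) : wt c δ x ≤ Real.exp (c / δ) := by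
  unfold wt
  set J := Real.sqrt (1 + ‖x - 0‖ ^ 2)
  have hJ : 0 ≤ J := Real.sqrt_nonneg _
  apply Real.exp_le_exp.2
  rw [div_eq_mul_inv c δ]
  gcongr
  rw [div_le_iff₀ (by positivity), mul_add, ← mul_assoc, inv_mul_cancel₀ hδ.ne']
  have : 0 < δ⁻¹ := by positivity
  linarith

lemma wt_le_exp {c δ : ℝ} (hc : 0 ≤ c) (hδ : 0 < δ) {x : Plane} {R : ℝ} (hx : ‖x‖ ≤ R) :
    wt c δ x ≤ Real.exp (c * (1 + R)) := by
  unfold wt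
  apply Real.exp_le_exp.2
  gcongr
  rw [sub_zero]
  refine (div_le_self (Real.sqrt_nonneg _) ?_).trans ?_
  · have := Real.sqrt_nonneg (1 + ‖x‖ ^ 2); nlinarith
  · rw [Real.sqrt_le_left (by linarith [norm_nonneg x])]
    nlinarith [norm_nonneg x]

lemma wt_mul_self (c δ : ℝ) (x : Plane) : wt c δ x * wt c δ x = wt (2 * c) δ x := by
  unfold wt
  rw [← Real.exp_add]; ring_nf

lemma gradSqR_wt_le (c : ℝ) {δ : ℝ} (hδ : 0 < δ) (x : Plane) :
    gradSqR (wt c δ) x ≤ c ^ 2 * wt c δ x ^ 2 := by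
  set t := ‖x - 0‖ ^ 2 with ht
  have ht0 : 0 ≤ t := by positivity
  set J := Real.sqrt (1 + t) with hJ
  have hJ0 : 0 < J := Real.sqrt_pos.2 (by linarith)
  have hJ2 : J ^ 2 = 1 + t := Real.sq_sqrt (by linarith)
  have d1 : HasDerivAt (fun s : ℝ => Real.sqrt (1 + s)) (1 / (2 * J)) t := by
    have := ((hasDerivAt_id t).const_add 1).sqrt (by simp only [id]; linarith)
    simpa using this
  have hpos : 0 < 1 + δ * J := by positivity
  have d2 := ((d1.div ((d1.const_mul δ).const_add 1) hpos.ne').const_mul c).exp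
  have h := gradSqR_radial 0 x d2
  have e : (fun y : Plane => Real.exp (c * (Real.sqrt (1 + ‖y - 0‖ ^ 2)
      / (1 + δ * Real.sqrt (1 + ‖y - 0‖ ^ 2))))) = wt c δ := rfl
  simp only [Pi.div_apply] at h
  rw [e] at h
  rw [h]
  have ew : Real.exp (c * (J / (1 + δ * J))) = wt c δ x := rfl
  rw [ew]
  have e2 : (1 / (2 * J) * (1 + δ * J) - J * (δ * (1 / (2 * J)))) / (1 + δ * J) ^ 2
      = 1 / (2 * J) * (1 / (1 + δ * J) ^ 2) := by
    field_simp; ring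
  rw [e2]
  have h1 : (1 / (1 + δ * J) ^ 2) ≤ 1 := by
    rw [div_le_one (by positivity)]
    nlinarith [mul_pos hδ hJ0]
  have h2 : (1 / (1 + δ * J) ^ 2) ^ 2 ≤ 1 := pow_le_one₀ (by positivity) h1
  calc 4 * (wt c δ x * (c * (1 / (2 * J) * (1 / (1 + δ * J) ^ 2)))) ^ 2 * t
      = c ^ 2 * wt c δ x ^ 2 * ((1 / (1 + δ * J) ^ 2) ^ 2 * (t / J ^ 2)) := by
        field_simp; ring
    _ ≤ c ^ 2 * wt c δ x ^ 2 * (1 * 1) := by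
        gcongr
        rw [hJ2, div_le_one (by linarith)]; linarith
    _ = _ := by ring

variable {Q : Plane → ℝ}

lemma norm_ofReal_sq (s : ℝ) : ‖(s : ℂ)‖ ^ 2 = s ^ 2 := by
  rw [Complex.norm_real, Real.norm_eq_abs, sq_abs]

lemma integrable_bdd_mul {f c : Plane → ℝ} (hf : Integrable f) (hc : Measurable c) {C : ℝ}
    (h : ∀ x, |c x| ≤ C) : Integrable (fun x => c x * f x) :=
  hf.bdd_mul hc.aestronglyMeasurable (ae_of_all _ h)

lemma IsGroundState.tail (hQ : IsGroundState Q) {A : ℝ} (hA : 0 < A) (hGN : GNIneq A) :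
    ∃ k : ℕ, ∫ x, (1 - chi k x) * Q x ^ 4 ≤ A / 4 := by
  have h4 := hQ.int_four hA hGN
  have ht : Tendsto (fun k : ℕ => ∫ x, (1 - chi k x) * Q x ^ 4) atTop
      (𝓝 (∫ _x : Plane, (0 : ℝ))) := by
    refine tendsto_integral_of_eventually (G := fun x => Q x ^ 4) ?_ h4 ?_ ?_
    · intro k
      exact ((continuous_const.sub (contDiff_chi k).continuous).mul
        (hQ.1.continuous.pow 4)).aestronglyMeasurable
    · intro k x
      have := chi_nonneg k x; have := chi_le_one k x
      rw [abs_mul, abs_of_nonneg (by linarith), abs_of_nonneg (by positivity)]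
      exact mul_le_of_le_one_left (by positivity) (by linarith)
    · intro x
      filter_upwards [eventually_norm_le x] with k hk
      rw [chi_eq_one hk.le]; ring
  rw [integral_zero] at ht
  exact ((ht.eventually (gt_mem_nhds (by positivity : (0:ℝ) < A / 4))).exists).imp fun k h => h.le

lemma decay_arith {A X Y Z κ τ : ℝ} (hA : 0 < A) (hX : 0 ≤ X) (hY : 0 ≤ Y)
    (hZ : A * Z ≤ 2 * X * Y) (hκ : κ = A / 2 / (X + Y + 1)) (hτ : τ ≤ A / 4) :
    κ * Z ≤ 1 / 4 * (X + Y) ∧ (4 * κ)⁻¹ * τ ≤ 1 / 8 * (X + Y + 1) := by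
  have hκ0 : 0 < κ := by rw [hκ]; positivity
  constructor
  · have : A * Z ≤ 1 / 2 * (X + Y) ^ 2 := by nlinarith [sq_nonneg (X - Y)]
    calc κ * Z = 1 / 2 * (A * Z) / (X + Y + 1) := by rw [hκ]; ring
      _ ≤ 1 / 2 * (1 / 2 * (X + Y) ^ 2) / (X + Y + 1) := by gcongr
      _ ≤ _ := by rw [div_le_iff₀ (by positivity)]; nlinarith
  · calc (4 * κ)⁻¹ * τ ≤ (4 * κ)⁻¹ * (A / 4) := by gcongr
      _ = _ := by rw [hκ]; field_simp; norm_num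

lemma young_cut {κ c : ℝ} (hκ : 0 < κ) (h0 : 0 ≤ c) (h1 : c ≤ 1) (w : ℝ) :
    c * w ≤ κ * w ^ 2 + (4 * κ)⁻¹ * c := by
  have e : κ * w ^ 2 + (4 * κ)⁻¹ * c ^ 2 - c * w = κ * (w - (2 * κ)⁻¹ * c) ^ 2 := by
    field_simp; ring
  have e2 : 0 ≤ κ * (w - (2 * κ)⁻¹ * c) ^ 2 := by positivity
  have e3 : (4 * κ)⁻¹ * c ^ 2 ≤ (4 * κ)⁻¹ * c := by
    gcongr; nlinarith
  linarith

set_option maxHeartbeats 800000 in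
lemma IsGroundState.weighted (hQ : IsGroundState Q) {A : ℝ} (hA : 0 < A) (hGN : GNIneq A) :
    ∃ C : ℝ, ∀ δ : ℝ, 0 < δ → ∫ x, wt 1 δ x * Q x ^ 2 ≤ C := by
  obtain ⟨k, hk⟩ := hQ.tail hA hGN
  have h4 := hQ.int_four hA hGN
  set E := Real.exp (1 * (1 + 2 * ((k : ℝ) + 1)))
  refine ⟨8 / 3 * (E * (∫ x, Q x ^ 4) + 1 / 8), fun δ hδ => ?_⟩
  set q : Plane → ℂ := fun x => (Q x : ℂ) with hq
  have hm := hQ.magH1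
  have hφ := contDiff_wt 1 hδ
  have hw := contDiff_wt (1 / 2) hδ
  have hwd := hw.differentiable one_ne_zero
  have hφS : ∀ x, |wt 1 δ x| ≤ Real.exp (1 / δ) := fun x => by
    rw [abs_of_pos (wt_pos _ _ _)]; exact wt_le zero_le_one hδ x
  have hwS : ∀ x, |wt (1 / 2) δ x| ≤ Real.exp (1 / 2 / δ) := fun x => by
    rw [abs_of_pos (wt_pos _ _ _)]; exact wt_le (by norm_num) hδ x
  have hφC : ∀ x, gradSqR (wt 1 δ) x ≤ 1 ^ 2 * Real.exp (1 / δ) ^ 2 := fun x =>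
    (gradSqR_wt_le 1 hδ x).trans (by
      have := (wt_pos 1 δ x).le
      gcongr; exact wt_le zero_le_one hδ x)
  have hwC : ∀ x, gradSqR (wt (1 / 2) δ) x ≤ (1 / 2) ^ 2 * Real.exp (1 / 2 / δ) ^ 2 := fun x =>
    (gradSqR_wt_le (1 / 2) hδ x).trans (by
      have := (wt_pos (1 / 2) δ x).le
      gcongr; exact wt_le (by norm_num) hδ x)
  have hww : ∀ x, wt (1 / 2) δ x ^ 2 = wt 1 δ x := fun x => by
    rw [pow_two, wt_mul_self]; norm_num
  have hM := hm.smul hwd hwS hwC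
  have hsq : ∀ x, ‖wt (1 / 2) δ x • (Q x : ℂ)‖ ^ 2 = wt 1 δ x * Q x ^ 2 := fun x => by
    rw [norm_smul, mul_pow, norm_ofReal_sq, Real.norm_eq_abs, sq_abs, hww]
  have hfour : ∀ x, ‖wt (1 / 2) δ x • (Q x : ℂ)‖ ^ 4 = wt 1 δ x ^ 2 * Q x ^ 4 := fun x => by
    rw [show (4 : ℕ) = 2 * 2 from rfl, pow_mul, hsq]; ring
  obtain ⟨hZi, hZ⟩ := hGN.mag hA hM
  have hYi := hM.int
  simp only [hsq] at hYi hZ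
  simp only [hfour] at hZi hZ
  set Y := ∫ x, wt 1 δ x * Q x ^ 2
  set X := ∫ x, magSq 0 (fun x => wt (1 / 2) δ x • (Q x : ℂ)) x with hX
  set Z := ∫ x, wt 1 δ x ^ 2 * Q x ^ 4
  have hweak := hQ.weak hA hGN hφ hφS hφC
  have hcr : ∀ x, cr (wt 1 δ) q x = 2 * wt (1 / 2) δ x * cr (wt (1 / 2) δ) q x := fun x => by
    have : wt 1 δ = fun y => wt (1 / 2) δ y * wt (1 / 2) δ y := by
      ext y; rw [wt_mul_self]; norm_num
    rw [this, cr_mul (hwd x) (hwd x)]; ring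
  have hXe : ∀ x, magSq 0 (fun x => wt (1 / 2) δ x • (Q x : ℂ)) x
      = wt 1 δ x * gradSqR Q x + cr (wt 1 δ) q x + gradSqR (wt (1 / 2) δ) x * Q x ^ 2 := fun x => by
    rw [magSq_smul 0 (hwd x) (hm.diff x), hww, hQ.magSq_eq, hcr, norm_ofReal_sq]
  have i1 : Integrable (fun x => wt 1 δ x * gradSqR Q x) :=
    integrable_bdd_mul hQ.int_grad hφ.continuous.measurable hφS
  have i2 : Integrable (fun x => cr (wt 1 δ) q x) := by
    simpa using hm.int_cr (s := fun _ => 1) measurable_const (S := 1) (by simp) hφC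
  have i3 : Integrable (fun x => gradSqR (wt (1 / 2) δ) x * Q x ^ 2) :=
    integrable_bdd_mul hQ.2.2.2.1 (measurable_gradSqR _) (fun x => by
      rw [abs_of_nonneg (gradSqR_nonneg _ _)]; exact hwC x)
  have hXsum : X = (∫ x, wt 1 δ x * gradSqR Q x) + (∫ x, cr (wt 1 δ) q x)
      + ∫ x, gradSqR (wt (1 / 2) δ) x * Q x ^ 2 := by
    rw [hX, ← integral_add_three i1 i2 i3]
    exact integral_congr_ae (ae_of_all _ hXe)
  have h3 : ∫ x, gradSqR (wt (1 / 2) δ) x * Q x ^ 2 ≤ 1 / 4 * Y := by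
    rw [← integral_const_mul]
    refine integral_mono i3 (hYi.const_mul _) fun x => ?_
    have := gradSqR_wt_le (1 / 2) hδ x
    rw [hww] at this
    have := mul_le_mul_of_nonneg_right this (sq_nonneg (Q x))
    linarith
  have hX0 : 0 ≤ X := integral_nonneg fun x => magSq_nonneg _ _ _
  have hY0 : 0 ≤ Y := integral_nonneg fun x => mul_nonneg (wt_pos _ _ _).le (sq_nonneg _)
  set κ := A / 2 / (X + Y + 1) with hκ
  have hκ0 : 0 < κ := by positivity
  have i4 : Integrable (fun x => (1 - chi k x) * Q x ^ 4) := by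
    refine integrable_bdd_mul h4 (continuous_const.sub (contDiff_chi k).continuous).measurable
      (C := 1) (fun x => ?_)
    have := chi_nonneg k x; have := chi_le_one k x
    rw [abs_of_nonneg (by linarith)]; linarith
  have h5 : ∫ x, wt 1 δ x * Q x ^ 4
      ≤ E * (∫ x, Q x ^ 4) + κ * Z + (4 * κ)⁻¹ * ∫ x, (1 - chi k x) * Q x ^ 4 := by
    rw [← integral_const_mul, ← integral_const_mul, ← integral_const_mul,
      ← integral_add_three (h4.const_mul _) (hZi.const_mul _) (i4.const_mul _)]
    refine integral_mono (integrable_bdd_mul h4 hφ.continuous.measurable hφS)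
      (integrable_add_three (h4.const_mul _) (hZi.const_mul _) (i4.const_mul _)) fun x => ?_
    have c0 := chi_nonneg k x
    have c1 := chi_le_one k x
    have hw0 := wt_pos 1 δ x
    have a1 : chi k x * wt 1 δ x ≤ E := by
      rcases le_total ‖x‖ (2 * ((k : ℝ) + 1)) with h | h
      · calc chi k x * wt 1 δ x ≤ 1 * wt 1 δ x := by gcongr
          _ ≤ E := by rw [one_mul]; exact wt_le_exp zero_le_one hδ h
      · rw [chi_eq_zero h, zero_mul]; positivity
    have a2 : (1 - chi k x) * wt 1 δ x ≤ κ * wt 1 δ x ^ 2 + (4 * κ)⁻¹ * (1 - chi k x) :=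
      young_cut hκ0 (by linarith) (by linarith) _
    have hq4 : 0 ≤ Q x ^ 4 := by positivity
    have := mul_le_mul_of_nonneg_right (add_le_add a1 a2) hq4
    linear_combination this
  obtain ⟨hκZ, hτ⟩ := decay_arith hA hX0 hY0 hZ hκ hk
  linarith

lemma IsGroundState.profile (hQ : IsGroundState Q) {A : ℝ} (hA : 0 < A) (hGN : GNIneq A) :
    Profile Q := by
  obtain ⟨C, hC⟩ := hQ.weighted hA hGN
  have hδ : ∀ k : ℕ, (0 : ℝ) < 1 / ((k : ℝ) + 1) := fun k => by positivity
  have hF := (fatou_bound (f := fun k x => wt 1 (1 / ((k : ℝ) + 1)) x * Q x ^ 2)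
    (F := fun x => Real.exp
      (1 * (Real.sqrt (1 + ‖x - 0‖ ^ 2) / (1 + 0 * Real.sqrt (1 + ‖x - 0‖ ^ 2))))
      * Q x ^ 2) (c := fun _ => C) (C := C)
    (fun k => integrable_bdd_mul hQ.2.2.2.1 (contDiff_wt 1 (hδ k)).continuous.measurable
      (C := Real.exp (1 / (1 / ((k : ℝ) + 1)))) (fun x => by
        rw [abs_of_pos (wt_pos _ _ _)]; exact wt_le zero_le_one (hδ k) x))
    (fun k x => mul_nonneg (wt_pos _ _ _).le (sq_nonneg _)) (fun x => ?_)
    (fun k => hC _ (hδ k)) tendsto_const_nhds).1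
  · refine ⟨hQ.diff, ?_, hQ.int_four hA hGN, hQ.int_grad⟩
    refine hF.mono' ((continuous_norm.rexp.mul (hQ.1.continuous.pow 2)).aestronglyMeasurable)
      (ae_of_all _ fun x => ?_)
    rw [Real.norm_eq_abs, abs_of_nonneg (by positivity)]
    gcongr
    rw [sub_zero, one_mul, zero_mul, add_zero, div_one]
    apply Real.le_sqrt_of_sq_le; linarith
  · have h0 : Tendsto (fun k : ℕ => 1 / ((k : ℝ) + 1)) atTop (𝓝 0) :=
      tendsto_one_div_add_atTop_nhds_zero_nat
    refine Tendsto.mul_const _ ?_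
    unfold wt
    refine (Real.continuous_exp.tendsto _).comp (Tendsto.const_mul _ ?_)
    refine Tendsto.div tendsto_const_nhds (tendsto_const_nhds.add (h0.mul_const _)) ?_
    simp

end Decay

/-! ### Blow-up of the energy and of the quartic term -/

section BlowUp

variable {V : Plane → ℝ} {Ω A a : ℝ} {u : Plane → ℂ}

/-- A minimizer at subcritical mass, together with the standing hypotheses. -/
structure SubMin (V : Plane → ℝ) (Ω A a : ℝ) (u : Plane → ℂ) : Prop where
  Ω_pos : 0 < Ω
  meas : Measurable V
  nonneg : ∀ x : Plane, 0 ≤ V x - Ω ^ 2 / 4 * ‖x‖ ^ 2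
  pos : 0 < a
  lt : a < A
  gn : GNIneq A
  min : IsMinimizer V Ω a u

namespace SubMin

lemma A_pos (h : SubMin V Ω A a u) : 0 < A := h.pos.trans h.lt

lemma inH (h : SubMin V Ω A a u) : InH V u := h.min.1.1

lemma mass (h : SubMin V Ω A a u) : ∫ x, ‖u x‖ ^ 2 = a := h.min.1.2

lemma magH1 (h : SubMin V Ω A a u) : MagH1 Ω u := h.inH.magH1 h.Ω_pos h.nonneg

lemma int_four (h : SubMin V Ω A a u) : Integrable (fun x => ‖u x‖ ^ 4) :=
  (h.gn.mag h.A_pos h.magH1).1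

lemma dens (h : SubMin V Ω A a u) : Dens (fun x => ‖u x‖ ^ 2) :=
  dens_of_inH h.Ω_pos h.nonneg h.inH h.int_four

lemma int_potential (h : SubMin V Ω A a u) :
    Integrable (fun x => (V x - Ω ^ 2 / 4 * ‖x‖ ^ 2) * ‖u x‖ ^ 2) :=
  int_pot h.inH.2 (int_sq_of_int_V h.Ω_pos h.nonneg h.magH1.diff.continuous h.inH.2)

lemma energy_eq (h : SubMin V Ω A a u) :
    Ea V Ω u = (∫ x, magSq Ω u x) + pot V Ω u + 1 / 2 * logConv u - 1 / 2 * ∫ x, ‖u x‖ ^ 4 :=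
  Ea_eq h.Ω_pos h.nonneg h.inH

lemma pot_nonneg (h : SubMin V Ω A a u) : 0 ≤ pot V Ω u :=
  integral_nonneg fun x => mul_nonneg (h.nonneg x) (sq_nonneg _)

lemma four_nonneg (u : Plane → ℂ) : 0 ≤ ∫ x : Plane, ‖u x‖ ^ 4 :=
  integral_nonneg fun x => by positivity

lemma mag_nonneg (b : ℝ) (u : Plane → ℂ) : 0 ≤ ∫ x : Plane, magSq b u x :=
  integral_nonneg fun _ => magSq_nonneg _ _ _

lemma four_le (h : SubMin V Ω A a u) :
    ∫ x, ‖u x‖ ^ 4 ≤ 2 * ∫ x, magSq Ω u x := by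
  have h1 := (h.gn.mag h.A_pos h.magH1).2
  rw [h.mass] at h1
  have hT := mag_nonneg Ω u
  refine le_of_mul_le_mul_left (h1.trans ?_) h.A_pos
  nlinarith [mul_le_mul_of_nonneg_left h.lt.le hT]

lemma logConv_eq' (h : SubMin V Ω A a u) :
    logConv u = logInt (fun x => ‖u x‖ ^ 2) (fun x => ‖u x‖ ^ 2) := logConv_eq h.dens

lemma integral_sq_sq (u : Plane → ℂ) :
    ∫ x : Plane, (‖u x‖ ^ 2) ^ 2 = ∫ x : Plane, ‖u x‖ ^ 4 := by
  congr 1; ext x; ring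

lemma logConv_ge (h : SubMin V Ω A a u) {δ : ℝ} (hδ : 0 < δ) :
    -(a * (δ * (∫ x, ‖u x‖ ^ 4) + (4 * δ)⁻¹ * ∫ z, lneg z ^ 2)) ≤ logConv u := by
  have := logInt_ge h.dens h.dens hδ
  rwa [h.mass, integral_sq_sq, ← h.logConv_eq'] at this

lemma logConv_nonpos (h : SubMin V Ω A a u) (hE : Ea V Ω u ≤ 0) : logConv u ≤ 0 := by
  have h1 := h.energy_eq
  have h2 := h.four_le
  have h3 := h.pot_nonneg
  linarith

lemma energy_ge (h : SubMin V Ω A a u) :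
    -(1 / 2 * A * ((∫ x, ‖u x‖ ^ 4) + 1 / 4 * ∫ z, lneg z ^ 2)) ≤ Ea V Ω u := by
  have h1 := h.energy_eq
  have h2 := h.four_le
  have h3 := h.pot_nonneg
  have h4 := h.logConv_ge one_pos
  have h5 : 0 ≤ ∫ z, lneg z ^ 2 := integral_nonneg fun z => sq_nonneg _
  have h6 := four_nonneg u
  have h7 : a * (1 * (∫ x, ‖u x‖ ^ 4) + (4 * 1)⁻¹ * ∫ z, lneg z ^ 2)
      ≤ A * ((∫ x, ‖u x‖ ^ 4) + 1 / 4 * ∫ z, lneg z ^ 2) := by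
    have := h.lt.le; have := h.A_pos
    norm_num
    gcongr
  linarith

lemma mag_le (h : SubMin V Ω A a u) (hE : Ea V Ω u ≤ 0) :
    ∫ x, magSq Ω u x ≤ 1 / 2 * (∫ x, ‖u x‖ ^ 4)
      + 1 / 2 * A * ((∫ x, ‖u x‖ ^ 4) + 1 / 4 * ∫ z, lneg z ^ 2) := by
  have h1 := h.energy_eq
  have h3 := h.pot_nonneg
  have h4 := h.logConv_ge one_pos
  have h5 : 0 ≤ ∫ z, lneg z ^ 2 := integral_nonneg fun z => sq_nonneg _
  have h6 := four_nonneg u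
  have h7 : a * (1 * (∫ x, ‖u x‖ ^ 4) + (4 * 1)⁻¹ * ∫ z, lneg z ^ 2)
      ≤ A * ((∫ x, ‖u x‖ ^ 4) + 1 / 4 * ∫ z, lneg z ^ 2) := by
    have := h.lt.le; have := h.A_pos
    norm_num
    gcongr
  linarith

end SubMin

lemma energy_atBot {Q : Plane → ℝ} (hQ : IsGroundState Q) {C γ : ℝ} (hV : Trap V Ω C γ)
    (hA : A = ∫ x, Q x ^ 2) (hA0 : 0 < A) {u : ℝ → Plane → ℂ}
    (hu : ∀ a ∈ Ioo (0 : ℝ) A, IsMinimizer V Ω a (u a)) (K : ℝ) :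
    ∀ᶠ a in 𝓝[<] A, Ea V Ω (u a) ≤ -K := by
  have hGN := gn_of_minimizers hV hA0 hu
  have hP := hQ.profile hA0 hGN
  have hp := hQ.pohozaev hA0 hGN
  have he := hQ.energy hA0 hGN
  have hC := hV.C_nonneg
  rw [← hA] at hp he
  set P := ∫ x, Real.exp ‖x‖ * Q x ^ 2
  have hP0 : 0 ≤ P := integral_nonneg fun x => by positivity
  set L0 := logInt (fun x => Q x ^ 2) (fun x => Q x ^ 2)
  have hlog := Real.tendsto_log_atTop.eventually_ge_atTop
    ((K + C * P + |L0| + 1) * (1 / 2 * (A / 2) ^ 2)⁻¹)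
  obtain ⟨l, hll, hl1, hlγ⟩ :=
    (hlog.and ((eventually_ge_atTop 1).and (eventually_ge_atTop γ))).exists
  have hl0 : 0 ≤ Real.log l := Real.log_nonneg hl1
  have hlog' : K + C * P + |L0| + 1 ≤ 1 / 2 * (A / 2) ^ 2 * Real.log l := by
    rw [← div_eq_mul_inv, div_le_iff₀ (by positivity)] at hll; linarith
  have hb : Tendsto (fun a : ℝ => l ^ 2 * (a * (1 - a / A))) (𝓝[<] A) (𝓝 0) := by
    have : ContinuousAt (fun a : ℝ => l ^ 2 * (a * (1 - a / A))) A := by fun_prop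
    have h := this.tendsto.mono_left (nhdsWithin_le_nhds (s := Iio A))
    rwa [div_self hA0.ne', sub_self, mul_zero, mul_zero] at h
  have hA2 : ∀ᶠ a in 𝓝[<] A, A / 2 < a :=
    nhdsWithin_le_nhds (lt_mem_nhds (by linarith))
  filter_upwards [self_mem_nhdsWithin, hA2, hb.eventually (gt_mem_nhds one_pos)] with a ha ha2 hab
  have ha0 : 0 < a := by linarith
  have h := trial_bound hV (hu a ⟨ha0, ha⟩) ha0.le hP (by rw [← hA]; exact hA0) hl1 hlγ
  rw [← hA, hp, he] at h
  have ht : a / A ≤ 1 := by rw [div_le_one hA0]; exact le_of_lt ha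
  have ht0 : 0 ≤ a / A := by positivity
  have e : a / A * A - 1 / 2 * (a / A) ^ 2 * (2 * A) = a * (1 - a / A) := by
    field_simp
  rw [e] at h
  have b1 : C * (a / A) * P ≤ C * P := by
    have := mul_le_mul_of_nonneg_left ht (mul_nonneg hC hP0); linarith
  have b2 : 1 / 2 * (a / A) ^ 2 * L0 ≤ |L0| := by
    have : (a / A) ^ 2 ≤ 1 := pow_le_one₀ ht0 ht
    calc 1 / 2 * (a / A) ^ 2 * L0 ≤ 1 / 2 * (a / A) ^ 2 * |L0| := by
          gcongr; exact le_abs_self _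
      _ ≤ 1 / 2 * 1 * |L0| := by gcongr
      _ ≤ |L0| := by linarith [abs_nonneg L0]
  have b3 : 1 / 2 * (A / 2) ^ 2 * Real.log l ≤ 1 / 2 * a ^ 2 * Real.log l := by
    have := hA0; gcongr
  linarith

end BlowUp

/-! ### A variational inequality for localized perturbations -/

section Variation

variable {V : Plane → ℝ} {Ω A a : ℝ} {u : Plane → ℂ}

lemma norm_real_smul_sq (s : ℝ) (z : ℂ) : ‖s • z‖ ^ 2 = s ^ 2 * ‖z‖ ^ 2 := by
  rw [norm_smul, mul_pow, Real.norm_eq_abs, sq_abs]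

lemma norm_real_smul_four (s : ℝ) (z : ℂ) : ‖s • z‖ ^ 4 = s ^ 4 * ‖z‖ ^ 4 := by
  rw [norm_smul, mul_pow, Real.norm_eq_abs, Even.pow_abs (by decide)]

lemma pot_const_smul (V : Plane → ℝ) (Ω s : ℝ) (w : Plane → ℂ) :
    pot V Ω (fun x => s • w x) = s ^ 2 * pot V Ω w := by
  unfold pot
  rw [← integral_const_mul]
  congr 1; ext x; rw [norm_real_smul_sq]; ring

lemma logConv_const_smul (s : ℝ) (w : Plane → ℂ) :
    logConv (fun x => s • w x) = s ^ 4 * logConv w := by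
  unfold logConv
  rw [← integral_const_mul]
  congr 1; ext x
  rw [← integral_const_mul]
  congr 1; ext y
  rw [norm_real_smul_sq, norm_real_smul_sq]; ring

lemma mag_const_smul (b s : ℝ) {w : Plane → ℂ} (hw : Differentiable ℝ w) :
    ∫ x, magSq b (fun y => s • w y) x = s ^ 2 * ∫ x, magSq b w x := by
  rw [← integral_const_mul]
  congr 1; ext x; exact magSq_const_smul b s (hw x)

lemma gradSqR_const (s : ℝ) (x : Plane) : gradSqR (fun _ => s) x = 0 := by
  simp [gradSqR, d0R, d1R]

namespace SubMin

lemma test (h : SubMin V Ω A a u) {w : Plane → ℂ} (hw : InH V w)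
    (hm : 0 < ∫ x, ‖w x‖ ^ 2) :
    Ea V Ω u ≤ (a / ∫ x, ‖w x‖ ^ 2) * ((∫ x, magSq Ω w x) + pot V Ω w)
      + 1 / 2 * (a / ∫ x, ‖w x‖ ^ 2) ^ 2 * (logConv w - ∫ x, ‖w x‖ ^ 4) := by
  set m := ∫ x, ‖w x‖ ^ 2 with hmdef
  set s := Real.sqrt (a / m) with hs
  have hs2 : s ^ 2 = a / m := Real.sq_sqrt (div_nonneg h.pos.le hm.le)
  have hs4 : s ^ 4 = (a / m) ^ 2 := by rw [← hs2]; ring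
  have hwm := hw.magH1 h.Ω_pos h.nonneg
  have hv : InH V (fun x => s • w x) := by
    refine (hwm.smul (f := fun _ => s) (differentiable_const _) (S := |s|) (C := 0)
      (fun _ => le_rfl) (fun x => (gradSqR_const s x).le)).inH h.Ω_pos h.nonneg ?_
    refine (hw.2.const_mul (s ^ 2)).congr (ae_of_all _ fun x => ?_)
    simp only [norm_real_smul_sq]; ring
  have hS : (fun x => s • w x) ∈ Sset V a := by
    refine ⟨hv, ?_⟩
    simp only [norm_real_smul_sq]
    rw [integral_const_mul, hs2, ← hmdef]
    field_simp
  have := h.min.2 _ hS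
  rw [Ea_eq h.Ω_pos h.nonneg hv, mag_const_smul _ _ hwm.diff, pot_const_smul,
    logConv_const_smul] at this
  simp only [norm_real_smul_four] at this
  rw [integral_const_mul, hs2, hs4] at this
  linarith

/-- The effective potential density integrated against a weight. -/
lemma int_mul_bdd (h : SubMin V Ω A a u) {φ : Plane → ℝ} (hφ : Measurable φ) {S : ℝ}
    (hS : ∀ x, |φ x| ≤ S) :
    Integrable (fun x => φ x * magSq Ω u x) ∧ Integrable (fun x => φ x * ‖u x‖ ^ 2) ∧
      Integrable (fun x => φ x * ‖u x‖ ^ 4) ∧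
      Integrable (fun x => φ x * ((V x - Ω ^ 2 / 4 * ‖x‖ ^ 2) * ‖u x‖ ^ 2)) :=
  ⟨integrable_bdd_mul h.magH1.int_mag hφ hS, integrable_bdd_mul h.magH1.int hφ hS,
    integrable_bdd_mul h.int_four hφ hS, integrable_bdd_mul h.int_potential hφ hS⟩

lemma smul_inH (h : SubMin V Ω A a u) {f : Plane → ℝ} (hf : Differentiable ℝ f) {S C : ℝ}
    (hS : ∀ x, |f x| ≤ S) (hC : ∀ x, gradSqR f x ≤ C) : InH V (fun x => f x • u x) := by
  refine (h.magH1.smul hf hS hC).inH h.Ω_pos h.nonneg ?_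
  refine (integrable_bdd_mul h.inH.2 (hf.continuous.measurable.pow_const 2) (C := S ^ 2)
    (fun x => ?_)).congr (ae_of_all _ fun x => ?_)
  · rw [abs_pow]; exact pow_le_pow_left₀ (abs_nonneg _) (hS x) 2
  · simp only [norm_real_smul_sq]; ring

end SubMin

lemma logInt_perturb {f q : Plane → ℝ} (hf : Dens f) (hq : Dens q) {t : ℝ} (ht : 0 ≤ t)
    (hp : Dens (fun x => f x - t * q x)) :
    logInt (fun x => f x - t * q x) (fun x => f x - t * q x)
      = logInt f f - 2 * t * logInt q f + t ^ 2 * logInt q q := by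
  set p := fun x => f x - t * q x with hpdef
  have hadd : ∀ {g : Plane → ℝ}, Dens g → logInt f g = logInt p g + t * logInt q g := by
    intro g hg
    have e : f = fun x => p x + t * q x := by ext x; simp [hpdef]
    have h1 : logInt (fun x => t * q x) g = t * logInt q g := by
      have := logInt_smul t 1 q g
      simpa using this
    conv_lhs => rw [e]
    rw [logInt_add_left hp (hq.const_mul ht) hg, h1]
  have a1 := hadd hf
  have a2 := hadd hp
  have a3 := hadd hq
  rw [logInt_comm f p] at a2
  rw [logInt_comm f q, logInt_comm p q] at a3
  linear_combination -a1 - a2 + t * a3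

lemma linear_coeff_nonneg {c1 c2 c3 : ℝ}
    (h : ∀ t ∈ Ioc (0 : ℝ) (1 / 2), 0 ≤ c1 * t + c2 * t ^ 2 + c3 * t ^ 3) : 0 ≤ c1 := by
  have hc : ContinuousAt (fun t : ℝ => c1 + c2 * t + c3 * t ^ 2) 0 := by fun_prop
  have ht := hc.tendsto.mono_left (nhdsWithin_le_nhds (s := Ioi 0))
  simp only [mul_zero, add_zero, ne_eq, OfNat.ofNat_ne_zero, not_false_eq_true, zero_pow] at ht
  refine ge_of_tendsto ht ?_
  filter_upwards [Ioc_mem_nhdsGT (show (0 : ℝ) < 1 / 2 by norm_num)] with t ht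
  have := h t ht
  have h2 : 0 ≤ t * (c1 + c2 * t + c3 * t ^ 2) := by linarith
  exact nonneg_of_mul_nonneg_right h2 ht.1

lemma magSq_sqrt_smul_le (b : ℝ) {φ : Plane → ℝ} {x : Plane} (hφ : DifferentiableAt ℝ φ x)
    (hu : DifferentiableAt ℝ u x) (h0 : 0 ≤ φ x) (h1 : φ x ≤ 1) {t : ℝ}
    (ht : t ∈ Ioc (0 : ℝ) (1 / 2)) :
    gradSqR (fun y => Real.sqrt (1 - t * φ y)) x ≤ t ^ 2 * (1 / 2 * gradSqR φ x) ∧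
    magSq b (fun y => Real.sqrt (1 - t * φ y) • u y) x
      ≤ magSq b u x - t * (φ x * magSq b u x + cr φ u x)
        + t ^ 2 * (1 / 2 * (gradSqR φ x * ‖u x‖ ^ 2)) := by
  have hp : 1 / 2 ≤ 1 - t * φ x := by
    have := ht.1; have := ht.2; nlinarith
  set r := Real.sqrt (1 - t * φ x) with hr
  have hr2 : r ^ 2 = 1 - t * φ x := Real.sq_sqrt (by linarith)
  have hr0 : 0 < r := Real.sqrt_pos.2 (by linarith)
  have hd := ((hφ.hasFDerivAt.const_mul t).const_sub 1).sqrt (by linarith)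
  have e0' : d0R (fun y => Real.sqrt (1 - t * φ y)) x = -(t * d0R φ x) / (2 * r) := by
    unfold d0R; rw [hd.fderiv]
    simp only [_root_.smul_apply, _root_.neg_apply, smul_eq_mul]; ring
  have e1' : d1R (fun y => Real.sqrt (1 - t * φ y)) x = -(t * d1R φ x) / (2 * r) := by
    unfold d1R; rw [hd.fderiv]
    simp only [_root_.smul_apply, _root_.neg_apply, smul_eq_mul]; ring
  have hg : gradSqR (fun y => Real.sqrt (1 - t * φ y)) x ≤ t ^ 2 * (1 / 2 * gradSqR φ x) := by
    have e : gradSqR (fun y => Real.sqrt (1 - t * φ y)) x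
        = t ^ 2 * gradSqR φ x * (1 / (4 * r ^ 2)) := by
      unfold gradSqR; rw [e0', e1']; field_simp; ring
    have h3 : 1 / (4 * r ^ 2) ≤ 1 / 2 := by
      rw [hr2, div_le_div_iff₀ (by linarith) (by norm_num)]; linarith
    have h4 := gradSqR_nonneg φ x
    calc _ = t ^ 2 * gradSqR φ x * (1 / (4 * r ^ 2)) := e
      _ ≤ t ^ 2 * gradSqR φ x * (1 / 2) := by gcongr
      _ = _ := by ring
  refine ⟨hg, ?_⟩
  have hc : 2 * r * cr (fun y => Real.sqrt (1 - t * φ y)) u x = -t * cr φ u x := by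
    unfold cr; rw [e0', e1']; field_simp; ring
  rw [magSq_smul b hd.differentiableAt hu, ← hr, hr2, hc]
  have := mul_le_mul_of_nonneg_right hg (sq_nonneg ‖u x‖)
  linarith

end Variation

section LocalVariation

variable {V : Plane → ℝ} {Ω A a : ℝ} {u : Plane → ℂ}

lemma integrable_lin_three {f g h : Plane → ℝ} (hf : Integrable f) (hg : Integrable g)
    (hh : Integrable h) (s t : ℝ) : Integrable (fun x => f x - s * g x + t * h x) :=
  (hf.sub (hg.const_mul s)).add (hh.const_mul t)

lemma integral_lin_three {f g h : Plane → ℝ} (hf : Integrable f) (hg : Integrable g)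
    (hh : Integrable h) (s t : ℝ) :
    ∫ x, (f x - s * g x + t * h x) = (∫ x, f x) - s * (∫ x, g x) + t * ∫ x, h x := by
  have := integral_add (hf.sub (hg.const_mul s)) (hh.const_mul t)
  simp only [Pi.sub_apply] at this
  rw [this, integral_sub hf (hg.const_mul s), integral_const_mul, integral_const_mul]

lemma variation_arith {a E0 K L D N Kφ Lφ Fφ G Lφφ Fφφ : ℝ} (ha : 0 < a)
    (hN0 : 0 ≤ N) (hNa : N ≤ a) (hE : E0 = K + 1 / 2 * L - 1 / 2 * D)
    (h : ∀ t ∈ Ioc (0 : ℝ) (1 / 2), E0 ≤ (a / (a - t * N)) * (K - t * Kφ + t ^ 2 * G)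
      + 1 / 2 * (a / (a - t * N)) ^ 2
        * ((L - 2 * t * Lφ + t ^ 2 * Lφφ) - (D - 2 * t * Fφ + t ^ 2 * Fφφ))) :
    a * (Kφ + Lφ - Fφ) ≤ N * (E0 + 1 / 2 * L - 1 / 2 * D) := by
  have key : 0 ≤ a * (N * (E0 + 1 / 2 * L - 1 / 2 * D) - a * (Kφ + Lφ - Fφ)) := by
    refine linear_coeff_nonneg
      (c2 := a * N * Kφ + a ^ 2 * G + 1 / 2 * a ^ 2 * (Lφφ - Fφφ) - N ^ 2 * E0)
      (c3 := - a * N * G) fun t ht => ?_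
    have hm : 0 < a - t * N := by
      have := ht.1; have := ht.2
      nlinarith
    have h1 := mul_le_mul_of_nonneg_left (h t ht) (sq_nonneg (a - t * N))
    have e : (a - t * N) ^ 2 * ((a / (a - t * N)) * (K - t * Kφ + t ^ 2 * G)
      + 1 / 2 * (a / (a - t * N)) ^ 2
        * ((L - 2 * t * Lφ + t ^ 2 * Lφφ) - (D - 2 * t * Fφ + t ^ 2 * Fφφ)))
        = a * (a - t * N) * (K - t * Kφ + t ^ 2 * G)
          + 1 / 2 * a ^ 2 * ((L - 2 * t * Lφ + t ^ 2 * Lφφ) - (D - 2 * t * Fφ + t ^ 2 * Fφφ)) := by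
      field_simp
    rw [e] at h1
    have hK : K = E0 - 1 / 2 * L + 1 / 2 * D := by linarith
    subst hK
    linarith
  have := nonneg_of_mul_nonneg_right key ha
  linarith

lemma SubMin.variation (h : SubMin V Ω A a u) (hE : Ea V Ω u ≤ 0) {φ : Plane → ℝ}
    (hφ : Differentiable ℝ φ) (h0 : ∀ x, 0 ≤ φ x) (h1 : ∀ x, φ x ≤ 1) {C : ℝ}
    (hC : ∀ x, gradSqR φ x ≤ C) :
    (∫ x, φ x * magSq Ω u x) + (∫ x, cr φ u x)
      + (∫ x, φ x * ((V x - Ω ^ 2 / 4 * ‖x‖ ^ 2) * ‖u x‖ ^ 2))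
      + logInt (fun x => φ x * ‖u x‖ ^ 2) (fun x => ‖u x‖ ^ 2)
      ≤ (∫ x, φ x * ‖u x‖ ^ 4) - (∫ x, ‖u x‖ ^ 4) / (2 * a) * ∫ x, φ x * ‖u x‖ ^ 2 := by
  have hφm := hφ.continuous.measurable
  have hφ1 : ∀ x, |φ x| ≤ 1 := fun x => by rw [abs_of_nonneg (h0 x)]; exact h1 x
  obtain ⟨i1, i2, i3, i4⟩ := h.int_mul_bdd hφm hφ1
  have i5 : Integrable (fun x => cr φ u x) := by
    simpa using h.magH1.int_cr (s := fun _ => 1) measurable_const (S := 1) (by simp) hC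
  have hC0 : 0 ≤ C := (gradSqR_nonneg φ 0).trans (hC 0)
  have i6 : Integrable (fun x => gradSqR φ x * ‖u x‖ ^ 2) :=
    (h.int_mul_bdd (measurable_gradSqR φ) (S := C) (fun x => by
      rw [abs_of_nonneg (gradSqR_nonneg φ x)]; exact hC x)).2.1
  have i7 : Integrable (fun x => φ x ^ 2 * ‖u x‖ ^ 4) :=
    (h.int_mul_bdd (hφm.pow_const 2) (S := 1) (fun x => by
      rw [abs_pow]; exact pow_le_one₀ (abs_nonneg _) (hφ1 x))).2.2.1
  have hq := h.dens.mul hφm h0 h1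
  set N := ∫ x, φ x * ‖u x‖ ^ 2 with hN
  have hN0 : 0 ≤ N := integral_nonneg fun x => mul_nonneg (h0 x) (sq_nonneg _)
  have hNa : N ≤ a := by
    rw [← h.mass]
    exact integral_mono i2 h.magH1.int fun x => mul_le_of_le_one_left (sq_nonneg _) (h1 x)
  set D := ∫ x, ‖u x‖ ^ 4 with hD
  have hener := h.energy_eq
  have hLn := h.logConv_nonpos hE
  have main := variation_arith (E0 := Ea V Ω u) (K := (∫ x, magSq Ω u x) + pot V Ω u)
    (L := logConv u) (D := D)
    (Kφ := ((∫ x, φ x * magSq Ω u x) + ∫ x, cr φ u x)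
      + ∫ x, φ x * ((V x - Ω ^ 2 / 4 * ‖x‖ ^ 2) * ‖u x‖ ^ 2))
    (Lφ := logInt (fun x => φ x * ‖u x‖ ^ 2) (fun x => ‖u x‖ ^ 2))
    (Fφ := ∫ x, φ x * ‖u x‖ ^ 4) (G := 1 / 2 * ∫ x, gradSqR φ x * ‖u x‖ ^ 2)
    (Lφφ := logInt (fun x => φ x * ‖u x‖ ^ 2) (fun x => φ x * ‖u x‖ ^ 2))
    (Fφφ := ∫ x, φ x ^ 2 * ‖u x‖ ^ 4) h.pos hN0 hNa (by linarith) ?_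
  · have e : (∫ x, φ x * ‖u x‖ ^ 4) - D / (2 * a) * N
        = (a * (∫ x, φ x * ‖u x‖ ^ 4) - D / 2 * N) / a := by
      have := h.pos.ne'; field_simp
    rw [e, le_div_iff₀ h.pos]
    have : N * (Ea V Ω u + 1 / 2 * logConv u - 1 / 2 * D) ≤ N * (-1 / 2 * D) :=
      mul_le_mul_of_nonneg_left (by linarith) hN0
    linarith
  · intro t ht
    have ht0 := ht.1.le
    have hp : ∀ x, 1 / 2 ≤ 1 - t * φ x := fun x => by
      have := ht.1; have := ht.2; nlinarith [h0 x, h1 x]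
    set f : Plane → ℝ := fun x => Real.sqrt (1 - t * φ x) with hf
    have hf2 : ∀ x, f x ^ 2 = 1 - t * φ x := fun x => Real.sq_sqrt (by linarith [hp x])
    have hfd : Differentiable ℝ f := fun x =>
      (((hφ x).const_mul t).const_sub 1).sqrt (by linarith [hp x])
    have hf1 : ∀ x, |f x| ≤ 1 := fun x => by
      rw [abs_of_nonneg (Real.sqrt_nonneg _)]
      exact Real.sqrt_le_one.2 (by nlinarith [h0 x])
    have hloc := fun x => magSq_sqrt_smul_le Ω (hφ x) (h.magH1.diff x) (h0 x) (h1 x) ht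
    have hfC : ∀ x, gradSqR f x ≤ t ^ 2 * (1 / 2 * C) := fun x =>
      (hloc x).1.trans (by have := hC x; gcongr)
    have hw := h.smul_inH hfd hf1 hfC
    have hwm := hw.magH1 h.Ω_pos h.nonneg
    have hsq : ∀ x, ‖f x • u x‖ ^ 2 = ‖u x‖ ^ 2 - t * (φ x * ‖u x‖ ^ 2) := fun x => by
      rw [norm_real_smul_sq, hf2]; ring
    have hfour : ∀ x, ‖f x • u x‖ ^ 4
        = ‖u x‖ ^ 4 - 2 * t * (φ x * ‖u x‖ ^ 4) + t ^ 2 * (φ x ^ 2 * ‖u x‖ ^ 4) := fun x => by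
      rw [norm_real_smul_four, show f x ^ 4 = (f x ^ 2) ^ 2 by ring, hf2]; ring
    have hmass : ∫ x, ‖f x • u x‖ ^ 2 = a - t * N := by
      simp only [hsq]
      rw [integral_sub h.magH1.int (i2.const_mul t), integral_const_mul, h.mass]
    have hm : 0 < a - t * N := by
      have := ht.1; have := ht.2; have := h.pos
      nlinarith
    have hD4 : ∫ x, ‖f x • u x‖ ^ 4
        = D - 2 * t * (∫ x, φ x * ‖u x‖ ^ 4) + t ^ 2 * ∫ x, φ x ^ 2 * ‖u x‖ ^ 4 := by
      simp only [hfour]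
      exact integral_lin_three h.int_four i3 i7 _ _
    have hpot : pot V Ω (fun x => f x • u x) = pot V Ω u
        - t * ∫ x, φ x * ((V x - Ω ^ 2 / 4 * ‖x‖ ^ 2) * ‖u x‖ ^ 2) := by
      unfold pot
      rw [← integral_const_mul, ← integral_sub h.int_potential (i4.const_mul _)]
      congr 1; ext x; rw [hsq]; ring
    have hmag : ∫ x, magSq Ω (fun x => f x • u x) x ≤ (∫ x, magSq Ω u x)
        - t * ((∫ x, φ x * magSq Ω u x) + ∫ x, cr φ u x)
        + t ^ 2 * (1 / 2 * ∫ x, gradSqR φ x * ‖u x‖ ^ 2) := by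
      have i15 : Integrable (fun x => φ x * magSq Ω u x + cr φ u x) := i1.add i5
      rw [← integral_add i1 i5, ← integral_const_mul (1 / 2 : ℝ),
        ← integral_lin_three h.magH1.int_mag i15 (i6.const_mul (1 / 2))]
      exact integral_mono hwm.int_mag
        (integrable_lin_three h.magH1.int_mag i15 (i6.const_mul (1 / 2)) _ _) fun x => (hloc x).2
    have hdens : Dens (fun x => ‖u x‖ ^ 2 - t * (φ x * ‖u x‖ ^ 2)) := by
      have := h.dens.mul (hfd.continuous.measurable.pow_const 2) (fun x => sq_nonneg (f x)) (C := 1)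
        (fun x => by rw [← sq_abs]; exact pow_le_one₀ (abs_nonneg _) (hf1 x))
      refine (congrArg Dens ?_).mp this
      ext x; rw [hf2]; ring
    have hlog : logConv (fun x => f x • u x) = logConv u
        - 2 * t * logInt (fun x => φ x * ‖u x‖ ^ 2) (fun x => ‖u x‖ ^ 2)
        + t ^ 2 * logInt (fun x => φ x * ‖u x‖ ^ 2) (fun x => φ x * ‖u x‖ ^ 2) := by
      rw [logConv_eq (by simpa only [hsq] using hdens), h.logConv_eq']
      simp only [hsq]
      exact logInt_perturb h.dens hq ht0 hdens
    have := h.test hw (by rw [hmass]; exact hm)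
    rw [hmass, hD4, hpot, hlog] at this
    refine this.trans ?_
    have hpos : 0 ≤ a / (a - t * N) := div_nonneg h.pos.le hm.le
    exact add_le_add (mul_le_mul_of_nonneg_left (by linarith) hpos) le_rfl

end LocalVariation

/-- A Gaussian weight centred at `z`. -/
def gauss (z : Plane) (s : ℝ) (x : Plane) : ℝ := Real.exp (-s * ‖x - z‖ ^ 2)

lemma gauss_pos (z : Plane) (s : ℝ) (x : Plane) : 0 < gauss z s x := Real.exp_pos _

lemma gauss_le_one (z : Plane) {s : ℝ} (hs : 0 ≤ s) (x : Plane) : gauss z s x ≤ 1 := by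
  refine Real.exp_le_one_iff.2 ?_
  have : 0 ≤ s * ‖x - z‖ ^ 2 := by positivity
  linarith

lemma sq_mul_gauss_le (z : Plane) (s : ℝ) (x : Plane) :
    s * (‖x - z‖ ^ 2 * gauss z s x) ≤ 1 := by
  have h := Real.add_one_le_exp (s * ‖x - z‖ ^ 2)
  have e : Real.exp (s * ‖x - z‖ ^ 2) * gauss z s x = 1 := by
    rw [gauss, ← Real.exp_add]; simp
  have h2 := mul_le_mul_of_nonneg_right h (gauss_pos z s x).le
  rw [e] at h2
  nlinarith [gauss_pos z s x]

lemma measurable_gauss (z : Plane) (s : ℝ) : Measurable (gauss z s) := by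
  unfold gauss; fun_prop

lemma hasDerivAt_exp_neg_mul (s t : ℝ) :
    HasDerivAt (fun t => Real.exp (-s * t)) (-s * Real.exp (-s * t)) t := by
  have := ((hasDerivAt_id t).const_mul (-s)).exp
  simpa [mul_comm] using this

lemma differentiable_gauss (z : Plane) (s : ℝ) : Differentiable ℝ (gauss z s) := fun x =>
  (hasFDerivAt_radial z x (hasDerivAt_exp_neg_mul s _)).differentiableAt

lemma d0R_gauss (z : Plane) (s : ℝ) (x : Plane) :
    d0R (gauss z s) x = 2 * (-s * gauss z s x) * (x - z) 0 :=
  d0R_radial z x (hasDerivAt_exp_neg_mul s _)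

lemma d1R_gauss (z : Plane) (s : ℝ) (x : Plane) :
    d1R (gauss z s) x = 2 * (-s * gauss z s x) * (x - z) 1 :=
  d1R_radial z x (hasDerivAt_exp_neg_mul s _)

lemma gradSqR_gauss_le (z : Plane) {s : ℝ} (hs : 0 < s) (x : Plane) :
    gradSqR (gauss z s) x ≤ 4 * s := by
  have e : gradSqR (gauss z s) x = 4 * (-s * gauss z s x) ^ 2 * ‖x - z‖ ^ 2 :=
    gradSqR_radial z x (hasDerivAt_exp_neg_mul s _)
  have h1 := sq_mul_gauss_le z s x
  have h2 := gauss_le_one z hs.le x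
  have h3 := gauss_pos z s x
  rw [e, show 4 * (-s * gauss z s x) ^ 2 * ‖x - z‖ ^ 2
    = 4 * s * (gauss z s x * (s * (‖x - z‖ ^ 2 * gauss z s x))) by ring]
  have : gauss z s x * (s * (‖x - z‖ ^ 2 * gauss z s x)) ≤ 1 * 1 := by gcongr
  nlinarith

lemma coord_sub_le (z x : Plane) (i : Fin 2) : |(x - z) i| ≤ ‖x - z‖ := by
  simpa using PiLp.norm_apply_le (x - z) i

lemma abs_coord_mul_gauss_le (z : Plane) {s : ℝ} (hs : 0 < s) (x : Plane) (i : Fin 2) :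
    |(x - z) i * gauss z s x| ≤ 1 + s⁻¹ := by
  have h1 : ‖x - z‖ ^ 2 * gauss z s x ≤ s⁻¹ := by
    rw [← one_div, le_div_iff₀ hs, mul_comm]; exact sq_mul_gauss_le z s x
  have h2 := gauss_le_one z hs.le x
  have h3 := gauss_pos z s x
  rw [abs_mul, abs_of_pos h3]
  have h4 : |(x - z) i| ≤ 1 + ‖x - z‖ ^ 2 := by
    have := coord_sub_le z x i; nlinarith [sq_nonneg (‖x - z‖ - 1)]
  nlinarith

lemma coord_sq_mul_gauss_le (z : Plane) {s : ℝ} (x : Plane) (hs : 0 < s) (i : Fin 2) :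
    |gauss z s x - 2 * s * ((x - z) i ^ 2 * gauss z s x)| ≤ 2 := by
  have h1 := sq_mul_gauss_le z s x
  have h2 := gauss_le_one z hs.le x
  have h3 := gauss_pos z s x
  have h4 : (x - z) i ^ 2 ≤ ‖x - z‖ ^ 2 := sq_le_sq.2 (by
    rw [abs_of_nonneg (norm_nonneg (x - z))]; exact coord_sub_le z x i)
  have h5 : s * ((x - z) i ^ 2 * gauss z s x) ≤ s * (‖x - z‖ ^ 2 * gauss z s x) := by gcongr
  have h6 : 0 ≤ s * ((x - z) i ^ 2 * gauss z s x) := by positivity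
  rw [abs_le]; constructor <;> linarith

lemma hasFDerivAt_coord_sub (z x : Plane) (i : Fin 2) :
    HasFDerivAt (fun y : Plane => (y - z) i)
      (EuclideanSpace.proj (𝕜 := ℝ) i : Plane →L[ℝ] ℝ) x := by
  have h := (EuclideanSpace.proj (𝕜 := ℝ) i : Plane →L[ℝ] ℝ).hasFDerivAt.comp x
    ((hasFDerivAt_id (𝕜 := ℝ) x).sub_const z)
  exact h

lemma d0R_coord_mul_gauss (z : Plane) (s : ℝ) (x : Plane) :
    d0R (fun y => (y - z) 0 * gauss z s y) x
      = gauss z s x - 2 * s * ((x - z) 0 ^ 2 * gauss z s x) := by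
  rw [d0R_mul (hasFDerivAt_coord_sub z x 0).differentiableAt (differentiable_gauss z s x),
    d0R_gauss]
  have : d0R (fun y : Plane => (y - z) 0) x = 1 := by
    unfold d0R; rw [(hasFDerivAt_coord_sub z x 0).fderiv]; simp [e0]
  rw [this]; ring

lemma d1R_coord_mul_gauss (z : Plane) (s : ℝ) (x : Plane) :
    d1R (fun y => (y - z) 1 * gauss z s y) x
      = gauss z s x - 2 * s * ((x - z) 1 ^ 2 * gauss z s x) := by
  rw [d1R_mul (hasFDerivAt_coord_sub z x 1).differentiableAt (differentiable_gauss z s x),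
    d1R_gauss]
  have : d1R (fun y : Plane => (y - z) 1) x = 1 := by
    unfold d1R; rw [(hasFDerivAt_coord_sub z x 1).fderiv]; simp [e1]
  rw [this]; ring

lemma differentiable_coord_mul_gauss (z : Plane) (s : ℝ) (i : Fin 2) :
    Differentiable ℝ (fun y : Plane => (y - z) i * gauss z s y) := fun x =>
  (hasFDerivAt_coord_sub z x i).differentiableAt.mul (differentiable_gauss z s x)

lemma d0R_normSq {u : Plane → ℂ} {x : Plane} (hu : DifferentiableAt ℝ u x) :
    d0R (fun y => ‖u y‖ ^ 2) x = 2 * ((starRingEnd ℂ) (u x) * d0 u x).re := by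
  simpa using d0R_comp_normSq hu (hasDerivAt_id _)

lemma d1R_normSq {u : Plane → ℂ} {x : Plane} (hu : DifferentiableAt ℝ u x) :
    d1R (fun y => ‖u y‖ ^ 2) x = 2 * ((starRingEnd ℂ) (u x) * d1 u x).re := by
  simpa using d1R_comp_normSq hu (hasDerivAt_id _)

lemma two_mul_abs_le_of_sq_le {p q r m : ℝ} (hr : 0 ≤ r) (hm : 0 ≤ m)
    (h : p ^ 2 + q ^ 2 ≤ r * m) : |2 * p| ≤ r + m := by
  have : (2 * p) ^ 2 ≤ (r + m) ^ 2 := by nlinarith [sq_nonneg (r - m), sq_nonneg q]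
  exact abs_le_of_sq_le_sq this (by positivity)

namespace MagH1

variable {b : ℝ} {u : Plane → ℂ}

lemma integrable_d0R_normSq (hu : MagH1 b u) : Integrable (d0R (fun y => ‖u y‖ ^ 2)) := by
  refine (hu.int.add hu.int_mag).mono' (measurable_d0R _).aestronglyMeasurable
    (Eventually.of_forall fun x => ?_)
  rw [d0R_normSq (hu.diff x)]
  exact two_mul_abs_le_of_sq_le (by positivity) (magSq_nonneg b u x) (re_sq_le b u x)

lemma integrable_d1R_normSq (hu : MagH1 b u) : Integrable (d1R (fun y => ‖u y‖ ^ 2)) := by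
  refine (hu.int.add hu.int_mag).mono' (measurable_d1R _).aestronglyMeasurable
    (Eventually.of_forall fun x => ?_)
  rw [d1R_normSq (hu.diff x)]
  exact two_mul_abs_le_of_sq_le (by positivity) (magSq_nonneg b u x)
    (by rw [add_comm]; exact re_sq_le b u x)

lemma integral_normSq_mul_d0R (hu : MagH1 b u) {g : Plane → ℝ} (hg : Differentiable ℝ g)
    {C C' : ℝ} (hC : ∀ x, |g x| ≤ C) (hC' : ∀ x, |d0R g x| ≤ C') :
    ∫ x, d0R g x * ‖u x‖ ^ 2 = -∫ x, g x * d0R (fun y => ‖u y‖ ^ 2) x := by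
  have i1 := integrable_bdd_mul hu.integrable_d0R_normSq hg.continuous.measurable hC
  have i2 := integrable_bdd_mul hu.int (measurable_d0R g) hC'
  have i3 := integrable_bdd_mul hu.int hg.continuous.measurable hC
  have k := integral_mul_fderiv_eq_neg_fderiv_mul_of_integrable (𝕜 := ℝ) (v := e0)
    (μ := (volume : Measure Plane)) (f := fun y => ‖u y‖ ^ 2) (g := g)
    (by simpa only [mul_comm, d0R] using i1) (by simpa only [mul_comm, d0R] using i2)
    (by simpa only [mul_comm] using i3)
    (fun x _ => (hasFDerivAt_normSq (hu.diff x)).differentiableAt) (fun x _ => hg x)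
  simpa only [mul_comm, d0R] using k

lemma integral_normSq_mul_d1R (hu : MagH1 b u) {g : Plane → ℝ} (hg : Differentiable ℝ g)
    {C C' : ℝ} (hC : ∀ x, |g x| ≤ C) (hC' : ∀ x, |d1R g x| ≤ C') :
    ∫ x, d1R g x * ‖u x‖ ^ 2 = -∫ x, g x * d1R (fun y => ‖u y‖ ^ 2) x := by
  have i1 := integrable_bdd_mul hu.integrable_d1R_normSq hg.continuous.measurable hC
  have i2 := integrable_bdd_mul hu.int (measurable_d1R g) hC'
  have i3 := integrable_bdd_mul hu.int hg.continuous.measurable hC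
  have k := integral_mul_fderiv_eq_neg_fderiv_mul_of_integrable (𝕜 := ℝ) (v := e1)
    (μ := (volume : Measure Plane)) (f := fun y => ‖u y‖ ^ 2) (g := g)
    (by simpa only [mul_comm, d1R] using i1) (by simpa only [mul_comm, d1R] using i2)
    (by simpa only [mul_comm] using i3)
    (fun x _ => (hasFDerivAt_normSq (hu.diff x)).differentiableAt) (fun x _ => hg x)
  simpa only [mul_comm, d1R] using k

lemma integrable_gauss_mul (hu : MagH1 b u) (z : Plane) {s : ℝ} (hs : 0 ≤ s) :
    Integrable (fun x => gauss z s x * ‖u x‖ ^ 2) :=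
  integrable_bdd_mul hu.int (measurable_gauss z s) (C := 1) fun x => by
    rw [abs_of_pos (gauss_pos z s x)]; exact gauss_le_one z hs x

lemma integrable_sq_mul_gauss_mul (hu : MagH1 b u) (z : Plane) {s : ℝ} (hs : 0 < s) :
    Integrable (fun x => ‖x - z‖ ^ 2 * gauss z s x * ‖u x‖ ^ 2) :=
  integrable_bdd_mul hu.int (by have := measurable_gauss z s; fun_prop) (C := s⁻¹) fun x => by
    have := gauss_pos z s x
    rw [abs_of_nonneg (by positivity), ← one_div, le_div_iff₀ hs, mul_comm]
    exact sq_mul_gauss_le z s x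

lemma integral_cr_gauss (hu : MagH1 b u) (z : Plane) {s : ℝ} (hs : 0 < s) :
    ∫ x, cr (gauss z s) u x = 2 * s * ((∫ x, gauss z s x * ‖u x‖ ^ 2)
      - s * ∫ x, ‖x - z‖ ^ 2 * gauss z s x * ‖u x‖ ^ 2) := by
  have k0 := hu.integral_normSq_mul_d0R (differentiable_coord_mul_gauss z s 0)
    (abs_coord_mul_gauss_le z hs · 0)
    (fun x => by rw [d0R_coord_mul_gauss]; exact coord_sq_mul_gauss_le z x hs 0)
  have k1 := hu.integral_normSq_mul_d1R (differentiable_coord_mul_gauss z s 1)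
    (abs_coord_mul_gauss_le z hs · 1)
    (fun x => by rw [d1R_coord_mul_gauss]; exact coord_sq_mul_gauss_le z x hs 1)
  have i0 : Integrable fun x => (x - z) 0 * gauss z s x * d0R (fun y => ‖u y‖ ^ 2) x :=
    integrable_bdd_mul hu.integrable_d0R_normSq
    (differentiable_coord_mul_gauss z s 0).continuous.measurable (abs_coord_mul_gauss_le z hs · 0)
  have i1 : Integrable fun x => (x - z) 1 * gauss z s x * d1R (fun y => ‖u y‖ ^ 2) x :=
    integrable_bdd_mul hu.integrable_d1R_normSq
    (differentiable_coord_mul_gauss z s 1).continuous.measurable (abs_coord_mul_gauss_le z hs · 1)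
  have j0 : Integrable fun x => d0R (fun y => (y - z) 0 * gauss z s y) x * ‖u x‖ ^ 2 :=
    integrable_bdd_mul hu.int (measurable_d0R _)
    (fun x => by rw [d0R_coord_mul_gauss]; exact coord_sq_mul_gauss_le z x hs 0)
  have j1 : Integrable fun x => d1R (fun y => (y - z) 1 * gauss z s y) x * ‖u x‖ ^ 2 :=
    integrable_bdd_mul hu.int (measurable_d1R _)
    (fun x => by rw [d1R_coord_mul_gauss]; exact coord_sq_mul_gauss_le z x hs 1)
  have e1 : ∫ x, cr (gauss z s) u x
      = -s * ((∫ x, (x - z) 0 * gauss z s x * d0R (fun y => ‖u y‖ ^ 2) x)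
        + ∫ x, (x - z) 1 * gauss z s x * d1R (fun y => ‖u y‖ ^ 2) x) := by
    rw [← integral_add i0 i1, ← integral_const_mul]
    refine integral_congr_ae (Eventually.of_forall fun x => ?_)
    simp only [cr]
    rw [d0R_normSq (hu.diff x), d1R_normSq (hu.diff x), d0R_gauss, d1R_gauss]
    ring
  have e2 : (∫ x, d0R (fun y => (y - z) 0 * gauss z s y) x * ‖u x‖ ^ 2)
      + (∫ x, d1R (fun y => (y - z) 1 * gauss z s y) x * ‖u x‖ ^ 2)
      = 2 * (∫ x, gauss z s x * ‖u x‖ ^ 2)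
        - 2 * s * ∫ x, ‖x - z‖ ^ 2 * gauss z s x * ‖u x‖ ^ 2 := by
    rw [← integral_add j0 j1, ← integral_const_mul, ← integral_const_mul,
      ← integral_sub ((hu.integrable_gauss_mul z hs.le).const_mul 2)
        ((hu.integrable_sq_mul_gauss_mul z hs).const_mul (2 * s))]
    refine integral_congr_ae (Eventually.of_forall fun x => ?_)
    simp only
    rw [d0R_coord_mul_gauss, d1R_coord_mul_gauss, plane_norm_sq (x - z)]
    ring
  linear_combination e1 + s * e2 - s * k0 - s * k1

lemma hasDerivAt_integral_gauss (hu : MagH1 b u) (z : Plane) {s : ℝ} (hs : 0 < s) :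
    HasDerivAt (fun t => ∫ x, gauss z t x * ‖u x‖ ^ 2)
      (-∫ x, ‖x - z‖ ^ 2 * gauss z s x * ‖u x‖ ^ 2) s := by
  rw [← integral_neg]
  refine (hasDerivAt_integral_of_dominated_loc_of_deriv_le (μ := (volume : Measure Plane))
    (F := fun t x => gauss z t x * ‖u x‖ ^ 2)
    (F' := fun t x => -(‖x - z‖ ^ 2 * gauss z t x * ‖u x‖ ^ 2))
    (bound := fun x => (s / 2)⁻¹ * ‖u x‖ ^ 2) (Ioi_mem_nhds (half_lt_self hs)) ?_
    (hu.integrable_gauss_mul z hs.le) (hu.integrable_sq_mul_gauss_mul z hs).neg.aestronglyMeasurable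
    ?_ (hu.int.const_mul _) ?_).2
  · filter_upwards [eventually_ge_nhds hs] with t ht
    have hm := measurable_gauss z t
    have := hu.diff.continuous.measurable
    exact (hm.mul (this.norm.pow_const 2)).aestronglyMeasurable
  · refine Eventually.of_forall fun x t ht => ?_
    have ht' : s / 2 < t := ht
    have ht0 : 0 < t := (half_pos hs).trans ht'
    have h1 : ‖x - z‖ ^ 2 * gauss z t x ≤ (s / 2)⁻¹ := by
      refine le_trans ?_ (inv_anti₀ (half_pos hs) ht'.le)
      rw [← one_div, le_div_iff₀ ht0, mul_comm]; exact sq_mul_gauss_le z t x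
    have := gauss_pos z t x
    rw [norm_neg, Real.norm_of_nonneg (by positivity)]
    gcongr
  · refine Eventually.of_forall fun x t _ => ?_
    have h : HasDerivAt (fun t => gauss z t x) (-(‖x - z‖ ^ 2) * gauss z t x) t := by
      have := ((hasDerivAt_id t).mul_const (-(‖x - z‖ ^ 2))).exp
      simp only [id, one_mul] at this
      unfold gauss
      convert this using 1
      · funext t; congr 1; ring
      · rw [mul_comm]; congr 2; ring
    exact (h.mul_const (‖u x‖ ^ 2)).congr_deriv (by rw [neg_mul, neg_mul])

end MagH1

lemma integral_exp_neg_norm_sq : ∫ y : Plane, Real.exp (-‖y‖ ^ 2) = Real.pi := by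
  have h := GaussianFourier.integral_rexp_neg_mul_sq_norm (V := Plane) (b := 1) one_pos
  simpa using h

lemma integrable_exp_neg_norm_sq : Integrable fun y : Plane => Real.exp (-‖y‖ ^ 2) := by
  by_contra h
  have := integral_exp_neg_norm_sq
  rw [integral_undef h] at this
  exact Real.pi_pos.ne this

lemma tendsto_integral_gauss {n : Plane → ℝ} (hn : Continuous n) {M : ℝ} (hM : ∀ x, |n x| ≤ M)
    (z : Plane) :
    Tendsto (fun s : ℝ => s * ∫ x, gauss z s x * n x) atTop (𝓝 (Real.pi * n z)) := by
  have key : ∀ᶠ s : ℝ in atTop, ∫ y : Plane, Real.exp (-‖y‖ ^ 2) * n (z + (√s)⁻¹ • y)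
      = s * ∫ x, gauss z s x * n x := by
    filter_upwards [eventually_gt_atTop 0] with s hs
    have hq : 0 < √s := Real.sqrt_pos.2 hs
    have h := integral_scale (fun y : Plane => Real.exp (-‖y‖ ^ 2) * n (z + (√s)⁻¹ • y)) hq
    rw [Real.sq_sqrt hs.le] at h
    rw [← integral_add_right_eq_self (fun x => gauss z s x * n x) z]
    have e : ∀ x : Plane, Real.exp (-‖√s • x‖ ^ 2) * n (z + (√s)⁻¹ • √s • x)
        = gauss z s (x + z) * n (x + z) := fun x => by
      rw [gauss, add_sub_cancel_right, norm_smul, mul_pow, Real.norm_of_nonneg hq.le,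
        Real.sq_sqrt hs.le, smul_smul, inv_mul_cancel₀ hq.ne', one_smul, add_comm z, neg_mul]
    simp_rw [e] at h
    rw [h, ← mul_assoc, mul_inv_cancel₀ hs.ne', one_mul]
  refine Tendsto.congr' key ?_
  rw [← integral_exp_neg_norm_sq, ← integral_mul_const]
  refine tendsto_integral_filter_of_dominated_convergence
    (fun y : Plane => Real.exp (-‖y‖ ^ 2) * M) ?_ ?_
    (integrable_exp_neg_norm_sq.mul_const M) ?_
  · exact Eventually.of_forall fun s => Continuous.aestronglyMeasurable (by fun_prop)
  · refine Eventually.of_forall fun s => Eventually.of_forall fun y => ?_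
    rw [norm_mul, Real.norm_of_nonneg (Real.exp_pos _).le]
    gcongr
    exact hM _
  · refine Eventually.of_forall fun y => Tendsto.const_mul _ ?_
    have h1 : Tendsto (fun s : ℝ => z + (√s)⁻¹ • y) atTop (𝓝 (z + (0 : ℝ) • y)) :=
      ((tendsto_inv_atTop_zero.comp Real.tendsto_sqrt_atTop).smul_const y).const_add z
    simp only [zero_smul, add_zero] at h1
    exact (hn.tendsto z).comp h1

lemma antitoneOn_mul_exp_of_deriv_le {H H' : ℝ → ℝ} {B : ℝ}
    (hd : ∀ s, 0 < s → HasDerivAt H (H' s) s) (hle : ∀ s, 0 < s → H' s ≤ B / (2 * s ^ 2) * H s) :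
    AntitoneOn (fun s => H s * Real.exp (B / 2 * s⁻¹)) (Ioi 0) := by
  have hder : ∀ s, 0 < s → HasDerivAt (fun s => H s * Real.exp (B / 2 * s⁻¹))
      (H' s * Real.exp (B / 2 * s⁻¹)
        + H s * (Real.exp (B / 2 * s⁻¹) * (B / 2 * -(s ^ 2)⁻¹))) s := fun s hs =>
    (hd s hs).mul (((hasDerivAt_inv hs.ne').const_mul (B / 2)).exp)
  refine antitoneOn_of_deriv_nonpos (convex_Ioi 0)
    (fun s hs => (hder s hs).continuousAt.continuousWithinAt) ?_ ?_
  · rw [interior_Ioi]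
    exact fun s hs => (hder s hs).differentiableAt.differentiableWithinAt
  · rw [interior_Ioi]
    intro s hs
    rw [(hder s hs).deriv]
    have h := hle s hs
    have e : H' s * Real.exp (B / 2 * s⁻¹)
        + H s * (Real.exp (B / 2 * s⁻¹) * (B / 2 * -(s ^ 2)⁻¹))
        = (H' s - B / (2 * s ^ 2) * H s) * Real.exp (B / 2 * s⁻¹) := by
      have : s ≠ 0 := (mem_Ioi.1 hs).ne'
      field_simp
      ring
    rw [e]
    exact mul_nonpos_of_nonpos_of_nonneg (by linarith) (Real.exp_pos _).le

section LocalBound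

variable {V : Plane → ℝ} {Ω A a : ℝ} {u : Plane → ℂ}

lemma SubMin.cr_gauss_le (h : SubMin V Ω A a u) (hE : Ea V Ω u ≤ 0) {M : ℝ}
    (hM : ∀ x, ‖u x‖ ≤ M) (z : Plane) {s : ℝ} (hs : 0 < s) :
    ∫ x, cr (gauss z s) u x
      ≤ (M ^ 2 + A / 2 * ∫ z, lneg z ^ 2) * ∫ x, gauss z s x * ‖u x‖ ^ 2 := by
  have hv := h.variation hE (differentiable_gauss z s) (fun x => (gauss_pos z s x).le)
    (gauss_le_one z hs.le) (gradSqR_gauss_le z hs)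
  have ha := h.pos
  have h1 : 0 ≤ ∫ x, gauss z s x * magSq Ω u x :=
    integral_nonneg fun x => mul_nonneg (gauss_pos z s x).le (magSq_nonneg _ _ _)
  have h2 : 0 ≤ ∫ x, gauss z s x * ((V x - Ω ^ 2 / 4 * ‖x‖ ^ 2) * ‖u x‖ ^ 2) :=
    integral_nonneg fun x => mul_nonneg (gauss_pos z s x).le
      (mul_nonneg (h.nonneg x) (by positivity))
  have h3 := logInt_ge (h.dens.mul (measurable_gauss z s) (fun x => (gauss_pos z s x).le)
    (gauss_le_one z hs.le)) h.dens (δ := 1 / (2 * a)) (by positivity)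
  rw [integral_sq_sq] at h3
  have hJ := h.magH1.integrable_gauss_mul z hs.le
  have h4 : ∫ x, gauss z s x * ‖u x‖ ^ 4 ≤ M ^ 2 * ∫ x, gauss z s x * ‖u x‖ ^ 2 := by
    rw [← integral_const_mul]
    refine integral_mono_of_nonneg (Eventually.of_forall fun x => ?_) (hJ.const_mul _)
      (Eventually.of_forall fun x => ?_)
    · have := gauss_pos z s x; positivity
    · have := gauss_pos z s x
      have hm : ‖u x‖ ^ 2 ≤ M ^ 2 := by gcongr; exact hM x
      have : gauss z s x * ‖u x‖ ^ 2 * ‖u x‖ ^ 2 ≤ gauss z s x * ‖u x‖ ^ 2 * M ^ 2 := by gcongr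
      simp only; linarith
  have hJ0 : 0 ≤ ∫ x, gauss z s x * ‖u x‖ ^ 2 :=
    integral_nonneg fun x => by have := gauss_pos z s x; positivity
  have hC0 : 0 ≤ ∫ z, lneg z ^ 2 := integral_nonneg fun z => sq_nonneg _
  have e : ∀ J D C : ℝ, J * (1 / (2 * a) * D + (4 * (1 / (2 * a)))⁻¹ * C)
      = D / (2 * a) * J + a / 2 * C * J := fun J D C => by
    field_simp
    ring
  rw [e] at h3
  have h5 : a / 2 * (∫ z, lneg z ^ 2) * (∫ x, gauss z s x * ‖u x‖ ^ 2)
      ≤ A / 2 * (∫ z, lneg z ^ 2) * ∫ x, gauss z s x * ‖u x‖ ^ 2 := by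
    have := h.lt; gcongr
  linarith

lemma SubMin.normSq_le (h : SubMin V Ω A a u) (hE : Ea V Ω u ≤ 0) {M : ℝ}
    (hM : ∀ x, ‖u x‖ ≤ M) {B : ℝ} (hB : B = M ^ 2 + A / 2 * ∫ z, lneg z ^ 2) (hB0 : 0 < B)
    (z : Plane) : ‖u z‖ ^ 2 ≤ B * ∫ x, gauss z B x * ‖u x‖ ^ 2 := by
  set J : ℝ → ℝ := fun s => ∫ x, gauss z s x * ‖u x‖ ^ 2
  set J' : ℝ → ℝ := fun s => ∫ x, ‖x - z‖ ^ 2 * gauss z s x * ‖u x‖ ^ 2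
  have hd : ∀ s, 0 < s → HasDerivAt (fun s => s * J s) (J s - s * J' s) s := fun s hs => by
    have := (hasDerivAt_id s).mul (h.magH1.hasDerivAt_integral_gauss z hs)
    exact this.congr_deriv (by change 1 * J s + s * -J' s = _; ring)
  have hle : ∀ s, 0 < s → J s - s * J' s ≤ B / (2 * s ^ 2) * (s * J s) := fun s hs => by
    have h1 := h.cr_gauss_le hE hM z hs
    rw [h.magH1.integral_cr_gauss z hs, ← hB] at h1
    have h2 : J s - s * J' s ≤ B * J s / (2 * s) := by
      rw [le_div_iff₀ (by positivity)]
      calc _ = 2 * s * (J s - s * J' s) := by ring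
        _ ≤ _ := h1
    refine h2.trans_eq ?_
    field_simp
  have hanti := antitoneOn_mul_exp_of_deriv_le hd hle
  have hcont := h.magH1.diff.continuous
  have hlim := tendsto_integral_gauss (n := fun x => ‖u x‖ ^ 2) (by fun_prop) (M := M ^ 2)
    (fun x => by rw [abs_of_nonneg (by positivity)]; gcongr; exact hM x) z
  have h0 : 0 ≤ J B := integral_nonneg fun x => by have := gauss_pos z B x; positivity
  have hle2 : Real.pi * ‖u z‖ ^ 2 ≤ B * J B * Real.exp (B / 2 * B⁻¹) := by
    refine le_of_tendsto hlim ?_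
    filter_upwards [eventually_ge_atTop B] with s hs
    have hs0 : 0 < s := hB0.trans_le hs
    have h1 := hanti (mem_Ioi.2 hB0) (mem_Ioi.2 hs0) hs
    refine le_trans ?_ h1
    refine le_mul_of_one_le_right ?_ (Real.one_le_exp (by positivity))
    exact mul_nonneg hs0.le (integral_nonneg fun x => by have := gauss_pos z s x; positivity)
  have e : B / 2 * B⁻¹ = 1 / 2 := by field_simp
  have h3 : Real.exp (1 / 2) ≤ 3 := by
    have h4 : Real.exp (1 / 2) ≤ Real.exp 1 := Real.exp_le_exp.2 (by norm_num)
    have := Real.exp_one_lt_d9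
    linarith
  rw [e] at hle2
  have h5 := Real.pi_gt_three
  have h6 : B * J B * Real.exp (1 / 2) ≤ B * J B * Real.pi := by
    have : 0 ≤ B * J B := by positivity
    gcongr; linarith
  nlinarith [Real.pi_pos]

end LocalBound

lemma exp_neg_le_inv {t : ℝ} (ht : 0 < t) : Real.exp (-t) ≤ t⁻¹ := by
  rw [Real.exp_neg]
  exact inv_anti₀ ht (by linarith [Real.add_one_le_exp t])

lemma integral_gauss (z : Plane) {s : ℝ} (hs : 0 < s) : ∫ x, gauss z s x = Real.pi / s := by
  have h := GaussianFourier.integral_rexp_neg_mul_sq_norm (V := Plane) (b := s) hs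
  have e := integral_sub_right_eq_self (μ := (volume : Measure Plane))
    (fun x : Plane => Real.exp (-s * ‖x‖ ^ 2)) z
  unfold gauss
  rw [e, h]
  simp

lemma integrable_gauss (z : Plane) {s : ℝ} (hs : 0 < s) : Integrable (gauss z s) := by
  by_contra h
  have := integral_gauss z hs
  rw [integral_undef h] at this
  have : 0 < Real.pi / s := div_pos Real.pi_pos hs
  linarith

/-- The mass of `u` outside the ball of radius `r` around `p`. -/
def massOut (u : Plane → ℂ) (p : Plane) (r : ℝ) : ℝ := ∫ x in (ball p r)ᶜ, ‖u x‖ ^ 2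

lemma massOut_nonneg (u : Plane → ℂ) (p : Plane) (r : ℝ) : 0 ≤ massOut u p r :=
  integral_nonneg fun _ => by positivity

lemma massOut_eq (u : Plane → ℂ) (p : Plane) (r : ℝ) :
    massOut u p r = ∫ x, ((ball p r)ᶜ).indicator (fun x => ‖u x‖ ^ 2) x :=
  (integral_indicator measurableSet_ball.compl).symm

/-- A minimizer with negative energy and large quartic norm, together with a maximum point. -/
structure Peak (V : Plane → ℝ) (Ω A a : ℝ) (u : Plane → ℂ) (p : Plane) : Prop where
  sub : SubMin V Ω A a u
  energy : Ea V Ω u ≤ 0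
  max : ∀ y, ‖u y‖ ≤ ‖u p‖
  large : A * (A / 2 * ∫ z, lneg z ^ 2) + 1 ≤ ∫ x, ‖u x‖ ^ 4

namespace Peak

variable {V : Plane → ℝ} {Ω A a : ℝ} {u : Plane → ℂ} {p : Plane}

lemma four_pos (h : Peak V Ω A a u p) : 0 < ∫ x, ‖u x‖ ^ 4 := by
  have h1 := h.large
  have := h.sub.A_pos
  have hC0 : 0 ≤ ∫ z, lneg z ^ 2 := integral_nonneg fun z => sq_nonneg _
  have : 0 ≤ A * (A / 2 * ∫ z, lneg z ^ 2) := by positivity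
  linarith

lemma four_le_max (h : Peak V Ω A a u p) : ∫ x, ‖u x‖ ^ 4 ≤ A * ‖u p‖ ^ 2 := by
  have h1 : ∫ x, ‖u x‖ ^ 4 ≤ ∫ x, ‖u p‖ ^ 2 * ‖u x‖ ^ 2 := by
    refine integral_mono h.sub.int_four (h.sub.magH1.int.const_mul _) fun x => ?_
    have : ‖u x‖ ^ 2 * ‖u x‖ ^ 2 ≤ ‖u p‖ ^ 2 * ‖u x‖ ^ 2 := by gcongr; exact h.max x
    calc ‖u x‖ ^ 4 = ‖u x‖ ^ 2 * ‖u x‖ ^ 2 := by ring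
      _ ≤ _ := this
  rw [integral_const_mul, h.sub.mass, mul_comm] at h1
  refine h1.trans ?_
  gcongr
  exact h.sub.lt.le

lemma gauss_mass_le (h : Peak V Ω A a u p) {B κ : ℝ} (hB : 0 < B) (hκ : 0 < κ) :
    ∫ x, gauss p B x * ‖u x‖ ^ 2
      ≤ κ * (∫ x, ‖u x‖ ^ 4) + (4 * κ)⁻¹ * (Real.pi / B) := by
  rw [← integral_gauss p hB, ← integral_const_mul, ← integral_const_mul,
    ← integral_add (h.sub.int_four.const_mul _) ((integrable_gauss p hB).const_mul _)]
  refine integral_mono (h.sub.magH1.integrable_gauss_mul p hB.le)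
    ((h.sub.int_four.const_mul _).add ((integrable_gauss p hB).const_mul _)) fun x => ?_
  have h1 := gauss_pos p B x
  have h2 := gauss_le_one p hB.le x
  have h3 : gauss p B x * ‖u x‖ ^ 2 ≤ κ * ‖u x‖ ^ 4 + (4 * κ)⁻¹ * gauss p B x ^ 2 := by
    have e : κ * ‖u x‖ ^ 4 + (4 * κ)⁻¹ * gauss p B x ^ 2 - gauss p B x * ‖u x‖ ^ 2
        = (4 * κ)⁻¹ * (gauss p B x - 2 * κ * ‖u x‖ ^ 2) ^ 2 := by
      field_simp; ring
    have : 0 ≤ (4 * κ)⁻¹ * (gauss p B x - 2 * κ * ‖u x‖ ^ 2) ^ 2 := by positivity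
    linarith
  have h4 : (4 * κ)⁻¹ * gauss p B x ^ 2 ≤ (4 * κ)⁻¹ * gauss p B x := by
    gcongr; nlinarith
  linarith

lemma exists_rate (h : Peak V Ω A a u p) :
    ∃ B : ℝ, (∫ x, ‖u x‖ ^ 4) / A ≤ B ∧ B ≤ 16 * (∫ x, ‖u x‖ ^ 4) ∧
      1 / 2 ≤ ∫ x, gauss p B x * ‖u x‖ ^ 2 ∧
      ∀ z, ‖u z‖ ^ 2 ≤ B * ∫ x, gauss z B x * ‖u x‖ ^ 2 := by
  have hA := h.sub.A_pos
  have hD := h.four_pos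
  have hDM := h.four_le_max
  have hC0 : 0 ≤ ∫ z, lneg z ^ 2 := integral_nonneg fun z => sq_nonneg _
  have hM : A / 2 * (∫ z, lneg z ^ 2) ≤ ‖u p‖ ^ 2 := by
    have := h.large
    by_contra hc
    have := mul_lt_mul_of_pos_left (not_le.1 hc) hA
    linarith
  have hM0 : 0 < ‖u p‖ ^ 2 := by
    by_contra hc
    have := mul_nonpos_of_nonneg_of_nonpos hA.le (not_lt.1 hc)
    linarith
  obtain ⟨B, hB⟩ : ∃ B, B = ‖u p‖ ^ 2 + A / 2 * ∫ z, lneg z ^ 2 := ⟨_, rfl⟩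
  have hBM : ‖u p‖ ^ 2 ≤ B := by
    have : 0 ≤ A / 2 * ∫ z, lneg z ^ 2 := by positivity
    linarith
  have hB0 : 0 < B := hM0.trans_le hBM
  have hloc := h.sub.normSq_le h.energy h.max hB hB0
  have hhalf : 1 / 2 ≤ ∫ x, gauss p B x * ‖u x‖ ^ 2 := by
    have h1 := hloc p
    have h2 : B ≤ 2 * (B * ∫ x, gauss p B x * ‖u x‖ ^ 2) := by linarith
    by_contra hc
    have := mul_lt_mul_of_pos_left (not_le.1 hc) hB0
    linarith
  refine ⟨B, ?_, ?_, hhalf, hloc⟩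
  · rw [div_le_iff₀ hA]
    nlinarith
  · have h1 := h.gauss_mass_le hB0 (κ := 1 / (4 * ∫ x, ‖u x‖ ^ 4)) (by positivity)
    have e : ∀ D : ℝ, 0 < D → 1 / (4 * D) * D + (4 * (1 / (4 * D)))⁻¹ * (Real.pi / B)
        = 1 / 4 + Real.pi * D / B := fun D hD => by field_simp
    rw [e _ hD] at h1
    have h2 : 1 / 4 ≤ Real.pi * (∫ x, ‖u x‖ ^ 4) / B := by linarith
    rw [le_div_iff₀ hB0] at h2
    have := Real.pi_lt_four
    nlinarith

lemma exp_rate_le (h : Peak V Ω A a u p) {B r : ℝ} (hr : 0 < r)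
    (hB : (∫ x, ‖u x‖ ^ 4) / A ≤ B) :
    a * Real.exp (-(B * r ^ 2)) ≤ A ^ 2 / ((∫ x, ‖u x‖ ^ 4) * r ^ 2) := by
  have hA := h.sub.A_pos
  have hD := h.four_pos
  have hDA : 0 < (∫ x, ‖u x‖ ^ 4) / A * r ^ 2 := by positivity
  have h1 : Real.exp (-(B * r ^ 2)) ≤ ((∫ x, ‖u x‖ ^ 4) / A * r ^ 2)⁻¹ :=
    (Real.exp_le_exp.2 (by gcongr)).trans (exp_neg_le_inv hDA)
  have ha := h.sub.lt
  have e : ∀ D : ℝ, A * (D / A * r ^ 2)⁻¹ = A ^ 2 / (D * r ^ 2) := fun D => by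
    rw [mul_inv, inv_div]; field_simp
  rw [← e]
  have := h.sub.pos
  gcongr

lemma massOut_le_sub (h : Peak V Ω A a u p) {r : ℝ} (hr : 0 < r) :
    massOut u p r ≤ a - 1 / 2 + A ^ 2 / ((∫ x, ‖u x‖ ^ 4) * r ^ 2) := by
  obtain ⟨B, hB1, hB2, hB3, -⟩ := h.exists_rate
  have hB0 : 0 < B := lt_of_lt_of_le (div_pos h.four_pos h.sub.A_pos) hB1
  refine le_trans ?_ (add_le_add_right (h.exp_rate_le hr hB1) _)
  have hn := h.sub.magH1.int
  have hi := hn.indicator (s := (ball p r)ᶜ) measurableSet_ball.compl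
  have key : ∫ x, gauss p B x * ‖u x‖ ^ 2
      ≤ ∫ x, (‖u x‖ ^ 2 - 1 * ((ball p r)ᶜ).indicator (fun x => ‖u x‖ ^ 2) x
        + Real.exp (-(B * r ^ 2)) * ‖u x‖ ^ 2) := by
    refine integral_mono (h.sub.magH1.integrable_gauss_mul p hB0.le)
      (integrable_lin_three hn hi hn _ _) fun x => ?_
    have h2 := gauss_le_one p hB0.le x
    by_cases hx : x ∈ ball p r
    · rw [indicator_of_notMem (by simpa using hx)]
      have : 0 ≤ Real.exp (-(B * r ^ 2)) * ‖u x‖ ^ 2 := by positivity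
      have : gauss p B x * ‖u x‖ ^ 2 ≤ 1 * ‖u x‖ ^ 2 := by gcongr
      linarith
    · rw [indicator_of_mem (by simpa using hx)]
      have hx' : r ≤ ‖x - p‖ := by simpa [dist_eq_norm] using hx
      have : gauss p B x ≤ Real.exp (-(B * r ^ 2)) := by
        refine Real.exp_le_exp.2 ?_
        rw [neg_mul]; gcongr
      have : gauss p B x * ‖u x‖ ^ 2 ≤ Real.exp (-(B * r ^ 2)) * ‖u x‖ ^ 2 := by gcongr
      linarith
  rw [integral_lin_three hn hi hn, ← massOut_eq, h.sub.mass] at key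
  linarith

lemma normSq_far (h : Peak V Ω A a u p) {r : ℝ} (hr : 0 < r) {z : Plane}
    (hz : 2 * r ≤ ‖z - p‖) :
    ‖u z‖ ^ 2 ≤ 16 * (∫ x, ‖u x‖ ^ 4)
      * (massOut u p r + A ^ 2 / ((∫ x, ‖u x‖ ^ 4) * r ^ 2)) := by
  obtain ⟨B, hB1, hB2, -, hB4⟩ := h.exists_rate
  have hB0 : 0 < B := lt_of_lt_of_le (div_pos h.four_pos h.sub.A_pos) hB1
  have hn := h.sub.magH1.int
  have hi := hn.indicator (s := (ball p r)ᶜ) measurableSet_ball.compl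
  have key : ∫ x, gauss z B x * ‖u x‖ ^ 2
      ≤ ∫ x, (((ball p r)ᶜ).indicator (fun x => ‖u x‖ ^ 2) x
        + Real.exp (-(B * r ^ 2)) * ‖u x‖ ^ 2) := by
    refine integral_mono (h.sub.magH1.integrable_gauss_mul z hB0.le)
      (hi.add (hn.const_mul _)) fun x => ?_
    have h2 := gauss_le_one z hB0.le x
    by_cases hx : x ∈ ball p r
    · have hx' : ‖x - p‖ < r := by simpa [dist_eq_norm] using hx
      have hx2 : r ≤ ‖x - z‖ := by
        have := norm_sub_le_norm_sub_add_norm_sub z x p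
        rw [norm_sub_rev x z]
        linarith
      rw [indicator_of_notMem (by simpa using hx)]
      have : gauss z B x ≤ Real.exp (-(B * r ^ 2)) := by
        refine Real.exp_le_exp.2 ?_
        rw [neg_mul]; gcongr
      have : gauss z B x * ‖u x‖ ^ 2 ≤ Real.exp (-(B * r ^ 2)) * ‖u x‖ ^ 2 := by gcongr
      linarith
    · rw [indicator_of_mem (by simpa using hx)]
      have : 0 ≤ Real.exp (-(B * r ^ 2)) * ‖u x‖ ^ 2 := by positivity
      have : gauss z B x * ‖u x‖ ^ 2 ≤ 1 * ‖u x‖ ^ 2 := by gcongr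
      linarith
  rw [integral_add hi (hn.const_mul _), ← massOut_eq, integral_const_mul, h.sub.mass] at key
  have hexp := h.exp_rate_le hr hB1
  have hm := massOut_nonneg u p r
  have hpos : 0 ≤ massOut u p r + A ^ 2 / ((∫ x, ‖u x‖ ^ 4) * r ^ 2) := by
    have := h.four_pos; positivity
  calc ‖u z‖ ^ 2 ≤ B * ∫ x, gauss z B x * ‖u x‖ ^ 2 := hB4 z
    _ ≤ B * (massOut u p r + A ^ 2 / ((∫ x, ‖u x‖ ^ 4) * r ^ 2)) := by
        gcongr; linarith
    _ ≤ _ := by gcongr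

end Peak

lemma d0R_comp {f : Plane → ℝ} {g : ℝ → ℝ} {g' : ℝ} {x : Plane} (hg : HasDerivAt g g' (f x))
    (hf : DifferentiableAt ℝ f x) : d0R (fun y => g (f y)) x = g' * d0R f x := by
  have h := hg.comp_hasFDerivAt x hf.hasFDerivAt
  unfold d0R
  rw [show (fun y => g (f y)) = g ∘ f from rfl, h.fderiv]
  simp

lemma d1R_comp {f : Plane → ℝ} {g : ℝ → ℝ} {g' : ℝ} {x : Plane} (hg : HasDerivAt g g' (f x))
    (hf : DifferentiableAt ℝ f x) : d1R (fun y => g (f y)) x = g' * d1R f x := by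
  have h := hg.comp_hasFDerivAt x hf.hasFDerivAt
  unfold d1R
  rw [show (fun y => g (f y)) = g ∘ f from rfl, h.fderiv]
  simp

lemma gradSqR_comp {f : Plane → ℝ} {g : ℝ → ℝ} {g' : ℝ} {x : Plane} (hg : HasDerivAt g g' (f x))
    (hf : DifferentiableAt ℝ f x) : gradSqR (fun y => g (f y)) x = g' ^ 2 * gradSqR f x := by
  unfold gradSqR; rw [d0R_comp hg hf, d1R_comp hg hf]; ring

lemma cr_comp {f : Plane → ℝ} {u : Plane → ℂ} {g : ℝ → ℝ} {g' : ℝ} {x : Plane}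
    (hg : HasDerivAt g g' (f x)) (hf : DifferentiableAt ℝ f x) :
    cr (fun y => g (f y)) u x = g' * cr f u x := by
  unfold cr; rw [d0R_comp hg hf, d1R_comp hg hf]; ring

lemma gradSqR_cos_le {θ : Plane → ℝ} {x : Plane} (hθ : DifferentiableAt ℝ θ x) :
    gradSqR (fun y => Real.cos (θ y)) x ≤ gradSqR θ x := by
  rw [gradSqR_comp (Real.hasDerivAt_cos _) hθ, neg_sq]
  exact mul_le_of_le_one_left (gradSqR_nonneg _ _) (Real.sin_sq_le_one _)

lemma gradSqR_sin_le {θ : Plane → ℝ} {x : Plane} (hθ : DifferentiableAt ℝ θ x) :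
    gradSqR (fun y => Real.sin (θ y)) x ≤ gradSqR θ x := by
  rw [gradSqR_comp (Real.hasDerivAt_sin _) hθ]
  exact mul_le_of_le_one_left (gradSqR_nonneg _ _) (Real.cos_sq_le_one _)

/-- The localization formula for the magnetic Dirichlet form. -/
lemma magSq_cos_add_sin (b : ℝ) {θ : Plane → ℝ} {u : Plane → ℂ} {x : Plane}
    (hθ : DifferentiableAt ℝ θ x) (hu : DifferentiableAt ℝ u x) :
    magSq b (fun y => Real.cos (θ y) • u y) x + magSq b (fun y => Real.sin (θ y) • u y) x
      = magSq b u x + gradSqR θ x * ‖u x‖ ^ 2 := by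
  rw [magSq_smul b hθ.cos hu, magSq_smul b hθ.sin hu, gradSqR_comp (Real.hasDerivAt_cos _) hθ,
    gradSqR_comp (Real.hasDerivAt_sin _) hθ, cr_comp (Real.hasDerivAt_cos _) hθ,
    cr_comp (Real.hasDerivAt_sin _) hθ]
  linear_combination (magSq b u x + gradSqR θ x * ‖u x‖ ^ 2) * Real.sin_sq_add_cos_sq (θ x)

section Split

variable {V : Plane → ℝ} {Ω A a : ℝ} {u : Plane → ℂ}

lemma SubMin.split (h : SubMin V Ω A a u) {θ : Plane → ℝ} (hθ : Differentiable ℝ θ) {G κ : ℝ}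
    (hG : ∀ x, gradSqR θ x ≤ G)
    (h1 : ∫ x, Real.cos (θ x) ^ 2 * ‖u x‖ ^ 2 ≤ A - κ)
    (h2 : ∫ x, Real.sin (θ x) ^ 2 * ‖u x‖ ^ 2 ≤ A - κ) :
    A * ((∫ x, ‖u x‖ ^ 4) - 2 * ∫ x, (Real.cos (θ x) * Real.sin (θ x)) ^ 2 * ‖u x‖ ^ 4)
      ≤ 2 * (A - κ) * ((∫ x, magSq Ω u x) + G * A) := by
  have hu := h.magH1
  have hθm : Measurable θ := hθ.continuous.measurable
  have hG0 : 0 ≤ G := (gradSqR_nonneg θ 0).trans (hG 0)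
  have hκ : 0 ≤ A - κ := (integral_nonneg fun x => by positivity).trans h1
  have hc : MagH1 Ω (fun x => Real.cos (θ x) • u x) := hu.smul hθ.cos
    (fun x => Real.abs_cos_le_one _) (fun x => (gradSqR_cos_le (hθ x)).trans (hG x))
  have hs : MagH1 Ω (fun x => Real.sin (θ x) • u x) := hu.smul hθ.sin
    (fun x => Real.abs_sin_le_one _) (fun x => (gradSqR_sin_le (hθ x)).trans (hG x))
  have g1 := (h.gn.mag h.A_pos hc).2
  have g2 := (h.gn.mag h.A_pos hs).2
  simp only [norm_real_smul_sq, norm_real_smul_four] at g1 g2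
  have t1 : 0 ≤ ∫ x, magSq Ω (fun x => Real.cos (θ x) • u x) x := SubMin.mag_nonneg _ _
  have t2 : 0 ≤ ∫ x, magSq Ω (fun x => Real.sin (θ x) • u x) x := SubMin.mag_nonneg _ _
  have hgi : Integrable fun x => gradSqR θ x * ‖u x‖ ^ 2 :=
    integrable_bdd_mul hu.int (measurable_gradSqR _) (C := G)
      fun x => by rw [abs_of_nonneg (gradSqR_nonneg _ _)]; exact hG x
  have hT : (∫ x, magSq Ω (fun x => Real.cos (θ x) • u x) x)
      + (∫ x, magSq Ω (fun x => Real.sin (θ x) • u x) x) ≤ (∫ x, magSq Ω u x) + G * A := by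
    rw [← integral_add hc.int_mag hs.int_mag]
    have e : ∫ x, (magSq Ω (fun x => Real.cos (θ x) • u x) x
        + magSq Ω (fun x => Real.sin (θ x) • u x) x)
        = (∫ x, magSq Ω u x) + ∫ x, gradSqR θ x * ‖u x‖ ^ 2 := by
      rw [← integral_add hu.int_mag hgi]
      exact integral_congr_ae (Eventually.of_forall fun x => magSq_cos_add_sin Ω (hθ x) (hu.diff x))
    rw [e]
    have : ∫ x, gradSqR θ x * ‖u x‖ ^ 2 ≤ G * a := by
      rw [← h.mass, ← integral_const_mul]
      exact integral_mono hgi (hu.int.const_mul _) fun x => by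
        have := hG x; simp only; gcongr
    have : G * a ≤ G * A := by have := h.lt; gcongr
    linarith
  have hb : ∀ {f : ℝ → ℝ}, Measurable f → (∀ t, |f t| ≤ 1) →
      Integrable fun x => f (θ x) * ‖u x‖ ^ 4 := fun hf hf1 =>
    integrable_bdd_mul h.int_four (hf.comp hθm) (C := 1) fun x => hf1 _
  have ic : ∀ t, |Real.cos t ^ 4| ≤ 1 := fun t => by
    rw [abs_pow]; exact pow_le_one₀ (abs_nonneg _) (Real.abs_cos_le_one t)
  have is : ∀ t, |Real.sin t ^ 4| ≤ 1 := fun t => by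
    rw [abs_pow]; exact pow_le_one₀ (abs_nonneg _) (Real.abs_sin_le_one t)
  have ics : ∀ t, |(Real.cos t * Real.sin t) ^ 2| ≤ 1 := fun t => by
    rw [abs_pow, abs_mul]
    exact pow_le_one₀ (by positivity)
      (mul_le_one₀ (Real.abs_cos_le_one t) (abs_nonneg _) (Real.abs_sin_le_one t))
  have hD : (∫ x, Real.cos (θ x) ^ 4 * ‖u x‖ ^ 4) + (∫ x, Real.sin (θ x) ^ 4 * ‖u x‖ ^ 4)
      = (∫ x, ‖u x‖ ^ 4) - 2 * ∫ x, (Real.cos (θ x) * Real.sin (θ x)) ^ 2 * ‖u x‖ ^ 4 := by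
    have i1 := hb (f := fun t => Real.cos t ^ 4) (by fun_prop) ic
    have i2 := hb (f := fun t => Real.sin t ^ 4) (by fun_prop) is
    have i3 := hb (f := fun t => (Real.cos t * Real.sin t) ^ 2) (by fun_prop) ics
    rw [← integral_add i1 i2, ← integral_const_mul,
      ← integral_sub h.int_four (i3.const_mul 2)]
    refine integral_congr_ae (Eventually.of_forall fun x => ?_)
    have := Real.sin_sq_add_cos_sq (θ x)
    simp only
    linear_combination ‖u x‖ ^ 4 * (Real.sin (θ x) ^ 2 + Real.cos (θ x) ^ 2 + 1) * this
  rw [← hD]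
  have b1 := mul_le_mul_of_nonneg_left h1 (mul_nonneg zero_le_two t1)
  have b2 := mul_le_mul_of_nonneg_left h2 (mul_nonneg zero_le_two t2)
  have b3 := mul_le_mul_of_nonneg_left hT (mul_nonneg zero_le_two hκ)
  linarith

end Split

lemma exists_le_of_sum_le {N : ℕ} (hN : 0 < N) {f : ℕ → ℝ} {D : ℝ}
    (h : ∑ j ∈ Finset.range N, f j ≤ D) : ∃ j < N, f j ≤ D / N := by
  by_contra hc
  push Not at hc
  have h1 : ∑ j ∈ Finset.range N, D / N < ∑ j ∈ Finset.range N, f j :=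
    Finset.sum_lt_sum_of_nonempty ⟨0, by simpa using hN⟩ fun j hj => hc j (Finset.mem_range.1 hj)
  rw [Finset.sum_const, Finset.card_range, nsmul_eq_mul] at h1
  have : (N : ℝ) * (D / N) = D := by
    have : (N : ℝ) ≠ 0 := by positivity
    field_simp
  linarith

/-- Angle interpolating from `0` to `π / 2` across the `j`-th of `N` shells between
`r ^ 2 / 2` and `r ^ 2`. -/
def angle (p : Plane) (r : ℝ) (N j : ℕ) (x : Plane) : ℝ :=
  Real.pi / 2 * cut p (r ^ 2 / 2 * (1 + j / N)) (r ^ 2 / 2 * (1 + (j + 1) / N)) x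

section Angle

variable {p x : Plane} {r : ℝ} {N j : ℕ}

lemma angle_lt (hr : 0 < r) (hN : 0 < N) :
    r ^ 2 / 2 * (1 + (j : ℝ) / N) < r ^ 2 / 2 * (1 + ((j : ℝ) + 1) / N) := by
  have : (0 : ℝ) < N := by exact_mod_cast hN
  gcongr
  linarith

lemma angle_upper (hN : 0 < N) (hj : j < N) :
    r ^ 2 / 2 * (1 + ((j : ℝ) + 1) / N) ≤ r ^ 2 := by
  have h0 : (0 : ℝ) < N := by exact_mod_cast hN
  have : ((j : ℝ) + 1) / N ≤ 1 := by
    rw [div_le_one h0]; exact_mod_cast hj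
  nlinarith [sq_nonneg r]

lemma angle_eq_zero (hr : 0 < r) (hN : 0 < N)
    (hx : ‖x - p‖ ^ 2 ≤ r ^ 2 / 2 * (1 + (j : ℝ) / N)) : angle p r N j x = 0 := by
  rw [angle, cut_eq_zero (angle_lt hr hN) hx, mul_zero]

lemma angle_eq (hr : 0 < r) (hN : 0 < N)
    (hx : r ^ 2 / 2 * (1 + ((j : ℝ) + 1) / N) ≤ ‖x - p‖ ^ 2) : angle p r N j x = Real.pi / 2 := by
  rw [angle, cut_eq_one (angle_lt hr hN) hx, mul_one]

lemma differentiable_angle (p : Plane) (r : ℝ) (N j : ℕ) : Differentiable ℝ (angle p r N j) :=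
  (differentiable_cut _ _ _).const_mul _

lemma exists_gradSqR_angle_le (hr : 0 < r) (hN : 0 < N) :
    ∃ G, ∀ p j, j < N → ∀ x, gradSqR (angle p r N j) x ≤ G := by
  obtain ⟨B, hB0, hB⟩ := smoothTransition_deriv_bound
  refine ⟨(Real.pi / 2) ^ 2 * (4 * B ^ 2 * r ^ 2 / (r ^ 2 / 2 * (1 / N)) ^ 2), fun p j hj x => ?_⟩
  have h0 : (0 : ℝ) < N := by exact_mod_cast hN
  have e : gradSqR (angle p r N j) x = (Real.pi / 2) ^ 2
      * gradSqR (cut p (r ^ 2 / 2 * (1 + j / N)) (r ^ 2 / 2 * (1 + (j + 1) / N))) x :=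
    gradSqR_comp (g := fun t => Real.pi / 2 * t)
      (by simpa using (hasDerivAt_id _).const_mul (Real.pi / 2)) (differentiable_cut _ _ _ x)
  rw [e]
  gcongr
  refine (gradSqR_cut_le hB p (by positivity) (angle_lt hr hN) x).trans ?_
  have e2 : r ^ 2 / 2 * (1 + ((j : ℝ) + 1) / N) - r ^ 2 / 2 * (1 + (j : ℝ) / N)
      = r ^ 2 / 2 * (1 / N) := by ring
  rw [e2]
  gcongr
  exact angle_upper hN hj

lemma sum_cos_mul_sin_angle_le (hr : 0 < r) (hN : 0 < N) (x : Plane) :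
    ∑ j ∈ Finset.range N, (Real.cos (angle p r N j x) * Real.sin (angle p r N j x)) ^ 2 ≤ 1 := by
  have h0 : (0 : ℝ) < N := by exact_mod_cast hN
  have hne : ∀ j : ℕ, (Real.cos (angle p r N j x) * Real.sin (angle p r N j x)) ^ 2 ≠ 0 →
      r ^ 2 / 2 * (1 + (j : ℝ) / N) < ‖x - p‖ ^ 2 ∧
      ‖x - p‖ ^ 2 < r ^ 2 / 2 * (1 + ((j : ℝ) + 1) / N) := fun j hj => by
    constructor
    · by_contra hc
      exact hj (by rw [angle_eq_zero hr hN (not_lt.1 hc)]; simp)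
    · by_contra hc
      exact hj (by rw [angle_eq hr hN (not_lt.1 hc)]; simp)
  by_cases hex : ∃ j ∈ Finset.range N,
      (Real.cos (angle p r N j x) * Real.sin (angle p r N j x)) ^ 2 ≠ 0
  · obtain ⟨j, hjN, hj⟩ := hex
    rw [Finset.sum_eq_single_of_mem j hjN]
    · rw [mul_pow]
      exact mul_le_one₀ (Real.cos_sq_le_one _) (sq_nonneg _) (Real.sin_sq_le_one _)
    · intro i _ hij
      by_contra hi
      have h1 := hne j hj
      have h2 := hne i hi
      have h3 := h1.1.trans h2.2
      have h4 := h2.1.trans h1.2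
      have hr2 : 0 < r ^ 2 / 2 := by positivity
      rw [mul_lt_mul_iff_right₀ hr2, add_lt_add_iff_left, div_lt_div_iff_of_pos_right h0] at h3 h4
      have h5 : j < i + 1 := by exact_mod_cast h3
      have h6 : i < j + 1 := by exact_mod_cast h4
      omega
  · push Not at hex
    rw [Finset.sum_eq_zero hex]
    exact zero_le_one

end Angle

namespace Peak

variable {V : Plane → ℝ} {Ω A a : ℝ} {u : Plane → ℂ} {p : Plane}

lemma exists_shell (h : Peak V Ω A a u p) {r : ℝ} (hr : 0 < r) {N : ℕ} (hN : 0 < N) :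
    ∃ j < N, ∫ x, (Real.cos (angle p r N j x) * Real.sin (angle p r N j x)) ^ 2 * ‖u x‖ ^ 4
      ≤ (∫ x, ‖u x‖ ^ 4) / N := by
  refine exists_le_of_sum_le hN ?_
  have hi : ∀ j, Integrable fun x =>
      (Real.cos (angle p r N j x) * Real.sin (angle p r N j x)) ^ 2 * ‖u x‖ ^ 4 := fun j => by
    have hm := (differentiable_angle p r N j).continuous.measurable
    refine integrable_bdd_mul h.sub.int_four (by fun_prop) (C := 1) fun x => ?_
    rw [abs_of_nonneg (sq_nonneg _), mul_pow]
    exact mul_le_one₀ (Real.cos_sq_le_one _) (sq_nonneg _) (Real.sin_sq_le_one _)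
  rw [← integral_finsetSum _ fun j _ => hi j]
  refine integral_mono (integrable_finsetSum _ fun j _ => hi j) h.sub.int_four fun x => ?_
  simp only [← Finset.sum_mul]
  exact mul_le_of_le_one_left (by positivity) (sum_cos_mul_sin_angle_le hr hN x)

lemma cos_mass_le (h : Peak V Ω A a u p) {r : ℝ} (hr : 0 < r) {N j : ℕ} (hN : 0 < N)
    (hj : j < N) :
    ∫ x, Real.cos (angle p r N j x) ^ 2 * ‖u x‖ ^ 2 ≤ a - massOut u p r := by
  have hn := h.sub.magH1.int
  have hi := hn.indicator (s := (ball p r)ᶜ) measurableSet_ball.compl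
  have hm := (differentiable_angle p r N j).continuous.measurable
  rw [massOut_eq, ← h.sub.mass, ← integral_sub hn hi]
  refine integral_mono (integrable_bdd_mul hn (by fun_prop) (C := 1) fun x => by
    rw [abs_of_nonneg (sq_nonneg _)]; exact Real.cos_sq_le_one _) (hn.sub hi) fun x => ?_
  by_cases hx : x ∈ ball p r
  · rw [indicator_of_notMem (by simpa using hx), sub_zero]
    exact mul_le_of_le_one_left (by positivity) (Real.cos_sq_le_one _)
  · rw [indicator_of_mem (by simpa using hx), sub_self]
    have hx' : r ≤ ‖x - p‖ := by simpa [dist_eq_norm] using hx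
    rw [angle_eq hr hN ((angle_upper hN hj).trans (by gcongr))]
    simp

lemma sin_mass_le (h : Peak V Ω A a u p) {r : ℝ} (hr : 0 < r) {N j : ℕ} (hN : 0 < N) :
    ∫ x, Real.sin (angle p r N j x) ^ 2 * ‖u x‖ ^ 2 ≤ massOut u p (r / 2) := by
  have hn := h.sub.magH1.int
  have hi := hn.indicator (s := (ball p (r / 2))ᶜ) measurableSet_ball.compl
  have hm := (differentiable_angle p r N j).continuous.measurable
  rw [massOut_eq]
  refine integral_mono (integrable_bdd_mul hn (by fun_prop) (C := 1) fun x => by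
    rw [abs_of_nonneg (sq_nonneg _)]; exact Real.sin_sq_le_one _) hi fun x => ?_
  by_cases hx : x ∈ ball p (r / 2)
  · rw [indicator_of_notMem (by simpa using hx)]
    have hx' : ‖x - p‖ < r / 2 := by simpa [dist_eq_norm] using hx
    have h1 : ‖x - p‖ ^ 2 ≤ (r / 2) ^ 2 := by gcongr
    have h2 : (0 : ℝ) ≤ (j : ℝ) / N := by positivity
    rw [angle_eq_zero hr hN]
    · simp
    · nlinarith [sq_nonneg r]
  · rw [indicator_of_mem (by simpa using hx)]
    exact mul_le_of_le_one_left (by positivity) (Real.sin_sq_le_one _)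

end Peak

lemma concentration_arith {A κ D T X G C δ N : ℝ} (hA : 0 < A) (hκ : 0 < κ)
    (hκA : κ ≤ A) (hD : 0 ≤ D) (hC : 0 ≤ C) (hG : 0 ≤ G) (hN : N = 8 * A / κ + 1)
    (hX : X ≤ D / N) (hδ : δ = κ / (4 * A ^ 2))
    (hT : T ≤ 1 / 2 * D + 1 / 2 * A * (δ * D + (4 * δ)⁻¹ * C))
    (h : A * (D - 2 * X) ≤ 2 * (A - κ) * (T + G * A)) :
    κ / 2 * D ≤ A * (A * ((4 * δ)⁻¹ * C) + 2 * (G * A)) := by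
  have hN0 : 0 < N := by rw [hN]; positivity
  have hδ0 : 0 < δ := by rw [hδ]; positivity
  have h1 : 2 * A * X ≤ κ / 4 * D := by
    have h2 : 2 * A * X ≤ 2 * A * (D / N) := by gcongr
    have h3 : 2 * A * (D / N) ≤ κ / 4 * D := by
      rw [← mul_div_assoc, div_le_iff₀ hN0, hN]
      have : κ / 4 * D * (8 * A / κ + 1) = 2 * A * D + κ / 4 * D := by field_simp; ring
      rw [this]
      have : 0 ≤ κ / 4 * D := by positivity
      linarith
    linarith
  have h4 : 2 * (A - κ) * (T + G * A)
      ≤ 2 * (A - κ) * (1 / 2 * D + 1 / 2 * A * (δ * D + (4 * δ)⁻¹ * C) + G * A) := by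
    have : 0 ≤ A - κ := by linarith
    gcongr
  have h5 : A ^ 2 * δ = κ / 4 := by rw [hδ]; field_simp
  set Y := (4 * δ)⁻¹ * C
  have hY : 0 ≤ Y := by positivity
  have h6 : (A - κ) * (A * (δ * D + Y) + 2 * (G * A)) ≤ A * (A * (δ * D + Y) + 2 * (G * A)) := by
    have : 0 ≤ A * (δ * D + Y) + 2 * (G * A) := by positivity
    gcongr; linarith
  have h7 : A * (A * (δ * D)) = κ / 4 * D := by rw [← h5]; ring
  nlinarith

/-- Mass concentrates at the maximum point as the quartic norm blows up. -/
lemma exists_massOut_le (V : Plane → ℝ) (Ω : ℝ) {A : ℝ} (hA : 0 < A) {r δ : ℝ} (hr : 0 < r)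
    (hδ : 0 < δ) :
    ∃ K, ∀ a u p, Peak V Ω A a u p → K ≤ ∫ x, ‖u x‖ ^ 4 → massOut u p r ≤ δ := by
  obtain ⟨κ, hκ⟩ : ∃ κ, κ = min (min δ (1 / 4)) A := ⟨_, rfl⟩
  have hκ0 : 0 < κ := by rw [hκ]; positivity
  have hκδ : κ ≤ δ := by rw [hκ]; exact (min_le_left _ _).trans (min_le_left _ _)
  have hκ4 : κ ≤ 1 / 4 := by rw [hκ]; exact (min_le_left _ _).trans (min_le_right _ _)
  have hκA : κ ≤ A := by rw [hκ]; exact min_le_right _ _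
  obtain ⟨N, hN⟩ := exists_nat_ge (8 * A / κ + 1)
  have hN0 : 0 < N := by
    have : (0 : ℝ) < N := lt_of_lt_of_le (by positivity) hN
    exact_mod_cast this
  obtain ⟨G, hG⟩ := exists_gradSqR_angle_le hr hN0
  have hG0 : 0 ≤ G := (gradSqR_nonneg _ _).trans (hG 0 0 hN0 0)
  obtain ⟨δ', hδ'⟩ : ∃ δ', δ' = κ / (4 * A ^ 2) := ⟨_, rfl⟩
  have hδ'0 : 0 < δ' := by rw [hδ']; positivity
  set C := ∫ z, lneg z ^ 2
  have hC : 0 ≤ C := integral_nonneg fun z => sq_nonneg _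
  refine ⟨max (4 * A ^ 2 / (r / 2) ^ 2)
    ((A * (A * ((4 * δ')⁻¹ * C) + 2 * (G * A)) + 1) / (κ / 2)), fun a u p h hK => ?_⟩
  by_contra hcon
  have hD := h.four_pos
  have hK1 := (le_max_left _ _).trans hK
  have hK2 := (le_max_right _ _).trans hK
  obtain ⟨j, hj, hX⟩ := h.exists_shell hr hN0
  have hsmall : A ^ 2 / ((∫ x, ‖u x‖ ^ 4) * (r / 2) ^ 2) ≤ 1 / 4 := by
    rw [div_le_iff₀ (by positivity)] at hK1
    rw [div_le_iff₀ (by positivity)]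
    linarith
  have hout := h.massOut_le_sub (half_pos hr)
  have ha := h.sub.lt
  have hsplit := h.sub.split (differentiable_angle p r N j) (κ := κ) (hG p j hj)
    ((h.cos_mass_le hr hN0 hj).trans (by linarith [not_le.1 hcon]))
    ((h.sin_mass_le hr hN0).trans (by linarith))
  have hE := h.energy
  rw [h.sub.energy_eq] at hE
  have hL := h.sub.logConv_ge hδ'0
  have hp := h.sub.pot_nonneg
  have hpos : 0 ≤ δ' * (∫ x, ‖u x‖ ^ 4) + (4 * δ')⁻¹ * C := by positivity
  have haA : a * (δ' * (∫ x, ‖u x‖ ^ 4) + (4 * δ')⁻¹ * C)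
      ≤ A * (δ' * (∫ x, ‖u x‖ ^ 4) + (4 * δ')⁻¹ * C) := by gcongr
  have hT : ∫ x, magSq Ω u x ≤ 1 / 2 * (∫ x, ‖u x‖ ^ 4)
      + 1 / 2 * A * (δ' * (∫ x, ‖u x‖ ^ 4) + (4 * δ')⁻¹ * C) := by linarith
  have hX' : ∫ x, (Real.cos (angle p r N j x) * Real.sin (angle p r N j x)) ^ 2 * ‖u x‖ ^ 4
      ≤ (∫ x, ‖u x‖ ^ 4) / (8 * A / κ + 1) := by
    refine hX.trans ?_
    gcongr
  have := concentration_arith hA hκ0 hκA hD.le hC hG0 rfl hX' hδ' hT hsplit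
  rw [div_le_iff₀ (by positivity)] at hK2
  linarith

section Tail

variable {V : Plane → ℝ} {Ω A a : ℝ} {u : Plane → ℂ} {p : Plane} {r : ℝ}

/-- Cutoff vanishing on the ball of radius `2 * r` and equal to one outside radius `3 * r`. -/
def tailCut (p : Plane) (r : ℝ) : Plane → ℝ := cut p ((2 * r) ^ 2) ((3 * r) ^ 2)

lemma tailCut_lt (hr : 0 < r) : (2 * r) ^ 2 < (3 * r) ^ 2 := by nlinarith [sq_pos_of_pos hr]

lemma tailCut_sq_le_one (p : Plane) (r : ℝ) (x : Plane) : tailCut p r x ^ 2 ≤ 1 :=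
  pow_le_one₀ (cut_nonneg _ _ _ _) (cut_le_one _ _ _ _)

lemma differentiable_tailCut (p : Plane) (r : ℝ) : Differentiable ℝ (tailCut p r) :=
  differentiable_cut _ _ _

lemma tailCut_eq_one (hr : 0 < r) {x : Plane} (hx : (3 * r) ^ 2 ≤ ‖x - p‖ ^ 2) :
    tailCut p r x = 1 := cut_eq_one (tailCut_lt hr) hx

lemma tailCut_eq_zero (hr : 0 < r) {x : Plane} (hx : x ∈ ball p (2 * r)) :
    tailCut p r x = 0 := by
  have : ‖x - p‖ < 2 * r := by simpa [dist_eq_norm] using hx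
  exact cut_eq_zero (tailCut_lt hr) (by gcongr)

lemma gradSqR_tailCut_eq_zero (hr : 0 < r) {x : Plane} (hx : x ∈ ball p (2 * r)) :
    gradSqR (tailCut p r) x = 0 := by
  have : ‖x - p‖ < 2 * r := by simpa [dist_eq_norm] using hx
  exact gradSqR_cut_eq_zero (tailCut_lt hr) (Or.inl (by gcongr))

lemma exists_gradSqR_tailCut_le (hr : 0 < r) : ∃ G, ∀ p x, gradSqR (tailCut p r) x ≤ G := by
  obtain ⟨B, -, hB⟩ := smoothTransition_deriv_bound
  exact ⟨_, fun p x => gradSqR_cut_le hB p (by positivity) (tailCut_lt hr) x⟩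

lemma integrable_tailCut_sq_mul (p : Plane) (r : ℝ) {f : Plane → ℝ} (hf : Integrable f) :
    Integrable fun x => tailCut p r x ^ 2 * f x :=
  integrable_bdd_mul hf ((differentiable_tailCut p r).continuous.measurable.pow_const 2) (C := 1)
    fun x => by rw [abs_of_nonneg (sq_nonneg _)]; exact tailCut_sq_le_one _ _ _

lemma Peak.integral_tailCut_le (h : Peak V Ω A a u p) (hr : 0 < r) :
    ∫ x, tailCut p r x ^ 2 * ‖u x‖ ^ 2 ≤ massOut u p (2 * r) := by
  have hn := h.sub.magH1.int
  rw [massOut_eq]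
  refine integral_mono (integrable_tailCut_sq_mul p r hn)
    (hn.indicator measurableSet_ball.compl) fun x => ?_
  by_cases hx : x ∈ ball p (2 * r)
  · rw [indicator_of_notMem (by simpa using hx)]
    simp [tailCut_eq_zero hr hx]
  · rw [indicator_of_mem (by simpa using hx)]
    exact mul_le_of_le_one_left (by positivity) (tailCut_sq_le_one _ _ _)

lemma Peak.integral_gradSqR_tailCut_le (h : Peak V Ω A a u p) (hr : 0 < r) {G : ℝ}
    (hG : ∀ x, gradSqR (tailCut p r) x ≤ G) :
    Integrable (fun x => gradSqR (tailCut p r) x * ‖u x‖ ^ 2) ∧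
      ∫ x, gradSqR (tailCut p r) x * ‖u x‖ ^ 2 ≤ G * massOut u p (2 * r) := by
  have hn := h.sub.magH1.int
  have hi : Integrable (fun x => gradSqR (tailCut p r) x * ‖u x‖ ^ 2) :=
    integrable_bdd_mul hn (measurable_gradSqR _) (C := G)
      fun x => by rw [abs_of_nonneg (gradSqR_nonneg _ _)]; exact hG x
  refine ⟨hi, ?_⟩
  rw [massOut_eq, ← integral_const_mul]
  refine integral_mono hi ((hn.indicator measurableSet_ball.compl).const_mul _) fun x => ?_
  by_cases hx : x ∈ ball p (2 * r)
  · simp only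
    rw [indicator_of_notMem (by simpa using hx)]
    simp [gradSqR_tailCut_eq_zero hr hx]
  · simp only
    rw [indicator_of_mem (by simpa using hx)]
    have := hG x
    gcongr

lemma Peak.integral_tailCut_four_le (h : Peak V Ω A a u p) (hr : 0 < r) {k : ℝ}
    (hfar : ∀ x, 2 * r ≤ ‖x - p‖ → ‖u x‖ ^ 2 ≤ k) :
    ∫ x, tailCut p r x ^ 2 * ‖u x‖ ^ 4 ≤ k * ∫ x, tailCut p r x ^ 2 * ‖u x‖ ^ 2 := by
  rw [← integral_const_mul]
  refine integral_mono (integrable_tailCut_sq_mul p r h.sub.int_four)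
    ((integrable_tailCut_sq_mul p r h.sub.magH1.int).const_mul _) fun x => ?_
  by_cases hx : x ∈ ball p (2 * r)
  · simp [tailCut_eq_zero hr hx]
  · have hx' : 2 * r ≤ ‖x - p‖ := by simpa [dist_eq_norm] using hx
    have h1 := hfar x hx'
    calc tailCut p r x ^ 2 * ‖u x‖ ^ 4 = ‖u x‖ ^ 2 * (tailCut p r x ^ 2 * ‖u x‖ ^ 2) := by ring
      _ ≤ k * (tailCut p r x ^ 2 * ‖u x‖ ^ 2) := by gcongr

/-- The kinetic energy and, with the weight `∫ |u| ^ 4`, the mass away from the peak are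
controlled by the mass. -/
lemma Peak.tail_le (h : Peak V Ω A a u p) (hr : 0 < r) {G : ℝ}
    (hG : ∀ x, gradSqR (tailCut p r) x ≤ G)
    (hfar : ∀ x, 2 * r ≤ ‖x - p‖ → ‖u x‖ ^ 2 ≤ (∫ x, ‖u x‖ ^ 4) / (8 * A)) :
    1 / 2 * (∫ x, tailCut p r x ^ 2 * magSq Ω u x)
      + (∫ x, ‖u x‖ ^ 4) / (4 * A) * (∫ x, tailCut p r x ^ 2 * ‖u x‖ ^ 2)
      ≤ (2 * G + 2 * A * ∫ z, lneg z ^ 2) * massOut u p (2 * r) := by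
  set ψ := tailCut p r with hψ
  have hu := h.sub.magH1
  have ha := h.sub.pos
  have haA := h.sub.lt.le
  have hA := h.sub.A_pos
  have hD := h.four_pos
  have hG0 : 0 ≤ G := (gradSqR_nonneg _ _).trans (hG 0)
  have hψd : Differentiable ℝ ψ := differentiable_tailCut p r
  have hder : ∀ x, HasDerivAt (fun t : ℝ => t ^ 2) (2 * ψ x) (ψ x) := fun x => by
    simpa using hasDerivAt_pow 2 (ψ x)
  have hgr : ∀ x, gradSqR (fun y => ψ y ^ 2) x ≤ 4 * G := fun x => by
    rw [gradSqR_comp (hder x) (hψd x)]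
    have h1 := tailCut_sq_le_one p r x
    have h2 := hG x
    have h3 := gradSqR_nonneg ψ x
    calc (2 * ψ x) ^ 2 * gradSqR ψ x = 4 * (ψ x ^ 2 * gradSqR ψ x) := by ring
      _ ≤ 4 * (1 * G) := by gcongr
      _ = _ := by ring
  have hv := h.sub.variation h.energy (φ := fun y => ψ y ^ 2) (hψd.pow 2) (fun x => sq_nonneg _)
    (tailCut_sq_le_one p r) hgr
  have hJ0 : 0 ≤ ∫ x, ψ x ^ 2 * ‖u x‖ ^ 2 := integral_nonneg fun x => by positivity
  have h1 : 0 ≤ ∫ x, ψ x ^ 2 * ((V x - Ω ^ 2 / 4 * ‖x‖ ^ 2) * ‖u x‖ ^ 2) :=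
    integral_nonneg fun x => mul_nonneg (sq_nonneg _) (mul_nonneg (h.sub.nonneg x) (by positivity))
  have hlog := logInt_ge (h.sub.dens.mul (c := fun y => ψ y ^ 2)
    (hψd.continuous.measurable.pow_const 2) (fun x => sq_nonneg _) (tailCut_sq_le_one p r))
    h.sub.dens (δ := 1 / (8 * A)) (by positivity)
  rw [SubMin.integral_sq_sq] at hlog
  have h4 := h.integral_tailCut_four_le hr hfar
  obtain ⟨hgi, hg⟩ := h.integral_gradSqR_tailCut_le hr hG
  have im := integrable_tailCut_sq_mul p r hu.int_mag
  have ic : Integrable (cr (fun y => ψ y ^ 2) u) := by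
    simpa using hu.int_cr (s := fun _ => 1) measurable_const (S := 1) (by simp) hgr
  have hcr : -(1 / 2 * (∫ x, ψ x ^ 2 * magSq Ω u x) + 2 * ∫ x, gradSqR ψ x * ‖u x‖ ^ 2)
      ≤ ∫ x, cr (fun y => ψ y ^ 2) u x := by
    rw [← integral_const_mul, ← integral_const_mul,
      ← integral_add (im.const_mul _) (hgi.const_mul _), ← integral_neg]
    refine integral_mono ((im.const_mul _).add (hgi.const_mul _)).neg ic fun x => ?_
    have e := cr_comp (u := u) (hder x) (hψd x)
    have := abs_cr_le Ω ψ u x (κ := 1 / 2) (by norm_num) (ψ x)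
    have h3 := neg_abs_le (ψ x * cr ψ u x)
    simp only
    rw [e]
    linarith
  have hm := h.integral_tailCut_le hr
  have hC0 : 0 ≤ ∫ z, lneg z ^ 2 := integral_nonneg fun z => sq_nonneg _
  have hm' : 2 * A * (∫ z, lneg z ^ 2) * (∫ x, ψ x ^ 2 * ‖u x‖ ^ 2)
      ≤ 2 * A * (∫ z, lneg z ^ 2) * massOut u p (2 * r) := by gcongr
  have hDa : (∫ x, ‖u x‖ ^ 4) / (2 * A) * (∫ x, ψ x ^ 2 * ‖u x‖ ^ 2)
      ≤ (∫ x, ‖u x‖ ^ 4) / (2 * a) * ∫ x, ψ x ^ 2 * ‖u x‖ ^ 2 := by gcongr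
  have e : ∀ J D C : ℝ, D / (2 * A) * J - D / (8 * A) * J
      - J * (1 / (8 * A) * D + (4 * (1 / (8 * A)))⁻¹ * C)
      = D / (4 * A) * J - 2 * A * C * J := fun J D C => by
    field_simp
    ring
  have e' := e (∫ x, ψ x ^ 2 * ‖u x‖ ^ 2) (∫ x, ‖u x‖ ^ 4) (∫ z, lneg z ^ 2)
  linarith

end Tail

/-- The translation by `p` together with the gauge phase that preserves the magnetic gradient. -/
def magTranslate (b : ℝ) (p : Plane) (w : Plane → ℂ) (x : Plane) : ℂ :=
  Complex.exp (((b / 2 * (p 1 * x 0 - p 0 * x 1) : ℝ) : ℂ) * Complex.I) * w (x + p)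

section MagTranslate

variable {b : ℝ} {p : Plane} {w : Plane → ℂ}

lemma norm_magTranslate (b : ℝ) (p : Plane) (w : Plane → ℂ) (x : Plane) :
    ‖magTranslate b p w x‖ = ‖w (x + p)‖ := by
  rw [magTranslate, norm_mul, Complex.norm_exp_ofReal_mul_I, one_mul]

lemma hasFDerivAt_magTranslate {x : Plane} (hw : DifferentiableAt ℝ w (x + p)) :
    HasFDerivAt (magTranslate b p w)
      (Complex.exp (((b / 2 * (p 1 * x 0 - p 0 * x 1) : ℝ) : ℂ) * Complex.I) •
        fderiv ℝ w (x + p)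
      + w (x + p) • (Complex.exp (((b / 2 * (p 1 * x 0 - p 0 * x 1) : ℝ) : ℂ) * Complex.I) •
        (Complex.ofRealCLM.comp ((b / 2) • (p 1 • (EuclideanSpace.proj 0 : Plane →L[ℝ] ℝ)
          - p 0 • (EuclideanSpace.proj 1 : Plane →L[ℝ] ℝ)))).smulRight Complex.I)) x := by
  have h1 : HasFDerivAt (fun x : Plane => b / 2 * (p 1 * x 0 - p 0 * x 1))
      ((b / 2) • (p 1 • (EuclideanSpace.proj 0 : Plane →L[ℝ] ℝ)
          - p 0 • (EuclideanSpace.proj 1 : Plane →L[ℝ] ℝ))) x :=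
    (((EuclideanSpace.proj 0 : Plane →L[ℝ] ℝ).hasFDerivAt.const_mul (p 1)).sub
      ((EuclideanSpace.proj 1 : Plane →L[ℝ] ℝ).hasFDerivAt.const_mul (p 0))).const_mul (b / 2)
  have h2 := ((Complex.ofRealCLM.hasFDerivAt.comp x h1).smul_const Complex.I).cexp
  have h3 : HasFDerivAt (fun y => w (y + p)) (fderiv ℝ w (x + p)) x := by
    exact (hw.hasFDerivAt.comp x ((hasFDerivAt_id (𝕜 := ℝ) x).add_const p)).congr_fderiv
      (ContinuousLinearMap.comp_id _)
  exact h2.mul h3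

lemma differentiable_magTranslate (hw : Differentiable ℝ w) :
    Differentiable ℝ (magTranslate b p w) := fun x =>
  (hasFDerivAt_magTranslate (hw (x + p))).differentiableAt

lemma magSq_magTranslate (hw : Differentiable ℝ w) (x : Plane) :
    magSq b (magTranslate b p w) x = magSq b w (x + p) := by
  have hd := hasFDerivAt_magTranslate (b := b) (hw (x + p))
  have hn : ∀ Z : ℂ, ‖Complex.exp (((b / 2 * (p 1 * x 0 - p 0 * x 1) : ℝ) : ℂ) * Complex.I) * Z‖
      = ‖Z‖ := fun Z => by rw [norm_mul, Complex.norm_exp_ofReal_mul_I, one_mul]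
  unfold magSq
  congr 2
  · rw [← hn (d0 w (x + p) + _)]
    congr 1
    unfold d0
    rw [hd.fderiv]
    simp [magTranslate]
    ring
  · rw [← hn (d1 w (x + p) - _)]
    congr 1
    unfold d1
    rw [hd.fderiv]
    simp [magTranslate]
    ring

lemma MagH1.magTranslate (hw : MagH1 b w) : MagH1 b (magTranslate b p w) := by
  refine ⟨differentiable_magTranslate hw.diff, ?_, ?_⟩
  · simp_rw [norm_magTranslate]
    exact hw.int.comp_add_right p
  · have e : magSq b (_root_.magTranslate b p w) = fun x => magSq b w (x + p) :=
      funext (magSq_magTranslate hw.diff)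
    rw [e]
    exact hw.int_mag.comp_add_right p

lemma integral_norm_pow_magTranslate (b : ℝ) (p : Plane) (w : Plane → ℂ) (k : ℕ) :
    ∫ x, ‖magTranslate b p w x‖ ^ k = ∫ x, ‖w x‖ ^ k := by
  simp_rw [norm_magTranslate]
  exact integral_add_right_eq_self (fun x => ‖w x‖ ^ k) p

lemma integral_magSq_magTranslate (hw : Differentiable ℝ w) :
    ∫ x, magSq b (magTranslate b p w) x = ∫ x, magSq b w x := by
  simp_rw [magSq_magTranslate hw]
  exact integral_add_right_eq_self (magSq b w) p

lemma logConv_magTranslate (b : ℝ) (p : Plane) (w : Plane → ℂ) :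
    logConv (magTranslate b p w) = logConv w := by
  unfold logConv
  simp_rw [norm_magTranslate]
  rw [← integral_add_right_eq_self
    (fun x => ∫ y : Plane, Real.log ‖x - y‖ * ‖w x‖ ^ 2 * ‖w y‖ ^ 2) p]
  refine integral_congr_ae (Eventually.of_forall fun x => ?_)
  simp only
  rw [← integral_add_right_eq_self
    (fun y => Real.log ‖x + p - y‖ * ‖w (x + p)‖ ^ 2 * ‖w y‖ ^ 2) p]
  simp

end MagTranslate

section Core

variable {V : Plane → ℝ} {Ω A a : ℝ} {u : Plane → ℂ} {p : Plane} {r : ℝ}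

/-- Cutoff equal to one on the ball of radius `3 * r` and vanishing outside radius `4 * r`. -/
def coreCut (p : Plane) (r : ℝ) (x : Plane) : ℝ := 1 - cut p ((3 * r) ^ 2) ((4 * r) ^ 2) x

lemma coreCut_lt (hr : 0 < r) : (3 * r) ^ 2 < (4 * r) ^ 2 := by nlinarith [sq_pos_of_pos hr]

lemma coreCut_nonneg (p : Plane) (r : ℝ) (x : Plane) : 0 ≤ coreCut p r x :=
  sub_nonneg.2 (cut_le_one _ _ _ _)

lemma coreCut_le_one (p : Plane) (r : ℝ) (x : Plane) : coreCut p r x ≤ 1 :=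
  sub_le_self _ (cut_nonneg _ _ _ _)

lemma abs_coreCut_le_one (p : Plane) (r : ℝ) (x : Plane) : |coreCut p r x| ≤ 1 := by
  rw [abs_of_nonneg (coreCut_nonneg p r x)]
  exact coreCut_le_one p r x

lemma differentiable_coreCut (p : Plane) (r : ℝ) : Differentiable ℝ (coreCut p r) :=
  (differentiable_cut _ _ _).const_sub 1

lemma coreCut_eq_zero (hr : 0 < r) {x : Plane} (hx : 4 * r ≤ ‖x - p‖) : coreCut p r x = 0 := by
  rw [coreCut, cut_eq_one (coreCut_lt hr) (by gcongr), sub_self]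

lemma coreCut_eq_one (hr : 0 < r) {x : Plane} (hx : ‖x - p‖ ^ 2 ≤ (3 * r) ^ 2) :
    coreCut p r x = 1 := by
  rw [coreCut, cut_eq_zero (coreCut_lt hr) hx, sub_zero]

lemma gradSqR_coreCut (p : Plane) (r : ℝ) (x : Plane) :
    gradSqR (coreCut p r) x = gradSqR (cut p ((3 * r) ^ 2) ((4 * r) ^ 2)) x := by
  have := gradSqR_comp (g := fun t => 1 - t) (g' := -1) (x := x)
    (by simpa using (hasDerivAt_id (cut p ((3 * r) ^ 2) ((4 * r) ^ 2) x)).const_sub 1)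
    (differentiable_cut p ((3 * r) ^ 2) ((4 * r) ^ 2) x)
  rw [neg_one_sq, one_mul] at this
  exact this

lemma exists_gradSqR_coreCut_le (hr : 0 < r) : ∃ G, ∀ p x, gradSqR (coreCut p r) x ≤ G := by
  obtain ⟨B, -, hB⟩ := smoothTransition_deriv_bound
  exact ⟨_, fun p x => (gradSqR_coreCut p r x).trans_le
    (gradSqR_cut_le hB p (by positivity) (coreCut_lt hr) x)⟩

/-- Either the core cutoff is locally constant at `x`, or the tail cutoff equals one. -/
lemma coreCut_or_tailCut (hr : 0 < r) (p x : Plane) :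
    (coreCut p r x = 1 ∧ gradSqR (coreCut p r) x = 0) ∨ tailCut p r x = 1 := by
  rcases le_total (‖x - p‖ ^ 2) ((3 * r) ^ 2) with hx | hx
  · exact Or.inl ⟨coreCut_eq_one hr hx, (gradSqR_coreCut p r x).trans
      (gradSqR_cut_eq_zero (coreCut_lt hr) (Or.inl hx))⟩
  · exact Or.inr (tailCut_eq_one hr hx)

lemma one_sub_coreCut_pow_le (hr : 0 < r) (p x : Plane) (k : ℕ) :
    1 - coreCut p r x ^ k ≤ tailCut p r x ^ 2 := by
  rcases coreCut_or_tailCut hr p x with ⟨h, -⟩ | h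
  · rw [h, one_pow, sub_self]
    positivity
  · rw [h, one_pow]
    exact sub_le_self _ (pow_nonneg (coreCut_nonneg p r x) k)

lemma magSq_coreCut_le (b : ℝ) {u : Plane → ℂ} (hu : Differentiable ℝ u) (hr : 0 < r) {G : ℝ}
    (p x : Plane) (hG : gradSqR (coreCut p r) x ≤ G) :
    magSq b (fun y => coreCut p r y • u y) x
      ≤ magSq b u x + tailCut p r x ^ 2 * magSq b u x
        + 2 * G * (tailCut p r x ^ 2 * ‖u x‖ ^ 2) := by
  have hM := magSq_nonneg b u x
  have h1 : coreCut p r x ^ 2 ≤ 1 := pow_le_one₀ (coreCut_nonneg p r x) (coreCut_le_one p r x)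
  have h2 := mul_le_of_le_one_left hM h1
  rw [magSq_smul b (differentiable_coreCut p r x) (hu x)]
  rcases coreCut_or_tailCut hr p x with ⟨-, h⟩ | h
  · have hG0 : 0 ≤ G := (gradSqR_nonneg _ _).trans hG
    rw [cr_eq_zero h, h]
    have : 0 ≤ tailCut p r x ^ 2 * magSq b u x + 2 * G * (tailCut p r x ^ 2 * ‖u x‖ ^ 2) := by
      positivity
    linarith
  · have h3 := abs_cr_le b (coreCut p r) u x one_pos (coreCut p r x)
    have h4 := le_abs_self (coreCut p r x * cr (coreCut p r) u x)
    have h5 : gradSqR (coreCut p r) x * ‖u x‖ ^ 2 ≤ G * ‖u x‖ ^ 2 := by gcongr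
    rw [inv_one] at h3
    rw [h]
    linarith

lemma integrable_coreCut_pow_mul (p : Plane) (r : ℝ) (k : ℕ) {f : Plane → ℝ}
    (hf : Integrable f) : Integrable fun x => coreCut p r x ^ k * f x :=
  integrable_bdd_mul hf ((differentiable_coreCut p r).continuous.measurable.pow_const k) (C := 1)
    fun x => by
      rw [abs_of_nonneg (pow_nonneg (coreCut_nonneg p r x) k)]
      exact pow_le_one₀ (coreCut_nonneg p r x) (coreCut_le_one p r x)

lemma integral_sub_coreCut_le (hr : 0 < r) (p : Plane) (k : ℕ) {f : Plane → ℝ}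
    (hf : Integrable f) (h0 : ∀ x, 0 ≤ f x) :
    (∫ x, f x) - ∫ x, coreCut p r x ^ k * f x ≤ ∫ x, tailCut p r x ^ 2 * f x := by
  rw [← integral_sub hf (integrable_coreCut_pow_mul p r k hf)]
  refine integral_mono (hf.sub (integrable_coreCut_pow_mul p r k hf))
    (integrable_tailCut_sq_mul p r hf) fun x => ?_
  have := mul_le_mul_of_nonneg_right (one_sub_coreCut_pow_le hr p x k) (h0 x)
  simp only
  linarith

lemma integral_coreCut_pow_mul_le (p : Plane) (r : ℝ) (k : ℕ) {f : Plane → ℝ}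
    (hf : Integrable f) (h0 : ∀ x, 0 ≤ f x) :
    ∫ x, coreCut p r x ^ k * f x ≤ ∫ x, f x :=
  integral_mono (integrable_coreCut_pow_mul p r k hf) hf fun x =>
    mul_le_of_le_one_left (h0 x) (pow_le_one₀ (coreCut_nonneg p r x) (coreCut_le_one p r x))

lemma SubMin.magH1_coreCut (h : SubMin V Ω A a u) (hr : 0 < r) :
    MagH1 Ω fun x => coreCut p r x • u x := by
  obtain ⟨G, hG⟩ := exists_gradSqR_coreCut_le hr
  exact h.magH1.smul (differentiable_coreCut p r) (abs_coreCut_le_one p r) (hG p)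

lemma SubMin.mag_coreCut_le (h : SubMin V Ω A a u) (hr : 0 < r) {G : ℝ}
    (hG : ∀ x, gradSqR (coreCut p r) x ≤ G) :
    ∫ x, magSq Ω (fun y => coreCut p r y • u y) x
      ≤ (∫ x, magSq Ω u x) + (∫ x, tailCut p r x ^ 2 * magSq Ω u x)
        + 2 * G * ∫ x, tailCut p r x ^ 2 * ‖u x‖ ^ 2 := by
  have hu := h.magH1
  have i1 := integrable_tailCut_sq_mul p r hu.int_mag
  have i2 := (integrable_tailCut_sq_mul p r hu.int).const_mul (2 * G)
  rw [← integral_const_mul, ← integral_add_three hu.int_mag i1 i2]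
  exact integral_mono (h.magH1_coreCut hr).int_mag ((hu.int_mag.add i1).add i2) fun x =>
    magSq_coreCut_le Ω hu.diff hr p x (hG x)

lemma norm_coreCut_smul_sq (p : Plane) (r : ℝ) (u : Plane → ℂ) :
    (fun x => ‖coreCut p r x • u x‖ ^ 2) = fun x => coreCut p r x ^ 2 * ‖u x‖ ^ 2 :=
  funext fun _ => norm_real_smul_sq _ _

lemma SubMin.dens_coreCut (h : SubMin V Ω A a u) :
    Dens fun x => coreCut p r x ^ 2 * ‖u x‖ ^ 2 :=
  h.dens.mul (C := 1) ((differentiable_coreCut p r).continuous.measurable.pow_const 2)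
    (fun _ => sq_nonneg _) fun x => pow_le_one₀ (coreCut_nonneg p r x) (coreCut_le_one p r x)

lemma SubMin.logConv_coreCut (h : SubMin V Ω A a u) :
    logConv (fun x => coreCut p r x • u x)
      = logInt (fun x => coreCut p r x ^ 2 * ‖u x‖ ^ 2) fun x => coreCut p r x ^ 2 * ‖u x‖ ^ 2 := by
  rw [logConv_eq (by rw [norm_coreCut_smul_sq]; exact h.dens_coreCut), norm_coreCut_smul_sq]

lemma SubMin.logConv_coreCut_nonpos (h : SubMin V Ω A a u) (hr : 0 < r) (hr8 : r ≤ 1 / 8) :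
    logConv (fun x => coreCut p r x • u x) ≤ 0 := by
  rw [h.logConv_coreCut]
  refine logInt_nonpos h.dens_coreCut.nonneg p fun x hx => ?_
  by_contra hc
  exact hx (by rw [coreCut_eq_zero hr (by linarith)]; ring)

lemma SubMin.logConv_coreCut_le (h : SubMin V Ω A a u) (hr : 0 < r) :
    logConv (fun x => coreCut p r x • u x) - logConv u
      ≤ 2 * ((∫ x, tailCut p r x ^ 2 * ‖u x‖ ^ 2)
        * ((∫ x, ‖u x‖ ^ 4) + 1 / 4 * ∫ z, lneg z ^ 2)) := by
  have hc := h.dens_coreCut (p := p) (r := r)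
  have h1c : ∀ x, coreCut p r x ^ 2 ≤ 1 := fun x =>
    pow_le_one₀ (coreCut_nonneg p r x) (coreCut_le_one p r x)
  have hq : Dens fun x => (1 - coreCut p r x ^ 2) * ‖u x‖ ^ 2 :=
    h.dens.mul (C := 1)
      (((differentiable_coreCut p r).continuous.measurable.pow_const 2).const_sub 1)
      (fun x => sub_nonneg.2 (h1c x)) fun x => sub_le_self _ (sq_nonneg _)
  have hs : (fun x => ‖u x‖ ^ 2)
      = fun x => coreCut p r x ^ 2 * ‖u x‖ ^ 2 + (1 - coreCut p r x ^ 2) * ‖u x‖ ^ 2 := by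
    funext x; ring
  have e : logConv u = logInt (fun x => coreCut p r x ^ 2 * ‖u x‖ ^ 2)
        (fun x => coreCut p r x ^ 2 * ‖u x‖ ^ 2)
      + logInt (fun x => (1 - coreCut p r x ^ 2) * ‖u x‖ ^ 2)
        (fun x => coreCut p r x ^ 2 * ‖u x‖ ^ 2)
      + logInt (fun x => (1 - coreCut p r x ^ 2) * ‖u x‖ ^ 2) (fun x => ‖u x‖ ^ 2) := by
    have e1 := logInt_add_left hc hq h.dens
    have e2 := logInt_add_left hc hq hc
    rw [← hs] at e1 e2
    rw [h.logConv_eq', e1, logInt_comm (fun x => coreCut p r x ^ 2 * ‖u x‖ ^ 2), e2]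
  have g1 := logInt_ge hq h.dens one_pos
  have g2 := logInt_ge hq hc one_pos
  have hJ : ∫ x, (1 - coreCut p r x ^ 2) * ‖u x‖ ^ 2 ≤ ∫ x, tailCut p r x ^ 2 * ‖u x‖ ^ 2 :=
    integral_mono hq.int (integrable_tailCut_sq_mul p r h.dens.int) fun x =>
      mul_le_mul_of_nonneg_right (one_sub_coreCut_pow_le hr p x 2) (sq_nonneg _)
  have hD : ∫ x, (coreCut p r x ^ 2 * ‖u x‖ ^ 2) ^ 2 ≤ ∫ x, ‖u x‖ ^ 4 := by
    rw [← SubMin.integral_sq_sq]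
    refine integral_mono hc.int_sq h.dens.int_sq fun x => ?_
    have := mul_le_of_le_one_left (sq_nonneg ‖u x‖) (h1c x)
    exact pow_le_pow_left₀ (by positivity) this 2
  have hq0 : 0 ≤ ∫ x, (1 - coreCut p r x ^ 2) * ‖u x‖ ^ 2 := integral_nonneg hq.nonneg
  have hC0 : 0 ≤ ∫ z, lneg z ^ 2 := integral_nonneg fun z => sq_nonneg _
  have hD0 := SubMin.four_nonneg u
  rw [SubMin.integral_sq_sq] at g1
  rw [h.logConv_coreCut, e]
  have k1 : (∫ x, (1 - coreCut p r x ^ 2) * ‖u x‖ ^ 2)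
        * (1 * (∫ x, ‖u x‖ ^ 4) + (4 * 1)⁻¹ * ∫ z, lneg z ^ 2)
      ≤ (∫ x, tailCut p r x ^ 2 * ‖u x‖ ^ 2)
        * ((∫ x, ‖u x‖ ^ 4) + 1 / 4 * ∫ z, lneg z ^ 2) := by
    refine mul_le_mul hJ (by norm_num) (by positivity) (hq0.trans hJ)
  have k2 : (∫ x, (1 - coreCut p r x ^ 2) * ‖u x‖ ^ 2)
        * (1 * (∫ x, (coreCut p r x ^ 2 * ‖u x‖ ^ 2) ^ 2) + (4 * 1)⁻¹ * ∫ z, lneg z ^ 2)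
      ≤ (∫ x, (1 - coreCut p r x ^ 2) * ‖u x‖ ^ 2)
        * (1 * (∫ x, ‖u x‖ ^ 4) + (4 * 1)⁻¹ * ∫ z, lneg z ^ 2) := by
    gcongr
  linarith

end Core

section CoreComparison

variable {V : Plane → ℝ} {Ω A a : ℝ} {u : Plane → ℂ} {p : Plane} {r S : ℝ}

/-- The part of `u` near `p`, moved to the origin by a magnetic translation. -/
def centeredCore (Ω : ℝ) (p : Plane) (r : ℝ) (u : Plane → ℂ) : Plane → ℂ :=
  magTranslate Ω p fun x => coreCut p r x • u x

lemma centeredCore_eq_zero (Ω : ℝ) (p : Plane) (hr : 0 < r) (u : Plane → ℂ) {x : Plane}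
    (hx : 4 * r ≤ ‖x‖) : centeredCore Ω p r u x = 0 := by
  rw [← norm_eq_zero, centeredCore, norm_magTranslate, coreCut_eq_zero hr (by simpa using hx),
    zero_smul, norm_zero]

lemma SubMin.magH1_centeredCore (h : SubMin V Ω A a u) (hr : 0 < r) :
    MagH1 Ω (centeredCore Ω p r u) := (h.magH1_coreCut hr).magTranslate

lemma SubMin.inH_centeredCore (h : SubMin V Ω A a u) (hr : 0 < r)
    (hS : ∀ x : Plane, ‖x‖ ≤ 4 * r → V x - Ω ^ 2 / 4 * ‖x‖ ^ 2 ≤ S) :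
    InH V (centeredCore Ω p r u) := by
  have hw := h.magH1_centeredCore (p := p) hr
  refine hw.inH h.Ω_pos h.nonneg ?_
  refine (hw.int.const_mul (S + Ω ^ 2 / 4 * (4 * r) ^ 2)).mono'
    (h.meas.mul (hw.diff.continuous.norm.measurable.pow_const 2)).aestronglyMeasurable
    (Eventually.of_forall fun x => ?_)
  have h0 : 0 ≤ V x := by
    have := h.nonneg x
    have : 0 ≤ Ω ^ 2 / 4 * ‖x‖ ^ 2 := by positivity
    linarith
  rw [Real.norm_of_nonneg (by positivity)]
  rcases le_total (4 * r) ‖x‖ with hx | hx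
  · simp [centeredCore_eq_zero Ω p hr u hx]
  · have h1 := hS x hx
    have h2 : Ω ^ 2 / 4 * ‖x‖ ^ 2 ≤ Ω ^ 2 / 4 * (4 * r) ^ 2 := by gcongr
    exact mul_le_mul_of_nonneg_right (by linarith) (sq_nonneg _)

lemma SubMin.pot_centeredCore_le (h : SubMin V Ω A a u) (hr : 0 < r)
    (hS : ∀ x : Plane, ‖x‖ ≤ 4 * r → V x - Ω ^ 2 / 4 * ‖x‖ ^ 2 ≤ S) :
    pot V Ω (centeredCore Ω p r u) ≤ S * ∫ x, ‖centeredCore Ω p r u x‖ ^ 2 := by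
  have hw := h.magH1_centeredCore (p := p) hr
  rw [pot, ← integral_const_mul]
  refine integral_mono_of_nonneg
    (Eventually.of_forall fun x => mul_nonneg (h.nonneg x) (sq_nonneg _)) (hw.int.const_mul S)
    (Eventually.of_forall fun x => ?_)
  rcases le_total (4 * r) ‖x‖ with hx | hx
  · simp [centeredCore_eq_zero Ω p hr u hx]
  · exact mul_le_mul_of_nonneg_right (hS x hx) (sq_nonneg _)

lemma core_comparison_arith {A a N T P L D T' P' L' D' J M m S G c C t : ℝ} (hA : 0 < A)
    (ha : 1 / 4 ≤ a) (haA : a ≤ A) (hN : a - J ≤ N) (hNa : N ≤ a)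
    (hJ0 : 0 ≤ J) (hJm : J ≤ m) (hm : m ≤ 1 / 8) (hT0 : 0 ≤ T) (hG : 0 ≤ G) (hC : 0 ≤ C)
    (hM0 : 0 ≤ M)
    (ht : t = a / N) (hS : 0 ≤ S)
    (htest : T + P + 1 / 2 * L - 1 / 2 * D ≤ t * (T' + P') + 1 / 2 * t ^ 2 * (L' - D'))
    (hT' : T' ≤ T + M + 2 * G * J) (hP' : P' ≤ S * N) (hL' : L' ≤ 0)
    (hLL : L' - L ≤ 2 * (J * (D + 1 / 4 * C))) (hD'0 : 0 ≤ D')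
    (hDD : D - D' ≤ D / (8 * A) * J)
    (hT : T ≤ 1 / 2 * D + 1 / 2 * A * (D + 1 / 4 * C))
    (hM : M ≤ 2 * (c * m)) (hDJ : D * J ≤ 4 * A * (c * m)) :
    P ≤ A * S + (8 * ((1 / 2 + 1 / 2 * A) * (4 * A * c) + A * C / 8) + 4 * (c + G)
      + 4 * A * c + C / 4 + c / 4) * m := by
  have hNpos : 0 < N := by linarith
  have htN : t * N = a := by rw [ht]; field_simp
  have ht1 : 1 ≤ t := by rw [ht, le_div_iff₀ hNpos]; linarith
  have ht2 : t - 1 ≤ 8 * J := by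
    rw [ht, sub_le_iff_le_add, div_le_iff₀ hNpos]
    nlinarith
  have htt : t ≤ 2 := by linarith
  have ht0 : 0 ≤ t := by linarith
  have ht21 : 1 ≤ t ^ 2 := one_le_pow₀ ht1
  have k1 : t * P' ≤ A * S := by
    calc t * P' ≤ t * (S * N) := by gcongr
      _ = a * S := by rw [← htN]; ring
      _ ≤ A * S := by gcongr
  have k2 : t ^ 2 * (L' - D') ≤ L' - D' := by nlinarith
  have k3 : t * T' ≤ t * (T + M + 2 * G * J) := by gcongr
  have k4 : (t - 1) * T ≤ 8 * J * T := by gcongr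
  have k5 : t * (M + 2 * G * J) ≤ 2 * (2 * (c * m) + 2 * G * m) := by gcongr
  have k6 : J * T ≤ J * (1 / 2 * D + 1 / 2 * A * (D + 1 / 4 * C)) := by gcongr
  have k7 : D / (8 * A) * J ≤ 1 / 2 * (c * m) := by
    rw [div_mul_eq_mul_div, div_le_iff₀ (by positivity)]
    linarith
  have k8 : A * C / 8 * J ≤ A * C / 8 * m := by gcongr
  have k9 : (1 / 2 + 1 / 2 * A) * (D * J) ≤ (1 / 2 + 1 / 2 * A) * (4 * A * (c * m)) := by gcongr
  have k10 : C / 4 * J ≤ C / 4 * m := by gcongr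
  linarith

lemma Peak.quarter_le_mass (h : Peak V Ω A a u p) (hr : 0 < r)
    (hD : 4 * A ^ 2 / r ^ 2 ≤ ∫ x, ‖u x‖ ^ 4) : 1 / 4 + massOut u p r ≤ a := by
  have h1 := h.massOut_le_sub hr
  have hD0 := h.four_pos
  have h2 : A ^ 2 / ((∫ x, ‖u x‖ ^ 4) * r ^ 2) ≤ 1 / 4 := by
    rw [div_le_iff₀ (by positivity)] at hD ⊢
    linarith
  linarith

/-- Comparison of the minimizer with its centered core. -/
lemma Peak.pot_le (h : Peak V Ω A a u p) (hr : 0 < r) (hr8 : r ≤ 1 / 8) {G G' : ℝ}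
    (hG : ∀ x, gradSqR (tailCut p r) x ≤ G) (hG' : ∀ x, gradSqR (coreCut p r) x ≤ G')
    (hfar : ∀ x, 2 * r ≤ ‖x - p‖ → ‖u x‖ ^ 2 ≤ (∫ x, ‖u x‖ ^ 4) / (8 * A))
    (hm : massOut u p (2 * r) ≤ 1 / 8) (ha : 1 / 4 ≤ a)
    (hS : ∀ x : Plane, ‖x‖ ≤ 4 * r → V x - Ω ^ 2 / 4 * ‖x‖ ^ 2 ≤ S) :
    pot V Ω u ≤ A * S
      + (8 * ((1 / 2 + 1 / 2 * A) * (4 * A * (2 * G + 2 * A * ∫ z, lneg z ^ 2))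
          + A * (∫ z, lneg z ^ 2) / 8)
        + 4 * ((2 * G + 2 * A * ∫ z, lneg z ^ 2) + G')
        + 4 * A * (2 * G + 2 * A * ∫ z, lneg z ^ 2) + (∫ z, lneg z ^ 2) / 4
        + (2 * G + 2 * A * ∫ z, lneg z ^ 2) / 4) * massOut u p (2 * r) := by
  have hs := h.sub
  have hn := hs.magH1.int
  have hA := hs.A_pos
  have hD := h.four_pos
  have hC0 : 0 ≤ ∫ z, lneg z ^ 2 := integral_nonneg fun z => sq_nonneg _
  have hG0 : 0 ≤ G := (gradSqR_nonneg _ _).trans (hG 0)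
  have hG'0 : 0 ≤ G' := (gradSqR_nonneg _ _).trans (hG' 0)
  have hS0 : 0 ≤ S := (hs.nonneg 0).trans (hS 0 (by simpa using hr.le))
  have htail := h.tail_le hr hG hfar
  have hJm := h.integral_tailCut_le hr
  have hJ0 : 0 ≤ ∫ x, tailCut p r x ^ 2 * ‖u x‖ ^ 2 := integral_nonneg fun x => by positivity
  have hM0 : 0 ≤ ∫ x, tailCut p r x ^ 2 * magSq Ω u x :=
    integral_nonneg fun x => mul_nonneg (sq_nonneg _) (magSq_nonneg _ _ _)
  have hDJ0 : 0 ≤ (∫ x, ‖u x‖ ^ 4) / (4 * A) * ∫ x, tailCut p r x ^ 2 * ‖u x‖ ^ 2 := by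
    positivity
  have hmass : ∫ x, ‖centeredCore Ω p r u x‖ ^ 2 = ∫ x, coreCut p r x ^ 2 * ‖u x‖ ^ 2 := by
    rw [centeredCore, integral_norm_pow_magTranslate, norm_coreCut_smul_sq]
  have hfour : ∫ x, ‖centeredCore Ω p r u x‖ ^ 4 = ∫ x, coreCut p r x ^ 4 * ‖u x‖ ^ 4 := by
    rw [centeredCore, integral_norm_pow_magTranslate]
    simp_rw [norm_real_smul_four]
  have hN := integral_sub_coreCut_le hr p 2 hn fun x => sq_nonneg _
  have hNa := integral_coreCut_pow_mul_le p r 2 hn fun x => sq_nonneg _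
  have hDD := integral_sub_coreCut_le hr p 4 hs.int_four fun x => by positivity
  have hDJ := h.integral_tailCut_four_le hr hfar
  rw [hs.mass] at hN hNa
  have htest := hs.test (hs.inH_centeredCore (p := p) hr hS) (by rw [hmass]; linarith)
  rw [hs.energy_eq] at htest
  have hPw := hs.pot_centeredCore_le (p := p) hr hS
  rw [hmass] at hPw htest
  rw [hfour] at htest
  have hTw : ∫ x, magSq Ω (centeredCore Ω p r u) x
      = ∫ x, magSq Ω (fun y => coreCut p r y • u y) x :=
    integral_magSq_magTranslate (hs.magH1_coreCut hr).diff
  have hLw : logConv (centeredCore Ω p r u) = logConv fun x => coreCut p r x • u x :=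
    logConv_magTranslate _ _ _
  rw [hTw, hLw] at htest
  refine core_comparison_arith hA ha hs.lt.le (by linarith) hNa hJ0 hJm hm
    (SubMin.mag_nonneg Ω u) hG'0 hC0 hM0 rfl hS0 htest
    (hs.mag_coreCut_le hr hG') hPw (hs.logConv_coreCut_nonpos hr hr8) (hs.logConv_coreCut_le hr)
    (integral_nonneg fun x => mul_nonneg (pow_nonneg (coreCut_nonneg p r x) 4) (by positivity))
    (hDD.trans hDJ) (hs.mag_le h.energy) (by linarith) ?_
  have : (∫ x, ‖u x‖ ^ 4) / (4 * A) * (∫ x, tailCut p r x ^ 2 * ‖u x‖ ^ 2)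
      ≤ (2 * G + 2 * A * ∫ z, lneg z ^ 2) * massOut u p (2 * r) := by linarith
  rw [div_mul_eq_mul_div, div_le_iff₀ (by positivity)] at this
  linarith

end CoreComparison

section Localization

variable {V : Plane → ℝ} {Ω A : ℝ}

lemma exists_pot_le (hA : 0 < A)
    (hV : ∀ ε > 0, ∃ δ > 0, ∀ x : Plane, ‖x‖ ≤ δ → V x - Ω ^ 2 / 4 * ‖x‖ ^ 2 ≤ ε)
    {η : ℝ} (hη : 0 < η) :
    ∃ K, ∀ a u p, Peak V Ω A a u p → K ≤ ∫ x, ‖u x‖ ^ 4 → pot V Ω u ≤ η := by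
  obtain ⟨δ, hδ, hδV⟩ := hV (η / (2 * A)) (by positivity)
  set r : ℝ := min (1 / 8) (δ / 4) with hr_def
  have hr : 0 < r := lt_min (by norm_num) (by positivity)
  have hr8 : r ≤ 1 / 8 := min_le_left _ _
  have hrδ : 4 * r ≤ δ := by linarith [min_le_right (1 / 8 : ℝ) (δ / 4)]
  obtain ⟨G, hG⟩ := exists_gradSqR_tailCut_le hr
  obtain ⟨G', hG'⟩ := exists_gradSqR_coreCut_le hr
  set C : ℝ := 8 * ((1 / 2 + 1 / 2 * A) * (4 * A * (2 * G + 2 * A * ∫ z, lneg z ^ 2))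
          + A * (∫ z, lneg z ^ 2) / 8)
        + 4 * ((2 * G + 2 * A * ∫ z, lneg z ^ 2) + G')
        + 4 * A * (2 * G + 2 * A * ∫ z, lneg z ^ 2) + (∫ z, lneg z ^ 2) / 4
        + (2 * G + 2 * A * ∫ z, lneg z ^ 2) / 4 with hC
  have hC1 : 0 < |C| + 1 := by positivity
  obtain ⟨K₁, hK₁⟩ := exists_massOut_le V Ω hA (r := 2 * r)
    (δ := min (1 / 8) (η / (2 * (|C| + 1)))) (by positivity)
    (lt_min (by norm_num) (by positivity))
  obtain ⟨K₂, hK₂⟩ := exists_massOut_le V Ω hA (r := r) (δ := 1 / (256 * A)) hr (by positivity)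
  refine ⟨max (max K₁ K₂) (max (4 * A ^ 2 / r ^ 2) (256 * A ^ 3 / r ^ 2)), fun a u p h hK => ?_⟩
  simp only [max_le_iff] at hK
  obtain ⟨⟨h1, h2⟩, h3, h4⟩ := hK
  have hD := h.four_pos
  have hm := hK₁ a u p h h1
  have hm8 := hm.trans (min_le_left _ _)
  have hmη := hm.trans (min_le_right _ _)
  have hm0 := massOut_nonneg u p (2 * r)
  have ha := h.quarter_le_mass hr h3
  have hm0' := massOut_nonneg u p r
  have hfar : ∀ x, 2 * r ≤ ‖x - p‖ → ‖u x‖ ^ 2 ≤ (∫ x, ‖u x‖ ^ 4) / (8 * A) := fun x hx => by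
    refine (h.normSq_far hr hx).trans ?_
    have e1 : A ^ 2 / ((∫ x, ‖u x‖ ^ 4) * r ^ 2) ≤ 1 / (256 * A) := by
      rw [div_le_iff₀ (by positivity)] at h4
      rw [div_le_div_iff₀ (by positivity) (by positivity)]
      linarith
    have e2 := hK₂ a u p h h2
    calc 16 * (∫ x, ‖u x‖ ^ 4) * (massOut u p r + A ^ 2 / ((∫ x, ‖u x‖ ^ 4) * r ^ 2))
        ≤ 16 * (∫ x, ‖u x‖ ^ 4) * (1 / (256 * A) + 1 / (256 * A)) := by gcongr
      _ = (∫ x, ‖u x‖ ^ 4) / (8 * A) := by ring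
  have key := h.pot_le hr hr8 (hG p) (hG' p) hfar hm8 (by linarith)
    fun x hx => hδV x (hx.trans hrδ)
  rw [← hC] at key
  have k1 : A * (η / (2 * A)) = η / 2 := by field_simp
  have k2 : C * massOut u p (2 * r) ≤ η / 2 := by
    calc C * massOut u p (2 * r) ≤ (|C| + 1) * (η / (2 * (|C| + 1))) :=
          mul_le_mul (by linarith [le_abs_self C]) hmη hm0 hC1.le
      _ = η / 2 := by field_simp
  linarith

/-- If the peak stays away from the origin, so does a fixed amount of potential energy. -/
lemma Peak.pot_ge {a r η : ℝ} {u : Plane → ℂ} {p : Plane} (h : Peak V Ω A a u p)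
    (hp : 2 * r ≤ ‖p‖) (hV : ∀ x : Plane, r ≤ ‖x‖ → η ≤ V x - Ω ^ 2 / 4 * ‖x‖ ^ 2) :
    η * (a - massOut u p r) ≤ pot V Ω u := by
  have hn := h.sub.magH1.int
  have hi := hn.indicator (measurableSet_ball (x := p) (ε := r)).compl
  rw [massOut_eq, ← h.sub.mass, ← integral_sub hn hi, ← integral_const_mul]
  refine integral_mono ((hn.sub hi).const_mul η) h.sub.int_potential fun x => ?_
  by_cases hx : x ∈ ball p r
  · simp only
    rw [indicator_of_notMem (by simpa using hx), sub_zero]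
    refine mul_le_mul_of_nonneg_right (hV x ?_) (sq_nonneg _)
    have h1 : ‖p - x‖ < r := by rwa [mem_ball', dist_eq_norm] at hx
    have h2 := norm_sub_norm_le p x
    linarith
  · simp only
    rw [indicator_of_mem (by simpa using hx), sub_self, mul_zero]
    exact mul_nonneg (h.sub.nonneg x) (sq_nonneg _)

lemma exists_norm_lt (hA : 0 < A)
    (hV : ∀ ε > 0, ∃ δ > 0, ∀ x : Plane, ‖x‖ ≤ δ → V x - Ω ^ 2 / 4 * ‖x‖ ^ 2 ≤ ε)
    (hpos : ∀ r > 0, ∃ η > 0, ∀ x : Plane, r ≤ ‖x‖ → η ≤ V x - Ω ^ 2 / 4 * ‖x‖ ^ 2)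
    {ε : ℝ} (hε : 0 < ε) :
    ∃ K, ∀ a u p, Peak V Ω A a u p → K ≤ ∫ x, ‖u x‖ ^ 4 → ‖p‖ < ε := by
  obtain ⟨η, hη, hηV⟩ := hpos (ε / 2) (by positivity)
  obtain ⟨K, hK⟩ := exists_pot_le hA hV (η := η / 8) (by positivity)
  refine ⟨max K (4 * A ^ 2 / (ε / 2) ^ 2), fun a u p h hD => ?_⟩
  by_contra! hc
  have h1 := hK a u p h ((le_max_left _ _).trans hD)
  have h2 := h.pot_ge (by linarith) hηV
  have h3 := h.quarter_le_mass (by positivity) ((le_max_right _ _).trans hD)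
  have h4 : η * (1 / 4) ≤ η * (a - massOut u p (ε / 2)) := by
    apply mul_le_mul_of_nonneg_left _ hη.le
    linarith
  linarith

end Localization

section CondV

variable {V : Plane → ℝ} {Ω α : ℝ}

lemma CondV.continuous (h : CondV V Ω α) :
    Continuous fun x : Plane => V x - Ω ^ 2 / 4 * ‖x‖ ^ 2 := by
  rw [continuous_iff_continuousAt]
  intro x
  obtain ⟨C, hC⟩ := h.2.2.2.1 (‖x‖ + 1) (by positivity)
  rw [ContinuousAt, tendsto_iff_norm_sub_tendsto_zero]
  have hlim : Tendsto (fun y => C * ‖y - x‖ ^ α) (𝓝 x) (𝓝 0) := by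
    have h1 : Continuous fun y : Plane => C * ‖y - x‖ ^ α :=
      ((continuous_id.sub continuous_const).norm.rpow_const fun _ => Or.inr h.1.1.le).const_mul C
    simpa [Real.zero_rpow h.1.1.ne'] using h1.tendsto x
  refine squeeze_zero' (Eventually.of_forall fun y => norm_nonneg _) ?_ hlim
  filter_upwards [ball_mem_nhds x one_pos] with y hy
  refine hC y ?_ x ?_
  · have h1 : ‖y - x‖ < 1 := by rwa [mem_ball, dist_eq_norm] at hy
    have h2 := norm_sub_norm_le y x
    rw [mem_closedBall_zero_iff]
    linarith
  · rw [mem_closedBall_zero_iff]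
    linarith

lemma CondV.exists_le (h : CondV V Ω α) {ε : ℝ} (hε : 0 < ε) :
    ∃ δ > 0, ∀ x : Plane, ‖x‖ ≤ δ → V x - Ω ^ 2 / 4 * ‖x‖ ^ 2 ≤ ε := by
  obtain ⟨δ, hδ, hb⟩ := Metric.continuous_iff.1 h.continuous 0 ε hε
  refine ⟨δ / 2, by positivity, fun x hx => ?_⟩
  have h1 := hb x (by rw [dist_zero_right]; linarith)
  rw [(h.2.2.1 0).2 rfl, dist_zero_right] at h1
  exact (le_abs_self _).trans h1.le

lemma CondV.exists_pos_le (h : CondV V Ω α) (hΩ : 0 < Ω) (hsub : SubCritical V Ω) {r : ℝ}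
    (hr : 0 < r) :
    ∃ η > 0, ∀ x : Plane, r ≤ ‖x‖ → η ≤ V x - Ω ^ 2 / 4 * ‖x‖ ^ 2 := by
  obtain ⟨W, ⟨-, hW⟩, hΩW⟩ := hsub
  obtain ⟨R, hR⟩ := hW 1
  have hpos : ∀ x : Plane, x ≠ 0 → 0 < V x - Ω ^ 2 / 4 * ‖x‖ ^ 2 := fun x hx =>
    (h.2.1 x).lt_of_ne fun e => hx ((h.2.2.1 x).1 e.symm)
  have hfar : ∀ x : Plane, R ≤ ‖x‖ → 1 ≤ V x - Ω ^ 2 / 4 * ‖x‖ ^ 2 := fun x hx => by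
    have h1 := hR x hx
    have h2 : Ω ^ 2 / 4 * ‖x‖ ^ 2 ≤ W ^ 2 / 4 * ‖x‖ ^ 2 := by gcongr
    linarith
  have hcpt : IsCompact (closedBall (0 : Plane) R \ ball 0 r) :=
    (isCompact_closedBall 0 R).diff isOpen_ball
  rcases (closedBall (0 : Plane) R \ ball 0 r).eq_empty_or_nonempty with he | hne
  · refine ⟨1, one_pos, fun x hx => hfar x ?_⟩
    by_contra! hc
    have : x ∈ closedBall (0 : Plane) R \ ball 0 r :=
      ⟨mem_closedBall_zero_iff.2 hc.le, fun hb => (mem_ball_zero_iff.1 hb).not_ge hx⟩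
    simp [he] at this
  · obtain ⟨y, hy, hmin⟩ := hcpt.exists_isMinOn hne h.continuous.continuousOn
    have hy0 : y ≠ 0 := by
      rintro rfl
      exact hy.2 (mem_ball_self hr)
    refine ⟨min 1 (V y - Ω ^ 2 / 4 * ‖y‖ ^ 2), lt_min one_pos (hpos y hy0), fun x hx => ?_⟩
    rcases le_total R ‖x‖ with hc | hc
    · exact (min_le_left _ _).trans (hfar x hc)
    · exact (min_le_right _ _).trans (hmin
        ⟨mem_closedBall_zero_iff.2 hc, fun hb => (mem_ball_zero_iff.1 hb).not_ge hx⟩)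

end CondV

lemma integral_groundState_pos {Q : Plane → ℝ} (hQ : IsGroundState Q) : 0 < ∫ x, Q x ^ 2 :=
  integral_pos_of_integrable_nonneg_nonzero (x := 0) (hQ.1.continuous.pow 2) hQ.2.2.2.1
    (fun _ => sq_nonneg _) (pow_ne_zero 2 (hQ.2.1 0).ne')

/-- Near the critical mass every minimizer is highly concentrated. -/
lemma eventually_peak {V : Plane → ℝ} {Ω A C γ : ℝ} {Q : Plane → ℝ} (hQ : IsGroundState Q)
    (hV : Trap V Ω C γ) (hA : A = ∫ x, Q x ^ 2) {u : ℝ → Plane → ℂ}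
    (hu : ∀ a ∈ Ioo (0 : ℝ) A, IsMinimizer V Ω a (u a)) {p : ℝ → Plane}
    (hp : ∀ a ∈ Ioo (0 : ℝ) A, ∀ y, ‖u a y‖ ≤ ‖u a (p a)‖) (K : ℝ) :
    ∀ᶠ a in 𝓝[<] A, Peak V Ω A a (u a) (p a) ∧ K ≤ ∫ x, ‖u a x‖ ^ 4 := by
  have hA0 : 0 < A := hA ▸ integral_groundState_pos hQ
  have hC0 : 0 ≤ ∫ z, lneg z ^ 2 := integral_nonneg fun z => sq_nonneg _
  set M : ℝ := max K (A * (A / 2 * ∫ z, lneg z ^ 2) + 1) with hM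
  have hM0 : 0 ≤ M := le_max_of_le_right (by positivity)
  filter_upwards [energy_atBot hQ hV hA hA0 hu
      (1 / 2 * A * (M + 1 / 4 * ∫ z, lneg z ^ 2)), Ioo_mem_nhdsLT hA0] with a hE ha
  have hs : SubMin V Ω A a (u a) :=
    ⟨hV.Ω_pos, hV.meas, hV.nonneg, ha.1, ha.2, gn_of_minimizers hV hA0 hu, hu a ha⟩
  have h1 := hs.energy_ge
  have hMD : M ≤ ∫ x, ‖u a x‖ ^ 4 := by
    by_contra! hc
    have : 1 / 2 * A * ((∫ x, ‖u a x‖ ^ 4) + 1 / 4 * ∫ z, lneg z ^ 2)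
        < 1 / 2 * A * (M + 1 / 4 * ∫ z, lneg z ^ 2) := by gcongr
    linarith
  have hneg : 0 ≤ 1 / 2 * A * (M + 1 / 4 * ∫ z, lneg z ^ 2) := by positivity
  exact ⟨⟨hs, by linarith, hp a ha, (le_max_right _ _).trans hMD⟩, (le_max_left _ _).trans hMD⟩

theorem concentration_point_to_zero
    (V : Plane → ℝ) (Ω α : ℝ) (Q : Plane → ℝ)
    (hV : V110 V) (hΩ : 0 < Ω) (hsub : SubCritical V Ω) (hCV : CondV V Ω α)
    (hQ : IsGroundState Q)
    (astar : ℝ) (hastar : astar = ∫ x : Plane, (Q x) ^ 2)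
    (u : ℝ → Plane → ℂ)
    (hmin : ∀ a ∈ Ioo (0 : ℝ) astar, IsMinimizer V Ω a (u a))
    (xa : ℝ → Plane)
    (hxa : ∀ a ∈ Ioo (0 : ℝ) astar, ∀ y : Plane, ‖u a y‖ ≤ ‖u a (xa a)‖) :
    (∃ R : ℝ, ∀ᶠ a in 𝓝[<] astar, ‖xa a‖ ≤ R) ∧
    Tendsto (fun a => V (xa a) - Ω ^ 2 / 4 * ‖xa a‖ ^ 2) (𝓝[<] astar) (𝓝 0) ∧
    Tendsto xa (𝓝[<] astar) (𝓝 0) := by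
  obtain ⟨C, γ, -, hexp⟩ := hCV.2.2.2.2
  have hT : Trap V Ω C γ := ⟨hV.1, hΩ, hCV.2.1, hexp⟩
  have hA0 : 0 < astar := hastar ▸ integral_groundState_pos hQ
  have hlim : Tendsto xa (𝓝[<] astar) (𝓝 0) := by
    rw [Metric.tendsto_nhds]
    intro ε hε
    obtain ⟨K, hK⟩ := exists_norm_lt (V := V) (Ω := Ω) hA0 (fun _ => hCV.exists_le)
      (fun _ => hCV.exists_pos_le hΩ hsub) hε
    filter_upwards [eventually_peak hQ hT hastar hmin hxa K] with a ha
    rw [dist_zero_right]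
    exact hK a (u a) (xa a) ha.1 ha.2
  refine ⟨⟨1, ?_⟩, ?_, hlim⟩
  · filter_upwards [hlim (closedBall_mem_nhds 0 one_pos)] with a ha
    exact mem_closedBall_zero_iff.1 ha
  · have := (hCV.continuous.tendsto 0).comp hlim
    rwa [(hCV.2.2.1 0).2 rfl] at this

end
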